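/- arXiv:2108.07475 — 2 statements merged into one kernel-verified Lean document; each statement's English description precedes it below -/
import Mathlib

section
/- There exists c₀ > 0 such that for every c ≥ c₀ the following holds: with A_c = {ζ ∈ ℂ : 1 < |ζ| < e^c}, there exists a holomorphic map Π : ℂ × A_c → ℂ² whose image is Ω'_c and which is a covering map onto Ω'_c (i.e. the corestriction of Π to Ω'_c is a topological covering map). In other words, the covering space of Ω'_c corresponding to the subgroup ℤ of π₁(Ω'_c) ≅ ℤ[1/d] is biholomorphic to the product ℂ × A_c. -/
open Filter Topology Set

noncomputable section

lemma isCoveringMap_of_homeos {E X : Type*} [TopologicalSpace E] [TopologicalSpace X] (f : E → X)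
    (hcont : Continuous f) (hopen : IsOpenMap f) (hsurj : Function.Surjective f)
    (hinj : ∀ e, ∃ U ∈ 𝓝 e, InjOn f U) (S : Subgroup (E ≃ₜ E))
    (h1 : ∀ g ∈ S, ∀ e, f (g e) = f e) (h2 : ∀ e e', f e = f e' → ∃ g ∈ S, g e' = e)
    (h3 : ∀ g ∈ S, ∀ e, g e = e → g = 1) : IsCoveringMap f := by
  let _ : MulAction S E :=
    { smul := fun g e => g.1 e
      one_smul := fun e => rfl
      mul_smul := fun g h e => rfl }
  have hsm : ∀ (g : S) (e : E), g • e = g.1 e := fun _ _ => rfl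
  have : IsQuotientCoveringMap f S :=
    { toIsQuotientMap := hopen.isQuotientMap hcont hsurj
      continuous_const_smul := fun g => g.1.continuous
      apply_eq_iff_mem_orbit := by
        intro e e'
        constructor
        · intro h
          obtain ⟨g, hg, h⟩ := h2 _ _ h
          exact ⟨⟨g, hg⟩, h⟩
        · rintro ⟨g, rfl⟩
          exact h1 g.1 g.2 e'
      disjoint := by
        intro e
        obtain ⟨U, hU, hi⟩ := hinj e
        refine ⟨U, hU, ?_⟩
        rintro g ⟨x, ⟨y, hy, rfl⟩, hx⟩
        have := hi hx hy (h1 g.1 g.2 y)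
        exact Subtype.ext (h3 g.1 g.2 y this) }
  exact this.isCoveringMap

/-- The topological part. -/
lemma covering_of_model (d : ℕ) (hd : 2 ≤ d) (b : ℂ) (hb : b ≠ 0) (Q : ℂ → ℂ)
    (hQ : Differentiable ℂ Q) (H K : ℂ × ℂ → ℂ × ℂ) (hKd : Differentiable ℂ K)
    (hHc : Continuous H)
    (hHK : ∀ z, H (K z) = z) (hKH : ∀ z, K (H z) = z)
    (F : ℂ × ℂ → ℂ × ℂ) (hF : ∀ w, F w = (b * w.1 + Q w.2, w.2 ^ d))
    (W : Set (ℂ × ℂ)) (hWo : IsOpen W) (hWF : ∀ w ∈ W, F w ∈ W)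
    (Ψ : ℂ × ℂ → ℂ × ℂ) (hΨd : DifferentiableOn ℂ Ψ W) (hΨi : InjOn Ψ W)
    (hΨn : ∀ w ∈ W, map Ψ (𝓝 w) = 𝓝 (Ψ w)) (hΨF : ∀ w ∈ W, Ψ (F w) = H (Ψ w))
    (hesc : ∀ w : ℂ × ℂ, 1 < ‖w.2‖ → ∃ n, F^[n] w ∈ W)
    (hW1 : ∀ w ∈ W, 1 < ‖w.2‖)
    (G : ℂ × ℂ → ℝ) (hGH : ∀ z, G (H z) = d * G z)
    (hGΨ : ∀ w ∈ W, G (Ψ w) = Real.log ‖w.2‖)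
    (hGs : ∀ z, 0 < G z → ∃ n, H^[n] z ∈ Ψ '' W) (c : ℝ) :
    ∃ (P : ℂ × ℂ → ℂ × ℂ)
        (hmaps : Set.MapsTo P
          ((Set.univ : Set ℂ) ×ˢ {ζ : ℂ | 1 < ‖ζ‖ ∧ ‖ζ‖ < Real.exp c})
          {z : ℂ × ℂ | 0 < G z ∧ G z < c}),
        DifferentiableOn ℂ P
          ((Set.univ : Set ℂ) ×ˢ {ζ : ℂ | 1 < ‖ζ‖ ∧ ‖ζ‖ < Real.exp c}) ∧
        P '' ((Set.univ : Set ℂ) ×ˢ {ζ : ℂ | 1 < ‖ζ‖ ∧ ‖ζ‖ < Real.exp c}) =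
          {z : ℂ × ℂ | 0 < G z ∧ G z < c} ∧
        IsCoveringMap
          (Set.MapsTo.restrict P
            ((Set.univ : Set ℂ) ×ˢ {ζ : ℂ | 1 < ‖ζ‖ ∧ ‖ζ‖ < Real.exp c})
            {z : ℂ × ℂ | 0 < G z ∧ G z < c} hmaps) := by
  classical
  -- the iterates of F
  have hFn : ∀ n : ℕ, ∃ q : ℂ → ℂ, Differentiable ℂ q ∧
      ∀ w, F^[n] w = (b ^ n * w.1 + q w.2, w.2 ^ (d ^ n)) := by
    intro n
    induction n with
    | zero => exact ⟨fun _ => 0, by fun_prop, fun w => by simp⟩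
    | succ n ih =>
      obtain ⟨q, hq, h⟩ := ih
      refine ⟨fun ζ => b * q ζ + Q (ζ ^ d ^ n), by fun_prop, fun w => ?_⟩
      rw [Function.iterate_succ_apply', h, hF]
      refine Prod.ext ?_ ?_
      · simp only []; ring
      · simp only []; rw [← pow_mul, pow_succ]
  choose q hqd hFq using hFn
  have hFn2 : ∀ n w, (F^[n] w).2 = w.2 ^ (d ^ n) := fun n w => by rw [hFq]
  have hFnc : ∀ n, Differentiable ℂ (F^[n]) := by
    intro n
    have : F^[n] = fun w => (b ^ n * w.1 + q n w.2, w.2 ^ (d ^ n)) := funext (hFq n)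
    rw [this]
    have := hqd n
    fun_prop
  have hWFn : ∀ n, ∀ w ∈ W, F^[n] w ∈ W := by
    intro n
    induction n with
    | zero => exact fun w hw => hw
    | succ n ih => intro w hw; rw [Function.iterate_succ_apply']; exact hWF _ (ih w hw)
  have hWmono : ∀ m n w, m ≤ n → F^[m] w ∈ W → F^[n] w ∈ W := by
    intro m n w hmn h
    obtain ⟨k, rfl⟩ := Nat.exists_eq_add_of_le' hmn
    rw [Function.iterate_add_apply]; exact hWFn k _ h
  have hΨFn : ∀ n, ∀ w ∈ W, Ψ (F^[n] w) = H^[n] (Ψ w) := by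
    intro n
    induction n with
    | zero => exact fun w hw => rfl
    | succ n ih =>
      intro w hw
      rw [Function.iterate_succ_apply', Function.iterate_succ_apply', hΨF _ (hWFn n w hw), ih w hw]
  have hKHn : ∀ n z, K^[n] (H^[n] z) = z := fun n => Function.LeftInverse.iterate hKH n
  have hHKn : ∀ n z, H^[n] (K^[n] z) = z := fun n => Function.LeftInverse.iterate hHK n
  -- P
  let P : ℂ × ℂ → ℂ × ℂ := fun w =>
    if h : ∃ n, F^[n] w ∈ W then K^[Nat.find h] (Ψ (F^[Nat.find h] w)) else 0
  have hHP : ∀ n w, F^[n] w ∈ W → H^[n] (P w) = Ψ (F^[n] w) := by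
    intro n w hn
    have h : ∃ n, F^[n] w ∈ W := ⟨n, hn⟩
    have hm := Nat.find_spec h
    have hmn : Nat.find h ≤ n := Nat.find_min' h hn
    have hP : P w = K^[Nat.find h] (Ψ (F^[Nat.find h] w)) := dif_pos h
    rw [hP]
    obtain ⟨k, hk⟩ := Nat.exists_eq_add_of_le' hmn
    generalize Nat.find h = m at *
    subst hk
    rw [Function.iterate_add_apply, hHKn, Function.iterate_add_apply, hΨFn k _ hm]
  have hPK : ∀ n w, F^[n] w ∈ W → P w = K^[n] (Ψ (F^[n] w)) := by
    intro n w hn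
    rw [← hHP n w hn, hKHn]
  have hGHn : ∀ n z, G (H^[n] z) = (d : ℝ) ^ n * G z := by
    intro n z
    induction n with
    | zero => simp
    | succ n ih => rw [Function.iterate_succ_apply', hGH, ih]; ring
  have hd0 : (0 : ℝ) < d := by positivity
  have hGP : ∀ w : ℂ × ℂ, 1 < ‖w.2‖ → G (P w) = Real.log ‖w.2‖ := by
    intro w hw
    obtain ⟨n, hn⟩ := hesc w hw
    have := hGHn n (P w)
    rw [hHP n w hn, hGΨ _ hn, hFn2, norm_pow, Real.log_pow] at this
    have h2 : (d : ℝ) ^ n ≠ 0 := by positivity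
    push_cast at this
    exact (mul_left_cancel₀ h2 this).symm
  have hPeq : ∀ w w' : ℂ × ℂ, 1 < ‖w.2‖ → 1 < ‖w'.2‖ → P w = P w' →
      ∃ n, F^[n] w = F^[n] w' := by
    intro w w' hw hw' h
    obtain ⟨n, hn⟩ := hesc w hw
    obtain ⟨n', hn'⟩ := hesc w' hw'
    refine ⟨max n n', ?_⟩
    have h1 := hWmono _ _ _ (le_max_left n n') hn
    have h2 := hWmono _ _ _ (le_max_right n n') hn'
    apply hΨi h1 h2
    rw [← hHP _ _ h1, ← hHP _ _ h2, h]
  have hPeq' : ∀ (w w' : ℂ × ℂ) (n : ℕ), 1 < ‖w.2‖ → F^[n] w = F^[n] w' → P w = P w' := by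
    intro w w' n hw h
    obtain ⟨m, hm⟩ := hesc w hw
    have h1 := hWmono _ _ _ (le_max_left m n) hm
    have h3 : F^[max m n] w = F^[max m n] w' := by
      obtain ⟨k, hk⟩ := Nat.exists_eq_add_of_le' (le_max_right m n)
      rw [hk, Function.iterate_add_apply, Function.iterate_add_apply, h]
    rw [hPK _ _ h1, hPK _ w' (h3 ▸ h1), h3]
  -- local structure
  have hPloc : ∀ w : ℂ × ℂ, 1 < ‖w.2‖ → ∃ n, F^[n] w ∈ W ∧
      ∀ᶠ w' in 𝓝 w, F^[n] w' ∈ W ∧ P w' = K^[n] (Ψ (F^[n] w')) := by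
    intro w hw
    obtain ⟨n, hn⟩ := hesc w hw
    refine ⟨n, hn, ?_⟩
    have : ∀ᶠ w' in 𝓝 w, F^[n] w' ∈ W :=
      (hFnc n).continuous.continuousAt.eventually_mem (hWo.mem_nhds hn)
    filter_upwards [this] with w' h
    exact ⟨h, hPK n w' h⟩
  have hPd : ∀ w : ℂ × ℂ, 1 < ‖w.2‖ → DifferentiableAt ℂ P w := by
    intro w hw
    obtain ⟨n, hn, h⟩ := hPloc w hw
    have h1 : DifferentiableAt ℂ (fun w' => K^[n] (Ψ (F^[n] w'))) w := by
      have hk : DifferentiableAt ℂ (K^[n]) (Ψ (F^[n] w)) := (hKd.iterate n) _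
      have hp : DifferentiableAt ℂ Ψ (F^[n] w) := hΨd.differentiableAt (hWo.mem_nhds hn)
      have hf : DifferentiableAt ℂ (F^[n]) w := (hFnc n) w
      exact hk.comp w (hp.comp w hf)
    exact h1.congr_of_eventuallyEq (h.mono fun _ h => h.2)
  have hpows : ∀ (m : ℕ), m ≠ 0 → ∀ ζ : ℂ, ζ ≠ 0 →
      HasStrictDerivAt (fun x : ℂ => x ^ m) ((m : ℂ) * ζ ^ (m - 1)) ζ := by
    intro m hm ζ hζ
    exact hasStrictDerivAt_pow m ζ
  have hdn : ∀ n : ℕ, d ^ n ≠ 0 := fun n => by positivity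
  have hpow0 : ∀ (m : ℕ), m ≠ 0 → ∀ ζ : ℂ, ζ ≠ 0 → ((m : ℂ) * ζ ^ (m - 1)) ≠ 0 := by
    intro m hm ζ hζ
    exact mul_ne_zero (by exact_mod_cast hm) (pow_ne_zero _ hζ)
  have hne : ∀ ζ : ℂ, 1 < ‖ζ‖ → ζ ≠ 0 := by
    rintro ζ h rfl
    simp at h
    linarith
  have hFnhds : ∀ n (w : ℂ × ℂ), 1 < ‖w.2‖ → map (F^[n]) (𝓝 w) = 𝓝 (F^[n] w) := by
    intro n w hw
    have hbn : b ^ n ≠ 0 := pow_ne_zero n hb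
    have hqc : Continuous (q n) := (hqd n).continuous
    let sh : ℂ × ℂ ≃ₜ ℂ × ℂ :=
      { toFun := fun w => (b ^ n * w.1 + q n w.2, w.2)
        invFun := fun w => ((w.1 - q n w.2) / b ^ n, w.2)
        left_inv := fun w => by
          refine Prod.ext ?_ rfl
          simp only []
          field_simp
          ring
        right_inv := fun w => by
          refine Prod.ext ?_ rfl
          simp only []
          field_simp
          ring
        continuous_toFun := by fun_prop
        continuous_invFun := by fun_prop }
    have h1 : F^[n] = (Prod.map id (fun x : ℂ => x ^ (d ^ n))) ∘ sh := by
      funext w; rw [hFq]; rfl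
    have h2 := (hpows (d ^ n) (hdn n) w.2 (hne _ hw)).map_nhds_eq (hpow0 _ (hdn n) _ (hne _ hw))
    rw [h1, ← Filter.map_map, sh.map_nhds_eq]
    have h3 : sh w = (b ^ n * w.1 + q n w.2, w.2) := rfl
    simp only [Function.comp, h3]
    rw [nhds_prod_eq, ← Filter.prod_map_map_eq', h2, Filter.map_id, ← nhds_prod_eq]
    rfl
  have hKnhds : ∀ n z, map (K^[n]) (𝓝 z) = 𝓝 (K^[n] z) := by
    intro n z
    let e : ℂ × ℂ ≃ₜ ℂ × ℂ :=
      { toFun := K^[n]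
        invFun := H^[n]
        left_inv := hHKn n
        right_inv := hKHn n
        continuous_toFun := hKd.continuous.iterate n
        continuous_invFun := hHc.iterate n }
    exact e.map_nhds_eq z
  have hPnhds : ∀ w : ℂ × ℂ, 1 < ‖w.2‖ → map P (𝓝 w) = 𝓝 (P w) := by
    intro w hw
    obtain ⟨n, hn, h⟩ := hPloc w hw
    have h1 : P =ᶠ[𝓝 w] (K^[n] ∘ Ψ ∘ F^[n]) := h.mono fun _ h => h.2
    rw [Filter.map_congr h1, h1.self_of_nhds, ← Filter.map_map, ← Filter.map_map, hFnhds n w hw,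
      hΨn _ hn, hKnhds]
    rfl
  have hPinj : ∀ w : ℂ × ℂ, 1 < ‖w.2‖ → ∃ U ∈ 𝓝 w, InjOn P U := by
    intro w hw
    obtain ⟨n, hn, h⟩ := hPloc w hw
    have hli := (hpows (d ^ n) (hdn n) w.2 (hne _ hw)).eventually_left_inverse
      (hpow0 _ (hdn n) _ (hne _ hw))
    have hli' := (continuous_snd.tendsto w).eventually hli
    refine ⟨_, h.and hli', ?_⟩
    rintro x ⟨⟨hx1, hx2⟩, hx3⟩ y ⟨⟨hy1, hy2⟩, hy3⟩ hxy
    have e1 : F^[n] x = F^[n] y := by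
      apply hΨi hx1 hy1
      rw [← hHP _ _ hx1, ← hHP _ _ hy1, hxy]
    rw [hFq, hFq, Prod.mk.injEq] at e1
    have e2 : x.2 = y.2 := by
      rw [← hx3, ← hy3, e1.2]
    have e3 := e1.1
    rw [e2] at e3
    have e4 : x.1 = y.1 := mul_left_cancel₀ (pow_ne_zero n hb) (add_right_cancel e3)
    exact Prod.ext e4 e2
  -- surjectivity
  have hPs : ∀ z, 0 < G z → ∃ w : ℂ × ℂ, 1 < ‖w.2‖ ∧ P w = z := by
    intro z hz
    obtain ⟨n, w', hw', hw'z⟩ := hGs z hz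
    obtain ⟨ζ, hζ⟩ := IsAlgClosed.exists_pow_nat_eq w'.2 (Nat.pos_of_ne_zero (hdn n))
    have h1 : 1 < ‖ζ‖ := by
      have := hW1 _ hw'
      rw [← hζ, norm_pow] at this
      by_contra hcon
      exact absurd (pow_le_one₀ (norm_nonneg _) (not_lt.mp hcon)) (not_le.mpr this)
    refine ⟨((w'.1 - q n ζ) / b ^ n, ζ), h1, ?_⟩
    have h2 : F^[n] ((w'.1 - q n ζ) / b ^ n, ζ) = w' := by
      rw [hFq]
      refine Prod.ext ?_ hζ
      have := pow_ne_zero n hb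
      simp only []
      field_simp
      ring
    rw [hPK n _ (by rw [h2]; exact hw'), h2, hw'z, hKHn]
  set A : Set ℂ := {ζ : ℂ | 1 < ‖ζ‖ ∧ ‖ζ‖ < Real.exp c} with hA
  have hGlt : ∀ w : ℂ × ℂ, 1 < ‖w.2‖ → (w.2 ∈ A ↔ (0 < G (P w) ∧ G (P w) < c)) := by
    intro w hw
    rw [hGP w hw, Real.log_lt_iff_lt_exp (by linarith), hA]
    simp only [mem_setOf_eq]
    exact ⟨fun h => ⟨Real.log_pos h.1, h.2⟩, fun h => ⟨hw, h.2⟩⟩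
  have hmaps : MapsTo P ((Set.univ : Set ℂ) ×ˢ A) {z : ℂ × ℂ | 0 < G z ∧ G z < c} := by
    rintro w ⟨-, hw⟩
    exact (hGlt w hw.1).1 hw
  have himg : P '' ((Set.univ : Set ℂ) ×ˢ A) = {z : ℂ × ℂ | 0 < G z ∧ G z < c} := by
    apply Subset.antisymm (image_subset_iff.2 hmaps)
    rintro z hz
    obtain ⟨w, hw, rfl⟩ := hPs z hz.1
    exact ⟨w, ⟨trivial, (hGlt w hw).2 hz⟩, rfl⟩
  refine ⟨P, hmaps, fun w hw => (hPd w hw.2.1).differentiableWithinAt, himg, ?_⟩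
  have hAo : IsOpen A := by
    rw [hA]
    exact (isOpen_lt continuous_const continuous_norm).inter
      (isOpen_lt continuous_norm continuous_const)
  have hEo : IsOpen ((Set.univ : Set ℂ) ×ˢ A) := isOpen_univ.prod hAo
  set E : Set (ℂ × ℂ) := (Set.univ : Set ℂ) ×ˢ A with hE
  have hPco : ContinuousOn P E := fun w hw => (hPd w hw.2.1).continuousAt.continuousWithinAt
  let S : Subgroup (E ≃ₜ E) :=
    { carrier := {g | (∀ e, P (g e) = P e) ∧ ∃ l : ℂ, l ≠ 0 ∧ ∀ e : E, (g e).1.2 = l * e.1.2}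
      mul_mem' := by
        rintro g h ⟨hg, l, hl, hgl⟩ ⟨hh, l', hl', hhl⟩
        refine ⟨fun e => ?_, l * l', mul_ne_zero hl hl', fun e => ?_⟩
        · rw [Homeomorph.mul_apply, hg, hh]
        · rw [Homeomorph.mul_apply, hgl, hhl, mul_assoc]
      one_mem' := ⟨fun e => rfl, 1, one_ne_zero, fun e => by simp⟩
      inv_mem' := by
        rintro g ⟨hg, l, hl, hgl⟩
        have key : ∀ e, g (g⁻¹ e) = e := fun e => g.apply_symm_apply e
        refine ⟨fun e => ?_, l⁻¹, inv_ne_zero hl, fun e => ?_⟩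
        · rw [← hg, key]
        · have := hgl (g⁻¹ e)
          rw [key] at this
          rw [this]; field_simp }
  apply isCoveringMap_of_homeos _ _ _ _ _ S
  · rintro g ⟨hg, -⟩ e
    exact Subtype.ext (hg e)
  · intro e e' h
    have h : P e.1 = P e'.1 := congrArg Subtype.val h
    obtain ⟨n, hn⟩ := hPeq _ _ e.2.2.1 e'.2.2.1 h
    have hn2 : e.1.2 ^ d ^ n = e'.1.2 ^ d ^ n := by
      rw [← hFn2, ← hFn2, hn]
    have hbn : b ^ n ≠ 0 := pow_ne_zero n hb
    have hqc : Continuous (q n) := (hqd n).continuous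
    have he'0 := hne _ e'.2.2.1
    have he0 := hne _ e.2.2.1
    obtain ⟨l, hl⟩ : ∃ l, l = e.1.2 / e'.1.2 := ⟨_, rfl⟩
    have hl0 : l ≠ 0 := by rw [hl]; exact div_ne_zero he0 he'0
    have hlm : l ^ d ^ n = 1 := by
      rw [hl, div_pow, hn2, div_self (pow_ne_zero _ he'0)]
    have hln : ‖l‖ = 1 := by
      have : ‖l‖ ^ d ^ n = 1 := by rw [← norm_pow, hlm, norm_one]
      exact (pow_eq_one_iff_of_nonneg (norm_nonneg _) (hdn n)).1 this
    let g : E ≃ₜ E :=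
      { toFun := fun w => ⟨(w.1.1 + (q n w.1.2 - q n (l * w.1.2)) / b ^ n, l * w.1.2), trivial, by
          have := w.2.2
          simpa [hA, hln] using this⟩
        invFun := fun w => ⟨(w.1.1 + (q n w.1.2 - q n (l⁻¹ * w.1.2)) / b ^ n, l⁻¹ * w.1.2), trivial, by
          have := w.2.2
          simpa [hA, hln] using this⟩
        left_inv := fun w => by
          apply Subtype.ext
          refine Prod.ext ?_ ?_
          · simp only [inv_mul_cancel_left₀ hl0]
            ring
          · simp only [inv_mul_cancel_left₀ hl0]
        right_inv := fun w => by
          apply Subtype.ext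
          refine Prod.ext ?_ ?_
          · simp only [mul_inv_cancel_left₀ hl0]
            ring
          · simp only [mul_inv_cancel_left₀ hl0]
        continuous_toFun := by fun_prop
        continuous_invFun := by fun_prop }
    have hg1 : ∀ w : E, (g w).1 = (w.1.1 + (q n w.1.2 - q n (l * w.1.2)) / b ^ n, l * w.1.2) :=
      fun w => rfl
    refine ⟨g, ⟨fun w => ?_, l, hl0, fun w => rfl⟩, ?_⟩
    · refine hPeq' _ _ n (g w).2.2.1 ?_
      rw [hg1, hFq, hFq]
      refine Prod.ext ?_ ?_
      · simp only []
        field_simp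
        ring
      · simp only []
        rw [mul_pow, hlm, one_mul]
    · apply Subtype.ext
      rw [hg1]
      have e2 : l * e'.1.2 = e.1.2 := by rw [hl]; field_simp
      refine Prod.ext ?_ e2
      rw [hFq, hFq, Prod.mk.injEq] at hn
      simp only [e2]
      have := hn.1
      field_simp
      linear_combination -this
  · rintro g ⟨hg, l, hl, hgl⟩ e hge
    have h1 : l = 1 := by
      have := hgl e
      rw [hge] at this
      exact (mul_right_cancel₀ (hne _ e.2.2.1) (by rw [one_mul]; exact this)).symm
    ext w : 1
    apply Subtype.ext
    have h2 : (g w).1.2 = w.1.2 := by rw [hgl, h1, one_mul]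
    refine Prod.ext ?_ h2
    obtain ⟨n, hn⟩ := hPeq _ _ (g w).2.2.1 w.2.2.1 (hg w)
    rw [hFq, hFq, Prod.mk.injEq, h2] at hn
    exact mul_left_cancel₀ (pow_ne_zero n hb) (add_right_cancel hn.1)
  · exact hPco.mapsToRestrict hmaps
  · intro O hO
    rw [isOpen_iff_mem_nhds]
    rintro _ ⟨w, hw, rfl⟩
    rw [nhds_subtype_eq_comap, Filter.mem_comap]
    refine ⟨P '' (Subtype.val '' O), ?_, ?_⟩
    · have h1 : Subtype.val '' O ∈ 𝓝 w.1 := (hEo.isOpenMap_subtype_val O hO).mem_nhds ⟨w, hw, rfl⟩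
      have := Filter.image_mem_map (m := P) h1
      rwa [hPnhds _ w.2.2.1] at this
    · rintro z ⟨_, ⟨w', hw', rfl⟩, hz⟩
      exact ⟨w', hw', Subtype.ext hz⟩
  · rintro ⟨z, hz⟩
    rw [← himg] at hz
    obtain ⟨w, hw, rfl⟩ := hz
    exact ⟨⟨w, hw⟩, rfl⟩
  · intro e
    obtain ⟨U, hU, hi⟩ := hPinj e.1 e.2.2.1
    refine ⟨Subtype.val ⁻¹' U, continuous_subtype_val.continuousAt.preimage_mem_nhds hU, ?_⟩
    intro x hx y hy hxy
    exact Subtype.ext (hi hx hy (congrArg Subtype.val hxy))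


lemma lim_diff (U : Set (ℂ × ℂ)) (hU : IsOpen U) (f : ℕ → ℂ × ℂ → ℂ) (g : ℂ × ℂ → ℂ)
    (hf : ∀ n, DifferentiableOn ℂ (f n) U)
    (hb : ∀ z ∈ U, ∃ V ∈ 𝓝 z, ∃ u : ℕ → ℝ, Summable u ∧
      ∀ n, ∀ z' ∈ V, ‖f (n + 1) z' - f n z'‖ ≤ u n)
    (hg : ∀ z ∈ U, Tendsto (fun n => f n z) atTop (𝓝 (g z))) :
    DifferentiableOn ℂ g U := by
  intro z hz
  obtain ⟨V, hV, u, hu, hfu⟩ := hb z hz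
  obtain ⟨r, hr, hrV⟩ := Metric.mem_nhds_iff.1 (Filter.inter_mem hV (hU.mem_nhds hz))
  set s := Metric.ball z (r / 2) with hs
  have hsub : ∀ x ∈ s, Metric.ball x (r / 2) ⊆ V ∩ U := by
    intro x hx y hy
    apply hrV
    rw [hs, Metric.mem_ball] at hx
    rw [Metric.mem_ball] at hy ⊢
    calc dist y z ≤ dist y x + dist x z := dist_triangle _ _ _
      _ < r := by linarith
  have hself : ∀ x ∈ s, x ∈ V ∩ U := fun x hx => hsub x hx (Metric.mem_ball_self (by linarith))
  have hdz : z ∈ s := Metric.mem_ball_self (by linarith)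
  have hD : ∀ n, ∀ x ∈ s, DifferentiableAt ℂ (fun y => f (n + 1) y - f n y) x := by
    intro n x hx
    have h1 := hU.mem_nhds (hself x hx).2
    exact ((hf (n + 1)).differentiableAt h1).sub ((hf n).differentiableAt h1)
  have hsum : ∀ x ∈ s, HasSum (fun n => f (n + 1) x - f n x) (g x - f 0 x) := by
    intro x hx
    have h1 : Summable (fun n => f (n + 1) x - f n x) :=
      Summable.of_norm_bounded hu (fun n => hfu n x (hself x hx).1)
    rw [h1.hasSum_iff_tendsto_nat]
    simp_rw [Finset.sum_range_sub (fun n => f n x)]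
    exact (hg x (hself x hx).2).sub_const _
  have h := hasFDerivAt_tsum_of_isPreconnected (𝕜 := ℂ)
    (f := fun n y => f (n + 1) y - f n y)
    (f' := fun n => fderiv ℂ (fun y => f (n + 1) y - f n y))
    (u := fun n => (2 * u n) / (r / 2)) (s := s) (x₀ := z) (x := z)
    ((hu.mul_left 2).div_const _) Metric.isOpen_ball
    (convex_ball z (r / 2)).isPreconnected
    (fun n x hx => (hD n x hx).hasFDerivAt)
    (fun n x hx => by
      apply Complex.norm_fderiv_le_div_of_mapsTo_ball
      · intro y hy
        have h1 := hU.mem_nhds (hsub x hx hy).2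
        exact (((hf (n + 1)).differentiableAt h1).sub
          ((hf n).differentiableAt h1)).differentiableWithinAt
      · intro y hy
        rw [Metric.mem_closedBall, dist_eq_norm]
        have h1 := hfu n y (hsub x hx hy).1
        have h2 := hfu n x (hself x hx).1
        calc _ ≤ ‖f (n + 1) y - f n y‖ + ‖f (n + 1) x - f n x‖ := norm_sub_le _ _
          _ ≤ 2 * u n := by linarith
      · linarith)
    hdz (hsum z hdz).summable hdz
  have h2 : (fun y => (∑' n, (f (n + 1) y - f n y)) + f 0 y) =ᶠ[𝓝 z] g := by
    filter_upwards [Metric.ball_mem_nhds z (by linarith : 0 < r / 2)] with y hy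
    rw [(hsum y hy).tsum_eq]; ring
  have h3 := h.differentiableAt.add ((hf 0).differentiableAt (hU.mem_nhds hz))
  exact (h3.congr_of_eventuallyEq h2.symm).differentiableWithinAt

lemma strict_of_diffOn {F : Type*} [NormedAddCommGroup F] [NormedSpace ℂ F]
    (U : Set (ℂ × ℂ)) (hU : IsOpen U) (f : ℂ × ℂ → F)
    (hf : DifferentiableOn ℂ f U) (z : ℂ × ℂ) (hz : z ∈ U) :
    HasStrictFDerivAt f (fderiv ℂ f z) z := by
  apply hasStrictFDerivAt_of_hasFDerivAt_of_continuousAt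
  · filter_upwards [hU.mem_nhds hz] with y hy
    exact (hf.differentiableAt (hU.mem_nhds hy)).hasFDerivAt
  obtain ⟨r, hr, hrU⟩ := Metric.nhds_basis_closedBall.mem_iff.1 (hU.mem_nhds hz)
  have hK : IsCompact (Metric.closedBall z r) := isCompact_closedBall z r
  have huc := hK.uniformContinuousOn_of_continuous (hf.continuousOn.mono hrU)
  rw [Metric.uniformContinuousOn_iff] at huc
  rw [Metric.continuousAt_iff]
  intro ε hε
  obtain ⟨δ, hδ, h⟩ := huc (ε * (r / 2) / 4) (by positivity)
  refine ⟨min δ (r / 2), by positivity, fun {x} hx => ?_⟩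
  have hx1 : dist x z < δ := lt_of_lt_of_le hx (min_le_left _ _)
  have hx2 : dist x z < r / 2 := lt_of_lt_of_le hx (min_le_right _ _)
  have hzb : ∀ y ∈ Metric.ball z (r / 2), y ∈ Metric.closedBall z r ∧
      y + (x - z) ∈ Metric.closedBall z r := by
    intro y hy
    rw [Metric.mem_ball, dist_eq_norm] at hy
    rw [dist_eq_norm] at hx2
    rw [Metric.mem_closedBall, Metric.mem_closedBall, dist_eq_norm, dist_eq_norm]
    refine ⟨by linarith, ?_⟩
    calc ‖y + (x - z) - z‖ = ‖(y - z) + (x - z)‖ := by congr 1; abel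
      _ ≤ ‖y - z‖ + ‖x - z‖ := norm_add_le _ _
      _ ≤ r := by linarith
  have hxU : x ∈ U := hrU (Metric.mem_closedBall.2 (by linarith))
  have h1 : HasFDerivAt (fun y => f (y + (x - z)) - f y) (fderiv ℂ f x - fderiv ℂ f z) z := by
    apply HasFDerivAt.sub
    · have h2 : HasFDerivAt f (fderiv ℂ f x) (z + (x - z)) := by
        rw [add_sub_cancel]
        exact (hf.differentiableAt (hU.mem_nhds hxU)).hasFDerivAt
      have h3 : HasFDerivAt (fun y : ℂ × ℂ => y + (x - z)) (ContinuousLinearMap.id ℂ (ℂ × ℂ)) z :=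
        (hasFDerivAt_id z).add_const _
      exact h2.comp z h3
    · exact (hf.differentiableAt (hU.mem_nhds hz)).hasFDerivAt
  have hd : ∀ y ∈ Metric.ball z (r / 2), ‖f (y + (x - z)) - f y‖ < ε * (r / 2) / 4 := by
    intro y hy
    rw [← dist_eq_norm]
    apply h _ (hzb y hy).2 _ (hzb y hy).1
    rw [dist_eq_norm, add_sub_cancel_left, ← dist_eq_norm]; exact hx1
  have hz0 : z ∈ Metric.ball z (r / 2) := Metric.mem_ball_self (by linarith)
  have h4 : ‖fderiv ℂ (fun y => f (y + (x - z)) - f y) z‖ ≤ (ε * (r / 2) / 2) / (r / 2) := by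
    apply Complex.norm_fderiv_le_div_of_mapsTo_ball
    · intro y hy
      have h5 := hf.differentiableAt (hU.mem_nhds (hrU (hzb y hy).1))
      have h6 := hf.differentiableAt (hU.mem_nhds (hrU (hzb y hy).2))
      have h7 : DifferentiableAt ℂ (fun y : ℂ × ℂ => y + (x - z)) y := by fun_prop
      exact ((h6.comp y h7).sub h5).differentiableWithinAt
    · intro y hy
      rw [Metric.mem_closedBall, dist_eq_norm]
      have := hd y hy
      have := hd z hz0
      calc _ ≤ ‖f (y + (x - z)) - f y‖ + ‖f (z + (x - z)) - f z‖ := norm_sub_le _ _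
        _ ≤ _ := by linarith
    · linarith
  rw [h1.fderiv] at h4
  rw [dist_eq_norm]
  have : ε * (r / 2) / 2 / (r / 2) = ε / 2 := by field_simp
  linarith

lemma skew_inv (f : ℂ × ℂ → ℂ) (U : Set (ℂ × ℂ)) (hU : IsOpen U) (hf : DifferentiableOn ℂ f U)
    (hinj : ∀ s s' t, (s, t) ∈ U → (s', t) ∈ U → f (s, t) = f (s', t) → s = s')
    (hder : ∀ s t, (s, t) ∈ U → ∃ c > 0, ∀ᶠ s' in 𝓝 s, c * ‖s' - s‖ ≤ ‖f (s', t) - f (s, t)‖) :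
    ∃ g : ℂ × ℂ → ℂ × ℂ, IsOpen ((fun z : ℂ × ℂ => (f z, z.2)) '' U) ∧
      (∀ z ∈ U, g (f z, z.2) = z) ∧
      DifferentiableOn ℂ g ((fun z : ℂ × ℂ => (f z, z.2)) '' U) ∧
      (∀ z ∈ U, map g (𝓝 (f z, z.2)) = 𝓝 z) := by
  set X : ℂ × ℂ → ℂ × ℂ := fun z => (f z, z.2) with hX
  have hXd : DifferentiableOn ℂ X U := hf.prodMk differentiableOn_snd
  have hXi : InjOn X U := by
    rintro ⟨s, t⟩ h ⟨s', t'⟩ h' e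
    simp only [hX, Prod.mk.injEq] at e
    obtain ⟨e1, rfl⟩ := e
    rw [hinj s s' t h h' e1]
  have hXe : ∀ z ∈ U, ∃ e : (ℂ × ℂ) ≃L[ℂ] (ℂ × ℂ),
      (e : (ℂ × ℂ) →L[ℂ] (ℂ × ℂ)) = fderiv ℂ X z := by
    rintro ⟨s, t⟩ hz
    have hfd := (hf.differentiableAt (hU.mem_nhds hz)).hasFDerivAt
    have h1 : fderiv ℂ X (s, t) = (fderiv ℂ f (s, t)).prod (ContinuousLinearMap.snd ℂ ℂ ℂ) :=
      (hfd.prodMk hasFDerivAt_snd).fderiv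
    have h2 : fderiv ℂ f (s, t) (1, 0) ≠ 0 := by
      intro h0
      obtain ⟨c, hc, hev⟩ := hder s t hz
      have h3 : HasDerivAt (fun s' : ℂ => f (s', t)) 0 s := by
        have h4 : HasDerivAt (fun s' : ℂ => (s', t)) (1, 0) s :=
          (hasDerivAt_id s).prodMk (hasDerivAt_const s t)
        have := hfd.comp_hasDerivAt s h4
        rwa [h0] at this
      have h5 := (hasDerivAt_iff_isLittleO.1 h3).def (by positivity : 0 < c / 2)
      have h6 := hev.and h5
      have h7 : ∃ᶠ s' in 𝓝 s, s' ≠ s := by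
        have : (𝓝[≠] s).NeBot := inferInstance
        exact frequently_iff_neBot.2 this
      obtain ⟨s', hs', h8, h9⟩ := (h7.and_eventually h6).exists
      simp only [smul_zero, sub_zero] at h9
      have : 0 < ‖s' - s‖ := norm_pos_iff.2 (sub_ne_zero.2 hs')
      nlinarith
    have h3 : Function.Injective (fderiv ℂ X (s, t)) := by
      rw [h1, injective_iff_map_eq_zero]
      rintro ⟨v, w⟩ hv
      simp only [ContinuousLinearMap.prod_apply, ContinuousLinearMap.coe_snd', Prod.mk_eq_zero] at hv
      obtain ⟨hv, rfl⟩ := hv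
      have : ((v, 0) : ℂ × ℂ) = v • (1, 0) := by simp
      rw [this, map_smul, smul_eq_mul, mul_eq_zero] at hv
      rw [hv.resolve_right h2]; rfl
    refine ⟨(LinearEquiv.ofInjectiveEndo (fderiv ℂ X (s, t)).toLinearMap h3).toContinuousLinearEquiv, ?_⟩
    ext v <;> rfl
  have hXn : ∀ z ∈ U, map X (𝓝 z) = 𝓝 (X z) := by
    intro z hz
    obtain ⟨e, he⟩ := hXe z hz
    have := strict_of_diffOn U hU X hXd z hz
    rw [← he] at this
    exact this.map_nhds_eq_of_equiv
  set g := Function.invFunOn X U with hg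
  have hgX : ∀ z ∈ U, g (X z) = z := fun z hz => hXi.leftInvOn_invFunOn hz
  have hop : IsOpen (X '' U) := by
    rw [isOpen_iff_mem_nhds]
    rintro _ ⟨z, hz, rfl⟩
    rw [← hXn z hz]
    exact image_mem_map (hU.mem_nhds hz)
  have hgn : ∀ z ∈ U, map g (𝓝 (X z)) = 𝓝 z := by
    intro z hz
    rw [← hXn z hz, Filter.map_map]
    have : g ∘ X =ᶠ[𝓝 z] id := by
      filter_upwards [hU.mem_nhds hz] with y hy
      exact hgX y hy
    rw [Filter.map_congr this, Filter.map_id]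
  refine ⟨g, hop, hgX, ?_, hgn⟩
  rintro _ ⟨z, hz, rfl⟩
  obtain ⟨e, he⟩ := hXe z hz
  have hc : ContinuousAt g (X z) := by
    unfold ContinuousAt
    rw [hgX z hz, Tendsto, hgn z hz]
  have h1 : HasFDerivAt X (e : (ℂ × ℂ) →L[ℂ] (ℂ × ℂ)) (g (X z)) := by
    rw [he, hgX z hz]
    exact (hXd.differentiableAt (hU.mem_nhds hz)).hasFDerivAt
  refine (HasFDerivAt.of_local_left_inverse hc h1 ?_).differentiableAt.differentiableWithinAt
  filter_upwards [hop.mem_nhds ⟨z, hz, rfl⟩] with y hy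
  obtain ⟨x, hx, rfl⟩ := hy
  rw [hgX x hx]

lemma laurent_base (q : ℂ → ℂ) (R B : ℝ)
    (hq : DifferentiableOn ℂ q {ζ | R < ‖ζ‖}) (hb : ∀ ζ, R < ‖ζ‖ → ‖q ζ‖ ≤ B) :
    ∃ (L : ℂ) (C R' : ℝ), 1 ≤ R' ∧ R ≤ R' ∧ ∀ ζ, R' < ‖ζ‖ → ‖q ζ - L‖ * ‖ζ‖ ≤ C := by
  set R0 := max R 1 with hR0
  have hR01 : 1 ≤ R0 := le_max_right _ _
  have hRR0 : R ≤ R0 := le_max_left _ _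
  set s := Metric.ball (0 : ℂ) R0⁻¹ with hs
  have hsw : ∀ w ∈ s \ {0}, R < ‖w⁻¹‖ := by
    rintro w ⟨hw, hw0⟩
    rw [hs, mem_ball_zero_iff] at hw
    have hw0' : 0 < ‖w‖ := norm_pos_iff.2 hw0
    rw [norm_inv]
    have : R0 < ‖w‖⁻¹ := by
      rw [lt_inv_comm₀ (by linarith) hw0']; exact hw
    linarith
  have h1 : DifferentiableOn ℂ (fun w => q w⁻¹) (s \ {0}) := by
    intro w hw
    have hw0 : w ≠ 0 := hw.2
    have ho : IsOpen {ζ : ℂ | R < ‖ζ‖} := isOpen_lt continuous_const continuous_norm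
    have h2 : DifferentiableAt ℂ q w⁻¹ := hq.differentiableAt (ho.mem_nhds (hsw w hw))
    exact (h2.comp w (differentiableAt_inv hw0)).differentiableWithinAt
  have hsn : s ∈ 𝓝 (0 : ℂ) := Metric.ball_mem_nhds _ (by positivity)
  have h2 := Complex.differentiableOn_update_limUnder_of_bddAbove hsn h1
    ⟨B, by rintro _ ⟨w, hw, rfl⟩; exact hb _ (hsw w hw)⟩
  set L := limUnder (𝓝[≠] (0 : ℂ)) (fun w => q w⁻¹) with hL
  have h3 := (h2.differentiableAt hsn).isBigO_sub
  obtain ⟨C, hC⟩ := h3.bound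
  obtain ⟨r, hr, hrC⟩ := Metric.eventually_nhds_iff.1 hC
  refine ⟨L, C, max R0 r⁻¹, le_trans hR01 (le_max_left _ _), le_trans hRR0 (le_max_left _ _),
    fun ζ hζ => ?_⟩
  have hζ1 : r⁻¹ < ‖ζ‖ := lt_of_le_of_lt (le_max_right _ _) hζ
  have hζp : 0 < ‖ζ‖ := lt_trans (by positivity) hζ1
  have hζ0 : ζ ≠ 0 := norm_pos_iff.1 hζp
  have h4 := hrC (y := ζ⁻¹) (by
    rw [dist_zero_right, norm_inv, inv_lt_comm₀ hζp hr]; exact hζ1)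
  rw [Function.update_of_ne (inv_ne_zero hζ0), Function.update_self, inv_inv, sub_zero,
    norm_inv] at h4
  calc ‖q ζ - L‖ * ‖ζ‖ ≤ (C * ‖ζ‖⁻¹) * ‖ζ‖ := by gcongr
    _ = C := by field_simp

/-- Polynomial part at infinity. -/
lemma laurent_split (q : ℂ → ℂ) (R B : ℝ) (m : ℕ)
    (hq : DifferentiableOn ℂ q {ζ | R < ‖ζ‖}) (hb : ∀ ζ, R < ‖ζ‖ → ‖q ζ‖ ≤ B * ‖ζ‖ ^ m) :
    ∃ (Q : Polynomial ℂ) (C R' : ℝ), ∀ ζ, R' < ‖ζ‖ → ‖q ζ - Q.eval ζ‖ * ‖ζ‖ ≤ C := by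
  induction m generalizing q B R with
  | zero =>
    obtain ⟨L, C, R', -, -, h⟩ := laurent_base q R B hq (fun ζ h => by simpa using hb ζ h)
    exact ⟨Polynomial.C L, C, R', fun ζ hζ => by simpa using h ζ hζ⟩
  | succ m ih =>
    have hR0 : ∀ ζ : ℂ, max R 1 < ‖ζ‖ → R < ‖ζ‖ ∧ 1 < ‖ζ‖ := fun ζ h =>
      ⟨lt_of_le_of_lt (le_max_left _ _) h, lt_of_le_of_lt (le_max_right _ _) h⟩
    have hne : ∀ ζ : ℂ, 1 < ‖ζ‖ → ζ ≠ 0 := by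
      rintro ζ h rfl
      simp at h
      linarith
    obtain ⟨L, C, R', h1, h2, h⟩ := laurent_base (fun ζ => q ζ / ζ ^ (m + 1)) (max R 1) B
      (by
        apply DifferentiableOn.div
        · exact hq.mono fun ζ h => (hR0 ζ h).1
        · fun_prop
        · intro ζ h
          exact pow_ne_zero _ (hne _ (hR0 ζ h).2))
      (fun ζ h => by
        have := hb ζ (hR0 ζ h).1
        have h3 := (hR0 ζ h).2
        rw [norm_div, norm_pow, div_le_iff₀ (by positivity)]
        exact this)
    have hR' : R ≤ R' := le_trans (le_max_left _ _) h2
    obtain ⟨Q, C', R'', hQ⟩ := ih (fun ζ => q ζ - L * ζ ^ (m + 1)) R' C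
      ((hq.mono fun ζ (h : R' < ‖ζ‖) => lt_of_le_of_lt hR' h).sub (by fun_prop))
      (fun ζ hζ => by
        have h3 := h ζ hζ
        have h4 : 1 < ‖ζ‖ := lt_of_le_of_lt h1 hζ
        have h5 := hne ζ h4
        have h6 : q ζ - L * ζ ^ (m + 1) = ((q ζ / ζ ^ (m + 1) - L) * ζ) * ζ ^ m := by
          field_simp
          ring
        rw [h6, norm_mul, norm_mul, norm_pow]
        gcongr)
    refine ⟨Q + Polynomial.C L * Polynomial.X ^ (m + 1), C', R'', fun ζ hζ => ?_⟩
    have := hQ ζ hζ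
    have h7 : q ζ - (Q + Polynomial.C L * Polynomial.X ^ (m + 1)).eval ζ =
      q ζ - L * ζ ^ (m + 1) - Q.eval ζ := by
      simp; ring
    rw [h7]; exact this


def Dset (R : ℝ) : Set (ℂ × ℂ) := {z | R < ‖z.2‖ ∧ ‖z.1‖ < 2 * ‖z.2‖}

def Tset (R : ℝ) : Set (ℂ × ℂ) := {w | R < ‖w.2‖ ∧ ‖w.1‖ < ‖w.2‖}

lemma isOpen_Dset (R : ℝ) : IsOpen (Dset R) :=
  by
  have h1 : IsOpen {z : ℂ × ℂ | R < ‖z.2‖} := isOpen_lt (by fun_prop) (by fun_prop)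
  have h2 : IsOpen {z : ℂ × ℂ | ‖z.1‖ < 2 * ‖z.2‖} := isOpen_lt (by fun_prop) (by fun_prop)
  exact h1.inter h2

lemma isOpen_Tset (R : ℝ) : IsOpen (Tset R) :=
  by
  have h1 : IsOpen {z : ℂ × ℂ | R < ‖z.2‖} := isOpen_lt (by fun_prop) (by fun_prop)
  have h2 : IsOpen {z : ℂ × ℂ | ‖z.1‖ < ‖z.2‖} := isOpen_lt (by fun_prop) (by fun_prop)
  exact h1.inter h2

lemma poly_lower (p : Polynomial ℂ) (d : ℕ) (hd : 1 ≤ d) (hpd : p.natDegree ≤ d) (y : ℂ)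
    (hy : 1 ≤ ‖y‖) : ‖p.eval y - p.coeff d * y ^ d‖ ≤
      (∑ i ∈ Finset.range d, ‖p.coeff i‖) * ‖y‖ ^ (d - 1) := by
  rw [Polynomial.eval_eq_sum_range' (Nat.lt_succ_of_le hpd), Finset.sum_range_succ,
    add_sub_cancel_right, Finset.sum_mul]
  refine (norm_sum_le _ _).trans (Finset.sum_le_sum fun i hi => ?_)
  rw [norm_mul, norm_pow]
  have := Finset.mem_range.1 hi
  gcongr
  omega

lemma exists_phi (d : ℕ) (hd : 2 ≤ d) (a : ℂ)
    (p : Polynomial ℂ) (hpm : p.Monic) (hpd : p.natDegree = d)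
    (H : ℂ × ℂ → ℂ × ℂ) (hH : ∀ z : ℂ × ℂ, H z = (z.2, p.eval z.2 - a * z.1)) :
    ∃ (R B : ℝ) (φ : ℂ × ℂ → ℂ), 1 ≤ R ∧ 1 ≤ B ∧ DifferentiableOn ℂ φ (Dset R) ∧
      (∀ z ∈ Dset R, ‖φ z - z.2‖ ≤ B) ∧ (∀ z ∈ Dset R, H z ∈ Dset R) ∧
      (∀ z ∈ Dset R, φ (H z) = φ z ^ d) ∧ (∀ z ∈ Dset R, 2 * ‖z.2‖ ≤ ‖(H z).2‖) := by
  set M : ℝ := (∑ i ∈ Finset.range d, ‖p.coeff i‖) + 2 * ‖a‖ with hM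
  have hM0 : 0 ≤ M := by positivity
  set R : ℝ := 4 + 4 * M with hR
  have hpos : ∀ z ∈ Dset R, 1 < ‖z.2‖ := fun z hz => by
    have := hz.1
    linarith
  have hne : ∀ z ∈ Dset R, z.2 ≠ 0 := fun z hz => norm_pos_iff.1 (by linarith [hpos z hz])
  let θ : ℂ × ℂ → ℂ := fun z => ((H z).2 - z.2 ^ d) / z.2 ^ d
  have hHd : Differentiable ℂ H := by
    have : H = fun z => (z.2, p.eval z.2 - a * z.1) := funext hH
    rw [this]
    have := p.differentiable
    fun_prop
  have hθ1 : ∀ z ∈ Dset R, (H z).2 = z.2 ^ d * (1 + θ z) := by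
    intro z hz
    have := pow_ne_zero d (hne z hz)
    simp only [θ]
    field_simp
    ring
  have hθ : ∀ z ∈ Dset R, ‖θ z‖ ≤ M / ‖z.2‖ := by
    intro z hz
    have h1 := hpos z hz
    have h2 := poly_lower p d (by omega) hpd.le z.2 h1.le
    have h3 : p.coeff d = 1 := by rw [← hpd]; exact hpm
    rw [h3, one_mul] at h2
    have h4 : ‖a * z.1‖ ≤ 2 * ‖a‖ * ‖z.2‖ ^ (d - 1) := by
      rw [norm_mul]
      have h5 : ‖z.2‖ ≤ ‖z.2‖ ^ (d - 1) := le_self_pow₀ h1.le (by omega)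
      have := hz.2
      nlinarith [norm_nonneg a]
    simp only [θ]
    rw [norm_div, norm_pow, div_le_div_iff₀ (by positivity) (by positivity), hH]
    have h6 : ‖p.eval z.2 - a * z.1 - z.2 ^ d‖ ≤ M * ‖z.2‖ ^ (d - 1) := by
      calc ‖p.eval z.2 - a * z.1 - z.2 ^ d‖ = ‖(p.eval z.2 - z.2 ^ d) - a * z.1‖ := by
            congr 1; ring
        _ ≤ _ := norm_sub_le _ _
        _ ≤ _ := by rw [hM]; linarith
    calc _ ≤ M * ‖z.2‖ ^ (d - 1) * ‖z.2‖ := by gcongr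
      _ = M * ‖z.2‖ ^ d := by
        rw [mul_assoc, ← pow_succ]; congr 2; omega
  have hθ4 : ∀ z ∈ Dset R, ‖θ z‖ ≤ 1 / 4 := by
    intro z hz
    refine (hθ z hz).trans ?_
    have := hpos z hz
    rw [div_le_iff₀ (by linarith)]
    linarith [hz.1]
  have hgrow : ∀ z ∈ Dset R, 2 * ‖z.2‖ ≤ ‖(H z).2‖ := by
    intro z hz
    rw [hθ1 z hz, norm_mul, norm_pow]
    have h1 : (3 : ℝ) / 4 ≤ ‖1 + θ z‖ := by
      have := norm_sub_le (1 + θ z) (θ z)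
      rw [add_sub_cancel_right, norm_one] at this
      linarith [hθ4 z hz]
    have h2 : ‖z.2‖ ^ 2 ≤ ‖z.2‖ ^ d := pow_le_pow_right₀ (hpos z hz).le hd
    have h3 : 4 < ‖z.2‖ := by linarith [hz.1]
    nlinarith
  have hDH : ∀ z ∈ Dset R, H z ∈ Dset R := by
    intro z hz
    have h1 := hgrow z hz
    have h2 := hpos z hz
    refine ⟨by linarith [hz.1], ?_⟩
    have : (H z).1 = z.2 := by rw [hH]
    rw [this]; linarith
  have hDHn : ∀ n, ∀ z ∈ Dset R, H^[n] z ∈ Dset R ∧ ‖z.2‖ ≤ ‖(H^[n] z).2‖ := by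
    intro n
    induction n with
    | zero => exact fun z hz => ⟨hz, le_rfl⟩
    | succ n ih =>
      intro z hz
      rw [Function.iterate_succ_apply']
      obtain ⟨h1, h2⟩ := ih z hz
      refine ⟨hDH _ h1, ?_⟩
      have := hgrow _ h1
      have := hpos _ h1
      linarith
  let t : ℕ → ℂ × ℂ → ℂ := fun n z => ((d : ℂ) ^ (n + 1))⁻¹ * Complex.log (1 + θ (H^[n] z))
  have htb : ∀ n, ∀ z ∈ Dset R, ‖t n z‖ ≤ (3 / 2 * (M / ‖z.2‖)) * (1 / 2) ^ (n + 1) := by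
    intro n z hz
    obtain ⟨h1, h2⟩ := hDHn n z hz
    have h3 := hpos z hz
    simp only [t]
    rw [norm_mul, mul_comm]
    gcongr
    · refine (Complex.norm_log_one_add_half_le_self ((hθ4 _ h1).trans (by norm_num))).trans ?_
      gcongr
      refine (hθ _ h1).trans ?_
      gcongr
    · rw [norm_inv, norm_pow, Complex.norm_natCast, one_div, inv_pow]
      gcongr
      exact_mod_cast hd
  have hgeo : HasSum (fun n : ℕ => ((1 : ℝ) / 2) ^ (n + 1)) 1 := by
    have := (hasSum_geometric_two).mul_left (1 / 2)
    simp only [← pow_succ'] at this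
    have e : (1 / 2 : ℝ) * 2 = 1 := by norm_num
    rw [e] at this
    exact this
  have hts : ∀ z ∈ Dset R, Summable fun n => t n z := fun z hz =>
    Summable.of_norm_bounded (hgeo.summable.mul_left _) (fun n => htb n z hz)
  let S : ℂ × ℂ → ℂ := fun z => ∑' n, t n z
  have hSb : ∀ z ∈ Dset R, ‖S z‖ ≤ 3 / 2 * (M / ‖z.2‖) := by
    intro z hz
    have := tsum_of_norm_bounded (hgeo.mul_left (3 / 2 * (M / ‖z.2‖))) (fun n => htb n z hz)
    rwa [mul_one] at this
  have htd : ∀ n, DifferentiableOn ℂ (t n) (Dset R) := by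
    intro n z hz
    have hz' := (hDHn n z hz).1
    have h1 : DifferentiableAt ℂ θ (H^[n] z) := by
      have h2 := hHd (H^[n] z)
      have h4 : DifferentiableAt ℂ (fun z : ℂ × ℂ => z.2 ^ d) (H^[n] z) := by fun_prop
      have h5 : DifferentiableAt ℂ (fun z : ℂ × ℂ => (H z).2 - z.2 ^ d) (H^[n] z) := by fun_prop
      have h6 := h5.fun_mul (h4.fun_inv (pow_ne_zero d (hne _ hz')))
      simpa only [θ, div_eq_mul_inv] using h6
    have h2 : DifferentiableAt ℂ (fun z => 1 + θ (H^[n] z)) z :=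
      (h1.comp z ((hHd.iterate n) z)).const_add 1
    have h3 : 1 + θ (H^[n] z) ∈ Complex.slitPlane :=
      Complex.mem_slitPlane_of_norm_lt_one (by linarith [hθ4 _ hz'])
    exact ((h2.clog h3).const_mul _).differentiableWithinAt
  have hSd : DifferentiableOn ℂ S (Dset R) := by
    apply lim_diff (Dset R) (isOpen_Dset R) (fun n z => ∑ k ∈ Finset.range n, t k z)
    · intro n
      exact DifferentiableOn.fun_sum fun i _ => htd i
    · intro z hz
      refine ⟨Dset R, (isOpen_Dset R).mem_nhds hz, fun n => (3 / 2 * M) * (1 / 2) ^ (n + 1),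
        hgeo.summable.mul_left _, fun n z' hz' => ?_⟩
      rw [Finset.sum_range_succ, add_sub_cancel_left]
      refine (htb n z' hz').trans ?_
      have h6 := div_le_self hM0 (hpos z' hz').le
      apply mul_le_mul_of_nonneg_right _ (by positivity)
      linarith
    · intro z hz
      exact (hts z hz).hasSum.tendsto_sum_nat
  have hd0 : (d : ℂ) ≠ 0 := by
    have : d ≠ 0 := by omega
    exact_mod_cast this
  have hSH : ∀ z ∈ Dset R, d * S z = Complex.log (1 + θ z) + S (H z) := by
    intro z hz
    have h1 : S z = t 0 z + ∑' n, t (n + 1) z := (hts z hz).tsum_eq_zero_add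
    have h2 : ∀ n, d * t (n + 1) z = t n (H z) := by
      intro n
      simp only [t]
      rw [← Function.iterate_succ_apply, pow_succ _ (n + 1)]
      field_simp
    have h3 : d * ∑' n, t (n + 1) z = S (H z) := by
      rw [← tsum_mul_left]
      exact tsum_congr h2
    rw [h1, mul_add, h3]
    simp only [t]
    simp
    field_simp
  refine ⟨R, 3 * M + 1, fun z => z.2 * Complex.exp (S z), by linarith, by linarith, ?_, ?_, hDH,
    ?_, hgrow⟩
  · exact DifferentiableOn.mul (by fun_prop) hSd.cexp
  · intro z hz
    have h1 := hSb z hz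
    have h2 := hpos z hz
    have h3 : M / ‖z.2‖ ≤ 1 / 4 := by
      rw [div_le_iff₀ (by linarith)]; linarith [hz.1]
    have h4 : ‖Complex.exp (S z) - 1‖ ≤ 2 * ‖S z‖ := Complex.norm_exp_sub_one_le (by linarith)
    have h5 : z.2 * Complex.exp (S z) - z.2 = z.2 * (Complex.exp (S z) - 1) := by ring
    rw [h5, norm_mul]
    calc ‖z.2‖ * ‖Complex.exp (S z) - 1‖ ≤ ‖z.2‖ * (2 * (3 / 2 * (M / ‖z.2‖))) := by
          gcongr; linarith
      _ = 3 * M := by field_simp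
      _ ≤ _ := by linarith
  · intro z hz
    simp only []
    rw [mul_pow, ← Complex.exp_nat_mul, hSH z hz, Complex.exp_add, Complex.exp_log, hθ1 z hz]
    · ring
    · intro h0
      have h1 := hθ4 z hz
      have h2 : θ z = -1 := by linear_combination h0
      rw [h2, norm_neg, norm_one] at h1
      norm_num at h1



lemma pow_close (B : ℝ) (hB : 0 ≤ B) (n : ℕ) : ∃ C : ℝ, 0 ≤ C ∧ ∀ s ζ : ℂ, ‖s - ζ‖ ≤ B → 1 ≤ ‖ζ‖ →
    ‖s ^ (n + 1) - ζ ^ (n + 1)‖ ≤ C * ‖ζ‖ ^ n := by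
  induction n with
  | zero => exact ⟨B, hB, fun s ζ h1 h2 => by simpa using h1⟩
  | succ n ih =>
    obtain ⟨C, hC, h⟩ := ih
    refine ⟨(1 + B) * C + B, by positivity, fun s ζ h1 h2 => ?_⟩
    have h3 := h s ζ h1 h2
    have h4 : ‖s‖ ≤ (1 + B) * ‖ζ‖ := by
      have := norm_add_le (s - ζ) ζ
      rw [sub_add_cancel] at this
      nlinarith
    have h5 : s ^ (n + 1 + 1) - ζ ^ (n + 1 + 1) =
      s * (s ^ (n + 1) - ζ ^ (n + 1)) + (s - ζ) * ζ ^ (n + 1) := by ring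
    rw [h5]
    refine (norm_add_le _ _).trans ?_
    rw [norm_mul, norm_mul, norm_pow]
    calc ‖s‖ * ‖s ^ (n + 1) - ζ ^ (n + 1)‖ + ‖s - ζ‖ * ‖ζ‖ ^ (n + 1)
        ≤ ((1 + B) * ‖ζ‖) * (C * ‖ζ‖ ^ n) + B * ‖ζ‖ ^ (n + 1) := by gcongr
      _ = _ := by ring

lemma poly_mvt (d : ℕ) (hd : 2 ≤ d) (p : Polynomial ℂ) (hpm : p.Monic) (hpd : p.natDegree = d)
    (B : ℝ) (hB : 0 ≤ B) : ∃ C : ℝ, 0 ≤ C ∧ ∀ ζ y y' : ℂ, B + 1 ≤ ‖ζ‖ → ‖y - ζ‖ ≤ B → ‖y' - ζ‖ ≤ B →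
    ‖p.eval y - p.eval y' - d * ζ ^ (d - 1) * (y - y')‖ ≤ C * ‖ζ‖ ^ (d - 2) * ‖y - y'‖ := by
  obtain ⟨e, rfl⟩ : ∃ e, d = e + 2 := ⟨d - 2, by omega⟩
  obtain ⟨C, hC, hc⟩ := pow_close B hB e
  set K := ∑ i ∈ Finset.range (e + 1), ‖(Polynomial.derivative p).coeff i‖ with hK
  have hK0 : 0 ≤ K := by positivity
  refine ⟨K * (1 + B) ^ e + (e + 2) * C, by positivity, fun ζ y y' h1 hy hy' => ?_⟩
  have hdeg : (Polynomial.derivative p).natDegree ≤ e + 1 := by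
    have := Polynomial.natDegree_derivative_le p
    omega
  have hcoef : (Polynomial.derivative p).coeff (e + 1) = (e + 2 : ℂ) := by
    rw [Polynomial.coeff_derivative]
    have : p.coeff (e + 1 + 1) = 1 := by
      have h : e + 1 + 1 = p.natDegree := by omega
      rw [h]; exact hpm
    rw [this]; push_cast; ring
  have hmv := (convex_closedBall ζ B).norm_image_sub_le_of_norm_hasDerivWithin_le
    (f := fun s => p.eval s - (e + 2 : ℂ) * ζ ^ (e + 1) * s)
    (f' := fun s => (Polynomial.derivative p).eval s - (e + 2 : ℂ) * ζ ^ (e + 1))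
    (C := (K * (1 + B) ^ e + (e + 2) * C) * ‖ζ‖ ^ e) (x := y') (y := y) ?_ ?_
    (by simpa [dist_eq_norm] using hy') (by simpa [dist_eq_norm] using hy)
  · have h9 : p.eval y - p.eval y' - ((e + 2 : ℕ) : ℂ) * ζ ^ (e + 2 - 1) * (y - y') =
      p.eval y - (e + 2 : ℂ) * ζ ^ (e + 1) * y - (p.eval y' - (e + 2 : ℂ) * ζ ^ (e + 1) * y') := by
      rw [show e + 2 - 1 = e + 1 by omega]
      push_cast
      ring
    rw [h9, Nat.add_sub_cancel]
    exact hmv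
  · intro s _
    have h2 := (p.hasDerivAt s).sub ((hasDerivAt_id s).const_mul ((e + 2 : ℂ) * ζ ^ (e + 1)))
    simp only [mul_one] at h2
    exact h2.hasDerivWithinAt
  · intro s hs
    have hs' : ‖s - ζ‖ ≤ B := by simpa [dist_eq_norm] using hs
    have hζ1 : 1 ≤ ‖ζ‖ := by linarith
    have hs1 : 1 ≤ ‖s‖ := by
      have := norm_sub_norm_le ζ s
      rw [norm_sub_rev] at this
      linarith
    have h4 : ‖s‖ ≤ (1 + B) * ‖ζ‖ := by
      have := norm_add_le (s - ζ) ζ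
      rw [sub_add_cancel] at this
      nlinarith
    have h5 := poly_lower _ (e + 1) (by omega) hdeg s hs1
    rw [hcoef, ← hK, Nat.add_sub_cancel] at h5
    have h6 := hc s ζ hs' hζ1
    have h7 : (Polynomial.derivative p).eval s - (e + 2 : ℂ) * ζ ^ (e + 1) =
      ((Polynomial.derivative p).eval s - (e + 2 : ℂ) * s ^ (e + 1)) +
        (e + 2 : ℂ) * (s ^ (e + 1) - ζ ^ (e + 1)) := by ring
    rw [h7]
    refine (norm_add_le _ _).trans ?_
    have h8 : ‖(e + 2 : ℂ)‖ = (e + 2 : ℝ) := by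
      have := Complex.norm_natCast (e + 2)
      push_cast at this
      exact this
    rw [norm_mul, h8]
    calc _ ≤ K * ((1 + B) * ‖ζ‖) ^ e + (e + 2) * (C * ‖ζ‖ ^ e) := by
          gcongr
          exact h5.trans (by gcongr)
      _ = _ := by rw [mul_pow]; ring

lemma seq_lemma (D Z : ℕ → ℝ) (A M : ℝ) (hA : 0 ≤ A) (hD0 : ∀ n, 0 ≤ D n)
    (hDM : ∀ n, D (n + 1) ≤ M) (hZ : ∀ k, 4 + 4 * A ≤ Z k)
    (h : ∀ k, Z k * D (k + 1) - A * D k ≤ D (k + 2)) : Z 0 * D 1 ≤ 2 * A * D 0 := by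
  by_contra! hc
  have hA0 := mul_nonneg hA (hD0 0)
  have hD1 : 0 < D 1 := by
    rcases (hD0 1).eq_or_lt with h1 | h1
    · rw [← h1] at hc; nlinarith
    · exact h1
  have hstep : ∀ k, 0 < D (k + 1) ∧ 2 * D (k + 1) ≤ D (k + 2) := by
    intro k
    induction k with
    | zero =>
      refine ⟨hD1, ?_⟩
      have := h 0
      have := hZ 0
      simp only [zero_add] at *
      nlinarith
    | succ k ih =>
      obtain ⟨h1, h2⟩ := ih
      have h3 := h (k + 1)
      have h4 := hZ (k + 1)
      have h5 : 0 < D (k + 2) := by linarith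
      refine ⟨h5, ?_⟩
      have e1 : k + 1 + 1 = k + 2 := rfl
      have e2 : k + 1 + 2 = k + 3 := rfl
      rw [e1, e2] at *
      have h6 := mul_le_mul_of_nonneg_right h4 h5.le
      have h7 := mul_le_mul_of_nonneg_left h2 hA
      nlinarith [mul_nonneg hA h1.le]
  have hgrow : ∀ k : ℕ, 2 ^ k * D 1 ≤ D (k + 1) := by
    intro k
    induction k with
    | zero => simp
    | succ k ih =>
      have := (hstep k).2
      rw [pow_succ]
      have e1 : k + 1 + 1 = k + 2 := rfl
      rw [e1]; linarith
  obtain ⟨n, hn⟩ := pow_unbounded_of_one_lt (M / D 1) (one_lt_two)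
  rw [div_lt_iff₀ hD1] at hn
  linarith [hgrow n, hDM n]

lemma leaf_lemma (d : ℕ) (hd : 2 ≤ d) (a : ℂ)
    (p : Polynomial ℂ) (hpm : p.Monic) (hpd : p.natDegree = d)
    (H : ℂ × ℂ → ℂ × ℂ) (hH : ∀ z : ℂ × ℂ, H z = (z.2, p.eval z.2 - a * z.1))
    (R B : ℝ) (φ : ℂ × ℂ → ℂ) (hB : 1 ≤ B)
    (hφb : ∀ z ∈ Dset R, ‖φ z - z.2‖ ≤ B) (hDH : ∀ z ∈ Dset R, H z ∈ Dset R)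
    (hφH : ∀ z ∈ Dset R, φ (H z) = φ z ^ d) :
    ∃ R1 C : ℝ, 1 ≤ R1 ∧ 0 ≤ C ∧ ∀ z ∈ Dset R, ∀ z' ∈ Dset R, φ z = φ z' → R1 < ‖φ z‖ →
      ‖z.2 - z'.2‖ ≤ 2 * ‖a‖ * ‖z.1 - z'.1‖ ∧
      ‖d * φ z ^ (d - 1) * (z.2 - z'.2) - a * (z.1 - z'.1)‖ * ‖φ z‖ ≤ C * ‖z.1 - z'.1‖ := by
  obtain ⟨C1, hC1, hmv⟩ := poly_mvt d hd p hpm hpd B (by linarith)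
  have key : ∀ z ∈ Dset R, ∀ z' ∈ Dset R, φ z = φ z' → B + 1 + C1 + (4 + 4 * ‖a‖) < ‖φ z‖ →
      ‖φ z‖ ^ (d - 1) * ‖z.2 - z'.2‖ ≤ 2 * ‖a‖ * ‖z.1 - z'.1‖ := by
    intro z hz z' hz' he hl
    have hna := norm_nonneg a
    have hD : ∀ n, ∀ z ∈ Dset R, H^[n] z ∈ Dset R ∧ φ (H^[n] z) = φ z ^ d ^ n := by
      intro n
      induction n with
      | zero => intro z hz; simpa using hz
      | succ n ih =>
        intro z hz
        obtain ⟨h1, h2⟩ := ih z hz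
        rw [Function.iterate_succ_apply']
        refine ⟨hDH _ h1, ?_⟩
        rw [hφH _ h1, h2, pow_succ, pow_mul]
    have hs1 : ∀ n z, (H^[n + 1] z).1 = (H^[n] z).2 := fun n z => by
      rw [Function.iterate_succ_apply', hH]
    have hs2 : ∀ n z, (H^[n + 1] z).2 = p.eval (H^[n] z).2 - a * (H^[n] z).1 := fun n z => by
      rw [Function.iterate_succ_apply', hH]
    have hζk : ∀ k : ℕ, ‖φ z‖ ≤ ‖φ (H^[k] z)‖ := by
      intro k
      rw [(hD k z hz).2, norm_pow]
      exact le_self_pow₀ (by linarith) (by positivity)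
    have hyk : ∀ k : ℕ, ‖(H^[k] z).2 - φ (H^[k] z)‖ ≤ B := fun k => by
      rw [norm_sub_rev]; exact hφb _ (hD k z hz).1
    have hyk' : ∀ k : ℕ, ‖(H^[k] z').2 - φ (H^[k] z)‖ ≤ B := fun k => by
      rw [norm_sub_rev, (hD k z hz).2, he, ← (hD k z' hz').2]; exact hφb _ (hD k z' hz').1
    have := seq_lemma (fun n => ‖(H^[n] z).1 - (H^[n] z').1‖) (fun n => ‖φ (H^[n] z)‖ ^ (d - 1))
      ‖a‖ (2 * B) (norm_nonneg _) (fun n => norm_nonneg _) ?_ ?_ ?_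
    · simp only [hs1] at this
      simpa [hH] using this
    · intro n
      simp only [hs1]
      have h1 := hyk n
      have h2 := hyk' n
      have h3 := norm_sub_le ((H^[n] z).2 - φ (H^[n] z)) ((H^[n] z').2 - φ (H^[n] z))
      rw [sub_sub_sub_cancel_right] at h3
      linarith
    · intro k
      have h1 := hζk k
      have h2 : ‖φ (H^[k] z)‖ ≤ ‖φ (H^[k] z)‖ ^ (d - 1) := le_self_pow₀ (by linarith) (by omega)
      linarith
    · intro k
      simp only [hs1, hs2]
      have h1 := hζk k
      have h2 := hmv _ _ _ (by linarith) (hyk k) (hyk' k)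
      set ζ := φ (H^[k] z)
      set y := (H^[k] z).2
      set y' := (H^[k] z').2
      set x := (H^[k] z).1
      set x' := (H^[k] z').1
      have h3 : d * ζ ^ (d - 1) * (y - y') = (p.eval y - a * x - (p.eval y' - a * x')) + a * (x - x')
        - (p.eval y - p.eval y' - d * ζ ^ (d - 1) * (y - y')) := by ring
      have h4 := norm_sub_le ((p.eval y - a * x - (p.eval y' - a * x')) + a * (x - x'))
        (p.eval y - p.eval y' - d * ζ ^ (d - 1) * (y - y'))
      rw [← h3] at h4
      have h5 := norm_add_le (p.eval y - a * x - (p.eval y' - a * x')) (a * (x - x'))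
      rw [norm_mul a] at h5
      rw [norm_mul, norm_mul, norm_pow, Complex.norm_natCast] at h4
      have h6 : C1 * ‖ζ‖ ^ (d - 2) * ‖y - y'‖ ≤ ‖ζ‖ ^ (d - 1) * ‖y - y'‖ := by
        have : ‖ζ‖ ^ (d - 1) = ‖ζ‖ * ‖ζ‖ ^ (d - 2) := by rw [← pow_succ']; congr 1; omega
        rw [this]
        gcongr
        linarith
      have h7 : 2 * ‖ζ‖ ^ (d - 1) * ‖y - y'‖ ≤ d * ‖ζ‖ ^ (d - 1) * ‖y - y'‖ := by
        gcongr
        exact_mod_cast hd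
      linarith
  refine ⟨B + 1 + C1 + (4 + 4 * ‖a‖), 2 * ‖a‖ * C1 + 4 * ‖a‖ ^ 2, ?_, by positivity, ?_⟩
  · linarith [norm_nonneg a]
  intro z hz z' hz' he hl
  have hna := norm_nonneg a
  have h1 := key z hz z' hz' he hl
  have hζ1 : 1 ≤ ‖φ z‖ := by linarith
  have hp : ‖φ z‖ ≤ ‖φ z‖ ^ (d - 1) := le_self_pow₀ hζ1 (by omega)
  have hζH : ‖φ z‖ ≤ ‖φ (H z)‖ := by
    rw [hφH z hz, norm_pow]; exact le_self_pow₀ hζ1 (by omega)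
  have hp' : ‖φ (H z)‖ ≤ ‖φ (H z)‖ ^ (d - 1) := le_self_pow₀ (by linarith) (by omega)
  have h2 := key (H z) (hDH z hz) (H z') (hDH z' hz') (by rw [hφH z hz, hφH z' hz', he])
    (by linarith)
  have hx : ∀ z, (H z).1 = z.2 := fun z => by rw [hH]
  have hy : ∀ z, (H z).2 = p.eval z.2 - a * z.1 := fun z => by rw [hH]
  simp only [hx, hy] at h2
  have hD1 : ‖φ z‖ * ‖z.2 - z'.2‖ ≤ 2 * ‖a‖ * ‖z.1 - z'.1‖ :=
    (mul_le_mul_of_nonneg_right hp (norm_nonneg _)).trans h1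
  refine ⟨(le_mul_of_one_le_left (norm_nonneg _) hζ1).trans hD1, ?_⟩
  have h3 := hmv (φ z) z.2 z'.2 (by linarith) (by rw [norm_sub_rev]; exact hφb z hz)
    (by rw [norm_sub_rev, he]; exact hφb z' hz')
  set Y := p.eval z.2 - a * z.1 - (p.eval z'.2 - a * z'.1) with hY
  have h4 : d * φ z ^ (d - 1) * (z.2 - z'.2) - a * (z.1 - z'.1) = Y -
    (p.eval z.2 - p.eval z'.2 - d * φ z ^ (d - 1) * (z.2 - z'.2)) := by rw [hY]; ring
  have h5 : ‖Y‖ ≤ 2 * ‖a‖ * ‖z.2 - z'.2‖ := by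
    refine le_trans ?_ h2
    exact le_mul_of_one_le_left (norm_nonneg _) (by linarith)
  have h6 : C1 * ‖φ z‖ ^ (d - 2) * ‖z.2 - z'.2‖ * ‖φ z‖ ≤ C1 * (2 * ‖a‖ * ‖z.1 - z'.1‖) := by
    have : C1 * ‖φ z‖ ^ (d - 2) * ‖z.2 - z'.2‖ * ‖φ z‖ = C1 * (‖φ z‖ ^ (d - 1) * ‖z.2 - z'.2‖) := by
      have : ‖φ z‖ ^ (d - 1) = ‖φ z‖ * ‖φ z‖ ^ (d - 2) := by rw [← pow_succ']; congr 1; omega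
      rw [this]; ring
    rw [this]
    gcongr
  have h7 : ‖Y‖ * ‖φ z‖ ≤ 2 * ‖a‖ * (2 * ‖a‖ * ‖z.1 - z'.1‖) := by
    calc ‖Y‖ * ‖φ z‖ ≤ 2 * ‖a‖ * ‖z.2 - z'.2‖ * ‖φ z‖ := by gcongr
      _ = 2 * ‖a‖ * (‖φ z‖ * ‖z.2 - z'.2‖) := by ring
      _ ≤ _ := by gcongr
  rw [h4]
  calc _ ≤ (‖Y‖ + C1 * ‖φ z‖ ^ (d - 2) * ‖z.2 - z'.2‖) * ‖φ z‖ := by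
        gcongr
        exact (norm_sub_le _ _).trans (by linarith)
    _ ≤ _ := by nlinarith


lemma freq_of_lower (h : ℂ → ℂ) (s : ℂ) (c : ℝ) (hc : 0 < c)
    (he : ∀ᶠ s' in 𝓝 s, c * ‖s' - s‖ ≤ ‖h s' - h s‖) : ∃ᶠ z in 𝓝 s, h z ≠ h s := by
  have h1 : ∀ᶠ z in 𝓝[≠] s, z ∈ ({s}ᶜ : Set ℂ) := eventually_mem_nhdsWithin
  have h2 := he.filter_mono (nhdsWithin_le_nhds (s := {s}ᶜ))
  have h3 : ∀ᶠ z in 𝓝[≠] s, h z ≠ h s := by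
    filter_upwards [h1, h2] with z hz1 hz2 hz3
    rw [hz3, sub_self, norm_zero] at hz2
    have h4 : 0 < ‖z - s‖ := norm_pos_iff.2 (sub_ne_zero.2 hz1)
    nlinarith
  exact h3.frequently.filter_mono nhdsWithin_le_nhds

lemma exists_L (R B R1 : ℝ) (φ : ℂ × ℂ → ℂ) (hR : 1 ≤ R) (hB : 1 ≤ B)
    (hφd : DifferentiableOn ℂ φ (Dset R))
    (hφb : ∀ z ∈ Dset R, ‖φ z - z.2‖ ≤ B)
    (huniq : ∀ z ∈ Dset R, ∀ z' ∈ Dset R, φ z = φ z' → R1 < ‖φ z‖ → z.1 = z'.1 → z = z') :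
    ∃ (R2 : ℝ) (L : ℂ × ℂ → ℂ × ℂ), R1 ≤ R2 ∧ 1 ≤ R2 ∧ DifferentiableOn ℂ L (Tset R2) ∧
      ∀ w ∈ Tset R2, L w ∈ Dset R ∧ (L w).1 = w.1 ∧ φ (L w) = w.2 ∧ map L (𝓝 w) = 𝓝 (L w) := by
  let f : ℂ × ℂ → ℂ := fun z => φ (z.2, z.1)
  let U0 : Set (ℂ × ℂ) := {z | R + 16 * B < ‖z.1‖ ∧ ‖z.2‖ < 3 / 2 * ‖z.1‖}
  have hU0D : ∀ z ∈ U0, (z.2, z.1) ∈ Dset R := by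
    intro z hz
    have h1 := hz.1
    have h2 := hz.2
    exact ⟨by simp only; linarith, by simp only; linarith⟩
  have hU0 : IsOpen U0 := by
    have h1 : IsOpen {z : ℂ × ℂ | R + 16 * B < ‖z.1‖} := isOpen_lt (by fun_prop) (by fun_prop)
    have h2 : IsOpen {z : ℂ × ℂ | ‖z.2‖ < 3 / 2 * ‖z.1‖} := isOpen_lt (by fun_prop) (by fun_prop)
    exact h1.inter h2
  have hfd0 : DifferentiableOn ℂ f U0 := by
    refine hφd.comp (g := φ) (f := fun z : ℂ × ℂ => (z.2, z.1)) (by fun_prop) hU0D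
  let U : Set (ℂ × ℂ) := U0 ∩ f ⁻¹' {ζ | R1 < ‖ζ‖}
  have hU : IsOpen U := by
    refine hfd0.continuousOn.isOpen_inter_preimage hU0 ?_
    exact isOpen_lt (by fun_prop) (by fun_prop)
  have hder : ∀ s t, (s, t) ∈ U0 → ∀ᶠ s' in 𝓝 s, 1 / 4 * ‖s' - s‖ ≤ ‖f (s', t) - f (s, t)‖ := by
    intro s t hst
    have hs1 : R + 16 * B < ‖s‖ := hst.1
    have hs2 : ‖t‖ < 3 / 2 * ‖s‖ := hst.2
    have hmem : ∀ s' ∈ Metric.ball s (4 * B), (t, s') ∈ Dset R := by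
      intro s' hs'
      rw [mem_ball_iff_norm] at hs'
      have h1 := norm_sub_norm_le s s'
      rw [norm_sub_rev] at h1
      exact ⟨by simp only; linarith, by simp only; linarith⟩
    have hd1 : DifferentiableOn ℂ (fun s' => φ (t, s') - s') (Metric.ball s (4 * B)) := by
      refine DifferentiableOn.sub ?_ differentiableOn_id
      exact hφd.comp (g := φ) (f := fun s' : ℂ => (t, s')) (by fun_prop) hmem
    filter_upwards [Metric.ball_mem_nhds s (show 0 < 4 * B by linarith)] with s' hs'
    have hm : MapsTo (fun s' => φ (t, s') - s') (Metric.ball s (4 * B))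
        (Metric.closedBall (φ (t, s) - s) (2 * B)) := by
      intro s'' hs''
      have h1 := hφb _ (hmem s'' hs'')
      have h2 := hφb _ (hmem s (Metric.mem_ball_self (by linarith)))
      rw [mem_closedBall_iff_norm]
      exact (norm_sub_le _ _).trans (by simp only at h1 h2 ⊢; linarith)
    have h3 := Complex.dist_le_div_mul_dist_of_mapsTo_ball hd1 hm hs'
    rw [dist_eq_norm, dist_eq_norm] at h3
    have h4 : 2 * B / (4 * B) = 1 / 2 := by field_simp; norm_num
    rw [h4] at h3
    have h5 : s' - s = (φ (t, s') - φ (t, s)) - (φ (t, s') - s' - (φ (t, s) - s)) := by ring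
    have h6 := norm_sub_le (φ (t, s') - φ (t, s)) (φ (t, s') - s' - (φ (t, s) - s))
    rw [← h5] at h6
    simp only [f]
    have := norm_nonneg (s' - s)
    linarith
  obtain ⟨g, -, hg2, hg3, hg4⟩ := skew_inv f U hU (hfd0.mono inter_subset_left)
    (fun s s' t h h' he => by
      have := huniq _ (hU0D _ h.1) _ (hU0D _ h'.1) he h.2 rfl
      simpa using this) (fun s t h => ⟨1 / 4, by norm_num, hder s t h.1⟩)
  have hex : ∀ w ∈ Tset (max (R + 21 * B) (max R1 1)), ∃ s, (s, w.1) ∈ U ∧ f (s, w.1) = w.2 := by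
    rintro ⟨x, ζ⟩ ⟨h1, h2⟩
    simp only at h1 h2 ⊢
    have h3 : R + 21 * B < ‖ζ‖ := (le_max_left _ _).trans_lt h1
    have h4 : R1 < ‖ζ‖ := ((le_max_left _ _).trans (le_max_right _ _)).trans_lt h1
    have hmem : ∀ s ∈ Metric.closedBall ζ (5 * B), (s, x) ∈ U0 := by
      intro s' hs'
      rw [mem_closedBall_iff_norm] at hs'
      have h1 := norm_sub_norm_le ζ s'
      rw [norm_sub_rev] at h1
      exact ⟨by simp only; linarith, by simp only; linarith⟩
    have hζm : ζ ∈ Metric.closedBall ζ (5 * B) := Metric.mem_closedBall_self (by linarith)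
    have hd1 : DifferentiableOn ℂ (fun s => f (s, x)) (Metric.closedBall ζ (5 * B)) :=
      hfd0.comp (g := f) (f := fun s : ℂ => (s, x)) (by fun_prop) hmem
    have hb : ∀ s ∈ Metric.closedBall ζ (5 * B), ‖f (s, x) - s‖ ≤ B := fun s hs =>
      hφb _ (hU0D _ (hmem s hs))
    have h5 := (hd1.diffContOnCl_ball le_rfl).ball_subset_image_closedBall (ε := 3 * B)
      (by linarith) (fun s hs => ?_) (freq_of_lower _ _ (1 / 4) (by norm_num) (hder ζ x (hmem ζ hζm)))
    · have h6 : ζ ∈ Metric.ball (f (ζ, x)) (3 * B / 2) := by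
        rw [mem_ball_iff_norm, norm_sub_rev]
        have := hb ζ hζm
        linarith
      obtain ⟨s, hs, hs2⟩ := h5 h6
      refine ⟨s, ⟨hmem s hs, ?_⟩, hs2⟩
      simp only at hs2
      rw [mem_preimage, hs2]
      exact h4
    · have h6 := hb ζ hζm
      have h7 := hb s (Metric.sphere_subset_closedBall hs)
      rw [mem_sphere_iff_norm] at hs
      have h8 : s - ζ = (f (s, x) - f (ζ, x)) - (f (s, x) - s) + (f (ζ, x) - ζ) := by ring
      have h9 := norm_add_le ((f (s, x) - f (ζ, x)) - (f (s, x) - s)) (f (ζ, x) - ζ)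
      have h10 := norm_sub_le (f (s, x) - f (ζ, x)) (f (s, x) - s)
      rw [← h8] at h9
      linarith
  refine ⟨max (R + 21 * B) (max R1 1), fun w => (g (w.2, w.1)).swap,
    (le_max_left _ _).trans (le_max_right _ _), (le_max_right _ _).trans (le_max_right _ _), ?_, ?_⟩
  · have h1 : DifferentiableOn ℂ (fun w : ℂ × ℂ => g (w.2, w.1))
        (Tset (max (R + 21 * B) (max R1 1))) := by
      refine hg3.comp (g := g) (f := fun w : ℂ × ℂ => (w.2, w.1)) (by fun_prop) ?_
      intro w hw
      obtain ⟨s, hs, hs2⟩ := hex w hw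
      exact ⟨(s, w.1), hs, by simp only [hs2]⟩
    exact h1.snd.prodMk h1.fst
  · intro w hw
    obtain ⟨s, hs, hs2⟩ := hex w hw
    have h1 := hg2 _ hs
    have h2 := hg4 _ hs
    simp only [hs2] at h1 h2
    simp only [h1]
    refine ⟨hU0D _ hs.1, rfl, hs2, ?_⟩
    have h3 : (fun w : ℂ × ℂ => (g (w.2, w.1)).swap) = Prod.swap ∘ g ∘ Prod.swap := rfl
    have hsw : ∀ q : ℂ × ℂ, map Prod.swap (𝓝 q) = 𝓝 q.swap := fun q =>
      (Homeomorph.prodComm ℂ ℂ).map_nhds_eq q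
    rw [h3, ← Filter.map_map, ← Filter.map_map, hsw]
    have h4 : w.swap = (w.2, w.1) := rfl
    rw [h4, h2, hsw]


lemma incr_lemma (v : ℕ → ℂ) (h : ∀ n, ‖v (n + 1) - v n‖ ≤ 1 / 8 * (1 / 2) ^ n * ‖v n‖) :
    ∀ n, ‖v n - v 0‖ ≤ 1 / 2 * (1 - (1 / 2) ^ n) * ‖v 0‖ ∧
      ‖v (n + 1) - v n‖ ≤ 1 / 4 * (1 / 2) ^ n * ‖v 0‖ := by
  have aux : ∀ n, ‖v n - v 0‖ ≤ 1 / 2 * (1 - (1 / 2) ^ n) * ‖v 0‖ →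
      ‖v (n + 1) - v n‖ ≤ 1 / 4 * (1 / 2) ^ n * ‖v 0‖ := by
    intro n hn
    have h1 := h n
    have hp : (0 : ℝ) < (1 / 2) ^ n := by positivity
    have h2 : ‖v n‖ ≤ 2 * ‖v 0‖ := by
      have h3 := norm_add_le (v n - v 0) (v 0)
      rw [sub_add_cancel] at h3
      nlinarith [norm_nonneg (v 0)]
    calc _ ≤ _ := h1
      _ ≤ 1 / 8 * (1 / 2) ^ n * (2 * ‖v 0‖) := by gcongr
      _ = _ := by ring
  intro n
  induction n with
  | zero => exact ⟨by simp, aux 0 (by simp)⟩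
  | succ n ih =>
    have h1 : ‖v (n + 1) - v 0‖ ≤ 1 / 2 * (1 - (1 / 2) ^ (n + 1)) * ‖v 0‖ := by
      have h2 := norm_add_le (v (n + 1) - v n) (v n - v 0)
      rw [sub_add_sub_cancel] at h2
      rw [pow_succ]
      linarith [ih.1, ih.2]
    exact ⟨h1, aux _ h1⟩

lemma exists_U (d : ℕ) (hd : 2 ≤ d) (a : ℂ) (ha : a ≠ 0)
    (H : ℂ × ℂ → ℂ × ℂ) (hHd : Differentiable ℂ H) (hH1 : ∀ z, (H z).1 = z.2)
    (R B R1 R2 C : ℝ) (φ : ℂ × ℂ → ℂ) (L : ℂ × ℂ → ℂ × ℂ) (hB : 1 ≤ B) (hC : 0 ≤ C)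
    (hφb : ∀ z ∈ Dset R, ‖φ z - z.2‖ ≤ B) (hDH : ∀ z ∈ Dset R, H z ∈ Dset R)
    (hφH : ∀ z ∈ Dset R, φ (H z) = φ z ^ d)
    (hleaf : ∀ z ∈ Dset R, ∀ z' ∈ Dset R, φ z = φ z' → R1 < ‖φ z‖ →
      ‖d * φ z ^ (d - 1) * (z.2 - z'.2) - a * (z.1 - z'.1)‖ * ‖φ z‖ ≤ C * ‖z.1 - z'.1‖)
    (huniq : ∀ z ∈ Dset R, ∀ z' ∈ Dset R, φ z = φ z' → R1 < ‖φ z‖ → z.1 = z'.1 → z = z')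
    (h12 : R1 ≤ R2) (hR2 : 1 ≤ R2) (hLd : DifferentiableOn ℂ L (Tset R2))
    (hL : ∀ w ∈ Tset R2, L w ∈ Dset R ∧ (L w).1 = w.1 ∧ φ (L w) = w.2) :
    ∃ (R3 : ℝ) (U : ℂ × ℂ → ℂ) (q : ℂ → ℂ), R2 ≤ R3 ∧ B + 2 ≤ R3 ∧
      DifferentiableOn ℂ U (Tset R3) ∧
      (∀ x x' ζ, (x, ζ) ∈ Tset R3 → (x', ζ) ∈ Tset R3 →
        ‖U (x, ζ) - U (x', ζ) - ζ * (x - x')‖ ≤ 1 / 2 * (‖ζ‖ * ‖x - x'‖)) ∧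
      (∀ ζ, R3 < ‖ζ‖ → U (0, ζ) = 0) ∧
      DifferentiableOn ℂ q {ζ | R3 < ‖ζ‖} ∧ (∀ ζ, R3 < ‖ζ‖ → ‖q ζ‖ ≤ 3 * ‖ζ‖ ^ (d + 1)) ∧
      ∀ x ζ, (x, ζ) ∈ Tset R3 → ((L (x, ζ)).2, ζ ^ d) ∈ Tset R3 ∧
        H (L (x, ζ)) = L ((L (x, ζ)).2, ζ ^ d) ∧
        U ((L (x, ζ)).2, ζ ^ d) = a / d * U (x, ζ) + q ζ := by
  have hna : 0 < ‖a‖ := norm_pos_iff.2 ha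
  have hd0 : (d : ℂ) ≠ 0 := by
    have : d ≠ 0 := by omega
    exact_mod_cast this
  have hCa : 0 ≤ 8 * C / ‖a‖ := by positivity
  set R3 : ℝ := R2 + B + 8 * C / ‖a‖ + 2 with hR3
  have hT : ∀ w ∈ Tset R3, w ∈ Tset R2 := fun w hw => ⟨by linarith [hw.1], hw.2⟩
  have hT0 : ∀ ζ, R3 < ‖ζ‖ → ((0 : ℂ), ζ) ∈ Tset R3 := fun ζ h => ⟨h, by
    simp only [norm_zero]; linarith⟩
  have hDn : ∀ n, ∀ z ∈ Dset R, H^[n] z ∈ Dset R ∧ φ (H^[n] z) = φ z ^ d ^ n := by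
    intro n
    induction n with
    | zero => intro z hz; simpa using hz
    | succ n ih =>
      intro z hz
      obtain ⟨h1, h2⟩ := ih z hz
      rw [Function.iterate_succ_apply']
      refine ⟨hDH _ h1, ?_⟩
      rw [hφH _ h1, h2, pow_succ, pow_mul]
  let u : ℕ → ℂ × ℂ → ℂ := fun n w =>
    (d / a) ^ n * w.2 ^ d ^ n * ((H^[n] (L w)).1 - (H^[n] (L (0, w.2))).1)
  -- lower bound for the powers
  have hpw : ∀ ζ : ℂ, R3 < ‖ζ‖ → ∀ n : ℕ, R3 * 2 ^ n ≤ ‖ζ ^ d ^ n‖ := by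
    intro ζ hζ n
    rw [norm_pow]
    have h1 : n + 1 ≤ d ^ n := (Nat.lt_pow_self (by omega))
    calc R3 * 2 ^ n ≤ ‖ζ‖ * ‖ζ‖ ^ n := by
          have h2 : (2 : ℝ) ≤ ‖ζ‖ := by linarith
          gcongr
      _ = ‖ζ‖ ^ (n + 1) := by ring
      _ ≤ _ := pow_le_pow_right₀ (by linarith) h1
  -- increments
  have hinc : ∀ x x' ζ, (x, ζ) ∈ Tset R3 → (x', ζ) ∈ Tset R3 → ∀ n,
      ‖(u (n + 1) (x, ζ) - u (n + 1) (x', ζ)) - (u n (x, ζ) - u n (x', ζ))‖ ≤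
        1 / 8 * (1 / 2) ^ n * ‖u n (x, ζ) - u n (x', ζ)‖ := by
    intro x x' ζ hw hw' n
    obtain ⟨l1, l2, l3⟩ := hL _ (hT _ hw)
    obtain ⟨l1', l2', l3'⟩ := hL _ (hT _ hw')
    obtain ⟨m1, m2⟩ := hDn n _ l1
    obtain ⟨m1', m2'⟩ := hDn n _ l1'
    rw [l3] at m2
    rw [l3'] at m2'
    simp only at m2 m2'
    have hp := hpw ζ hw.1 n
    have h2n : (1 : ℝ) ≤ 2 ^ n := one_le_pow₀ (by norm_num)
    have hR30 : 0 ≤ R3 := by linarith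
    have hp1 : R3 ≤ ‖ζ ^ d ^ n‖ := le_trans (le_mul_of_one_le_right hR30 h2n) hp
    have hlf := hleaf _ m1 _ m1' (by rw [m2, m2']) (by
      rw [m2]; linarith)
    rw [m2] at hlf
    set X := (H^[n] (L (x, ζ))).1 with hX
    set X' := (H^[n] (L (x', ζ))).1 with hX'
    have hXs : (H^[n + 1] (L (x, ζ))).1 = (H^[n] (L (x, ζ))).2 := by
      rw [Function.iterate_succ_apply', hH1]
    have hXs' : (H^[n + 1] (L (x', ζ))).1 = (H^[n] (L (x', ζ))).2 := by
      rw [Function.iterate_succ_apply', hH1]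
    set Y := (H^[n] (L (x, ζ))).2 with hY
    set Y' := (H^[n] (L (x', ζ))).2 with hY'
    have e1 : u n (x, ζ) - u n (x', ζ) = (d / a) ^ n * ζ ^ d ^ n * (X - X') := by
      simp only [u]; ring
    have e2 : u (n + 1) (x, ζ) - u (n + 1) (x', ζ) =
        (d / a) ^ (n + 1) * ζ ^ d ^ (n + 1) * (Y - Y') := by
      simp only [u, hXs, hXs']; ring
    have e3 : (u (n + 1) (x, ζ) - u (n + 1) (x', ζ)) - (u n (x, ζ) - u n (x', ζ)) =
        (d / a) ^ n * ζ ^ d ^ n / a * (d * (ζ ^ d ^ n) ^ (d - 1) * (Y - Y') - a * (X - X')) := by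
      rw [e1, e2]
      have : ζ ^ d ^ (n + 1) = ζ ^ d ^ n * (ζ ^ d ^ n) ^ (d - 1) := by
        rw [← pow_succ', ← pow_mul]
        congr 1
        rw [pow_succ]; congr 1; omega
      rw [this, pow_succ]
      field_simp
    rw [e3, e1]
    rw [norm_mul, norm_div, norm_mul, norm_mul]
    have hpos : 0 < ‖ζ ^ d ^ n‖ := by linarith
    have hlf2 : ‖d * (ζ ^ d ^ n) ^ (d - 1) * (Y - Y') - a * (X - X')‖ ≤
        C / ‖ζ ^ d ^ n‖ * ‖X - X'‖ := by
      rw [div_mul_eq_mul_div, le_div_iff₀ hpos]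
      exact hlf
    have h5 : C / ‖ζ ^ d ^ n‖ ≤ ‖a‖ * (1 / 8 * (1 / 2) ^ n) := by
      rw [div_le_iff₀ hpos]
      have h6 : 8 * C / ‖a‖ ≤ R3 := by linarith
      rw [div_le_iff₀ hna] at h6
      calc C ≤ 1 / 8 * (R3 * ‖a‖) := by linarith
        _ = ‖a‖ * (1 / 8 * (1 / 2) ^ n) * (R3 * 2 ^ n) := by
          have : ((1 : ℝ) / 2) ^ n * 2 ^ n = 1 := by rw [← mul_pow]; norm_num
          linear_combination -(1 / 8 * (R3 * ‖a‖)) * this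
        _ ≤ _ := by gcongr
    calc _ ≤ ‖((d : ℂ) / a) ^ n‖ * ‖ζ ^ d ^ n‖ / ‖a‖ * (‖a‖ * (1 / 8 * (1 / 2) ^ n) * ‖X - X'‖) := by
          gcongr
          exact hlf2.trans (by gcongr)
      _ = _ := by
        rw [norm_mul]
        field_simp
  have hu0 : ∀ x ζ, (x, ζ) ∈ Tset R3 → u 0 (x, ζ) = ζ * x := by
    intro x ζ hw
    have h1 := (hL _ (hT _ hw)).2.1
    have h2 := (hL _ (hT _ (hT0 ζ hw.1))).2.1
    simp only [u]
    simp [h1, h2]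
  have hun0 : ∀ n ζ, u n (0, ζ) = 0 := fun n ζ => by simp [u]
  have hmain := fun x x' ζ (hw : (x, ζ) ∈ Tset R3) (hw' : (x', ζ) ∈ Tset R3) =>
    incr_lemma (fun n => u n (x, ζ) - u n (x', ζ)) (hinc x x' ζ hw hw')
  -- limit
  have hstep : ∀ w ∈ Tset R3, ∀ n, ‖u (n + 1) w - u n w‖ ≤ 1 / 4 * (1 / 2) ^ n * (‖w.2‖ * ‖w.1‖) := by
    rintro ⟨x, ζ⟩ hw n
    have := (hmain x 0 ζ hw (hT0 ζ hw.1) n).2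
    simp only [hun0, sub_zero, hu0 x ζ hw, norm_mul] at this
    exact this
  have hconv : ∀ w, ∃ l, w ∈ Tset R3 → Tendsto (fun n => u n w) atTop (𝓝 l) := by
    intro w
    by_cases hw : w ∈ Tset R3
    · have hc : CauchySeq (fun n => u n w) := by
        apply cauchySeq_of_le_geometric (1 / 2) (1 / 4 * (‖w.2‖ * ‖w.1‖)) (by norm_num)
        intro n
        rw [dist_comm, dist_eq_norm]
        refine (hstep w hw n).trans (le_of_eq (by ring))
      obtain ⟨l, hl⟩ := cauchySeq_tendsto_of_complete hc
      exact ⟨l, fun _ => hl⟩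
    · exact ⟨0, fun h => absurd h hw⟩
  choose U hU using hconv
  have hUd : DifferentiableOn ℂ U (Tset R3) := by
    apply lim_diff (Tset R3) (isOpen_Tset R3) u U
    · intro n
      have h1 : DifferentiableOn ℂ (fun w => (H^[n] (L w)).1) (Tset R3) :=
        ((hHd.iterate n).comp_differentiableOn (hLd.mono hT)).fst
      have h2 : DifferentiableOn ℂ (fun w : ℂ × ℂ => (H^[n] (L (0, w.2))).1) (Tset R3) :=
        h1.comp (f := fun w : ℂ × ℂ => ((0 : ℂ), w.2)) (by fun_prop) (fun w hw => hT0 _ hw.1)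
      have h3 : DifferentiableOn ℂ (fun w : ℂ × ℂ => ((d : ℂ) / a) ^ n * w.2 ^ d ^ n) (Tset R3) := by
        fun_prop
      exact h3.mul (h1.sub h2)
    · intro w hw
      refine ⟨Tset R3 ∩ {w' | ‖w'.2‖ < ‖w.2‖ + 1}, ?_,
        fun n => (1 / 4 * (‖w.2‖ + 1) ^ 2) * (1 / 2) ^ n, ?_, ?_⟩
      · refine inter_mem ((isOpen_Tset R3).mem_nhds hw) ?_
        have h1 : IsOpen {w' : ℂ × ℂ | ‖w'.2‖ < ‖w.2‖ + 1} := isOpen_lt (by fun_prop) (by fun_prop)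
        exact h1.mem_nhds (by simp)
      · exact summable_geometric_two.mul_left _
      · rintro n w' ⟨h1, h2⟩
        refine (hstep w' h1 n).trans ?_
        have h3 := h1.2
        have h4 : ‖w'.2‖ < ‖w.2‖ + 1 := h2
        have h5 : ‖w'.2‖ * ‖w'.1‖ ≤ (‖w.2‖ + 1) * (‖w.2‖ + 1) := by
          gcongr
          linarith
        calc _ ≤ 1 / 4 * (1 / 2) ^ n * ((‖w.2‖ + 1) * (‖w.2‖ + 1)) := by gcongr
          _ = _ := by ring
    · intro w hw
      exact hU w hw
  have hU2 : ∀ x x' ζ, (x, ζ) ∈ Tset R3 → (x', ζ) ∈ Tset R3 →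
        ‖U (x, ζ) - U (x', ζ) - ζ * (x - x')‖ ≤ 1 / 2 * (‖ζ‖ * ‖x - x'‖) := by
    intro x x' ζ hw hw'
    have h1 : Tendsto (fun n => ‖u n (x, ζ) - u n (x', ζ) - ζ * (x - x')‖) atTop
      (𝓝 ‖U (x, ζ) - U (x', ζ) - ζ * (x - x')‖) :=
      (((hU _ hw).sub (hU _ hw')).sub_const _).norm
    refine le_of_tendsto' h1 (fun n => ?_)
    have h2 := (hmain x x' ζ hw hw' n).1
    simp only [hu0 x ζ hw, hu0 x' ζ hw'] at h2
    rw [show ζ * x - ζ * x' = ζ * (x - x') by ring, norm_mul ζ (x - x')] at h2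
    refine h2.trans ?_
    have hp : (0 : ℝ) < (1 / 2) ^ n := by positivity
    have h3 : 0 ≤ ‖ζ‖ * ‖x - x'‖ := by positivity
    nlinarith
  have hU3 : ∀ ζ, R3 < ‖ζ‖ → U (0, ζ) = 0 := by
    intro ζ hζ
    have h1 := hU _ (hT0 ζ hζ)
    simp only [hun0] at h1
    exact tendsto_nhds_unique h1 tendsto_const_nhds
  have hUb : ∀ x ζ, (x, ζ) ∈ Tset R3 → ‖U (x, ζ)‖ ≤ 3 / 2 * (‖ζ‖ * ‖x‖) := by
    intro x ζ hw
    have h1 := hU2 x 0 ζ hw (hT0 ζ hw.1)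
    rw [hU3 ζ hw.1, sub_zero, sub_zero] at h1
    have h2 := norm_add_le (U (x, ζ) - ζ * x) (ζ * x)
    rw [sub_add_cancel, norm_mul] at h2
    linarith
  have hyb : ∀ x ζ, (x, ζ) ∈ Tset R3 → ‖(L (x, ζ)).2‖ ≤ ‖ζ‖ + B := by
    intro x ζ hw
    obtain ⟨l1, l2, l3⟩ := hL _ (hT _ hw)
    have h1 := hφb _ l1
    rw [l3, norm_sub_rev] at h1
    have h2 := norm_add_le ((L (x, ζ)).2 - ζ) ζ
    rw [sub_add_cancel] at h2
    simp only at h1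
    linarith
  have hsq : ∀ ζ : ℂ, R3 < ‖ζ‖ → ‖ζ‖ + B < ‖ζ ^ d‖ ∧ R3 < ‖ζ ^ d‖ := by
    intro ζ hζ
    rw [norm_pow]
    have h1 : ‖ζ‖ ^ 2 ≤ ‖ζ‖ ^ d := pow_le_pow_right₀ (by linarith) hd
    constructor <;> nlinarith
  have hyT : ∀ x ζ, (x, ζ) ∈ Tset R3 → ((L (x, ζ)).2, ζ ^ d) ∈ Tset R3 := by
    intro x ζ hw
    exact ⟨(hsq ζ hw.1).2, (hyb x ζ hw).trans_lt (hsq ζ hw.1).1⟩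
  have hHL : ∀ x ζ, (x, ζ) ∈ Tset R3 → H (L (x, ζ)) = L ((L (x, ζ)).2, ζ ^ d) := by
    intro x ζ hw
    obtain ⟨l1, l2, l3⟩ := hL _ (hT _ hw)
    obtain ⟨m1, m2, m3⟩ := hL _ (hT _ (hyT x ζ hw))
    have h1 : φ (H (L (x, ζ))) = ζ ^ d := by rw [hφH _ l1, l3]
    refine huniq _ (hDH _ l1) _ m1 (by rw [h1, m3]) ?_ (by rw [m2, hH1])
    rw [h1]
    linarith [(hsq ζ hw.1).2]
  refine ⟨R3, U, fun ζ => U ((L (0, ζ)).2, ζ ^ d), by linarith, by linarith, hUd, hU2, hU3, ?_, ?_,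
    fun x ζ hw => ⟨hyT x ζ hw, hHL x ζ hw, ?_⟩⟩
  · have h1 : DifferentiableOn ℂ (fun ζ : ℂ => (L (0, ζ)).2) {ζ | R3 < ‖ζ‖} :=
      ((hLd.mono hT).comp (f := fun ζ : ℂ => ((0 : ℂ), ζ)) (by fun_prop) (fun ζ hζ => hT0 ζ hζ)).snd
    have h2 : DifferentiableOn ℂ (fun ζ : ℂ => ((L (0, ζ)).2, ζ ^ d)) {ζ | R3 < ‖ζ‖} :=
      h1.prodMk (by fun_prop)
    exact hUd.comp (g := U) (f := fun ζ : ℂ => ((L (0, ζ)).2, ζ ^ d)) h2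
      (fun ζ hζ => hyT 0 ζ (hT0 ζ hζ))
  · intro ζ hζ
    refine (hUb _ _ (hyT 0 ζ (hT0 ζ hζ))).trans ?_
    have h1 := hyb 0 ζ (hT0 ζ hζ)
    rw [norm_pow]
    have h2 : ‖(L (0, ζ)).2‖ ≤ 2 * ‖ζ‖ := by linarith
    calc 3 / 2 * (‖ζ‖ ^ d * ‖(L (0, ζ)).2‖) ≤ 3 / 2 * (‖ζ‖ ^ d * (2 * ‖ζ‖)) := by gcongr
      _ = _ := by ring
  · have hw0 := hT0 ζ hw.1
    have h1 := (hU _ (hyT x ζ hw)).sub (hU _ (hyT 0 ζ hw0))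
    have h2 := ((tendsto_add_atTop_iff_nat 1).2 (hU _ hw)).const_mul (a / d)
    have h3 : ∀ n, u n ((L (x, ζ)).2, ζ ^ d) - u n ((L (0, ζ)).2, ζ ^ d) =
        a / d * u (n + 1) (x, ζ) := by
      intro n
      simp only [u]
      rw [← hHL x ζ hw, ← hHL 0 ζ hw0]
      simp only [← Function.iterate_succ_apply]
      have e5 : ((d : ℂ) / a) ^ n = a / d * (d / a) ^ (n + 1) := by
        rw [pow_succ]
        generalize ((d : ℂ) / a) ^ n = E
        field_simp
      rw [← pow_mul, ← pow_succ', e5]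
      ring
    simp only [h3] at h1
    have h4 := tendsto_nhds_unique h1 h2
    linear_combination h4


lemma escape_lemma (d : ℕ) (hd : 2 ≤ d) (b : ℂ) (Q : ℂ → ℂ) (R4 : ℝ)
    (hQ : ∀ ζ, R4 < ‖ζ‖ → ‖Q ζ‖ ≤ 4 * ‖ζ‖ ^ (d + 1))
    (F : ℂ × ℂ → ℂ × ℂ) (hF : ∀ w, F w = (b * w.1 + Q w.2, w.2 ^ d))
    (w : ℂ × ℂ) (hw : 1 < ‖w.2‖) (R : ℝ) :
    ∃ n, R < ‖(F^[n] w).2‖ ∧ ‖(F^[n] w).1‖ < ‖(F^[n] w).2‖ ^ 2 / 16 := by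
  set R5 : ℝ := |R| + |R4| + 2 * ‖b‖ + 256 with hR5
  have hR5R : R ≤ R5 := by
    have := le_abs_self R
    have := abs_nonneg R4
    have := norm_nonneg b
    linarith
  have hR5R4 : R4 ≤ R5 := by
    have := le_abs_self R4
    have := abs_nonneg R
    have := norm_nonneg b
    linarith
  have hR5b : 2 * ‖b‖ ≤ R5 := by
    have := abs_nonneg R4
    have := abs_nonneg R
    linarith
  have hR5c : 256 ≤ R5 := by
    have := abs_nonneg R4
    have := abs_nonneg R
    have := norm_nonneg b
    linarith
  have h2 : ∀ n w, (F^[n] w).2 = w.2 ^ d ^ n := by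
    intro n
    induction n with
    | zero => intro w; simp
    | succ n ih =>
      intro w
      rw [Function.iterate_succ_apply', hF]
      simp only [ih]
      rw [← pow_mul, pow_succ]
  obtain ⟨N, hN⟩ := pow_unbounded_of_one_lt R5 hw
  set w0 := F^[N] w with hw0
  have hw02 : R5 < ‖w0.2‖ := by
    rw [hw0, h2, norm_pow]
    refine hN.trans_le (pow_le_pow_right₀ hw.le (Nat.lt_pow_self (by omega)).le)
  have hbig : ∀ n, R5 < ‖(F^[n] w0).2‖ := by
    intro n
    rw [h2, norm_pow]
    exact hw02.trans_le (le_self_pow₀ (by linarith) (by positivity))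
  let t : ℕ → ℝ := fun n => ‖(F^[n] w0).1‖ / ‖(F^[n] w0).2‖ ^ 2
  have ht : ∀ n, t (n + 1) ≤ 1 / 2 * t n + 1 / 64 := by
    intro n
    have hb := hbig n
    simp only [t, Function.iterate_succ_apply', hF]
    set u := (F^[n] w0).1
    set ζ := (F^[n] w0).2
    have hζ : 0 < ‖ζ‖ := by linarith
    have h1 : ‖b * u + Q ζ‖ ≤ ‖b‖ * ‖u‖ + 4 * ‖ζ‖ ^ (d + 1) := by
      refine (norm_add_le _ _).trans ?_
      rw [norm_mul]
      have := hQ ζ (by linarith)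
      linarith
    rw [norm_pow, div_le_iff₀ (by positivity)]
    refine h1.trans ?_
    have e1 : (‖ζ‖ ^ d) ^ 2 = ‖ζ‖ ^ 2 * ‖ζ‖ ^ (2 * d - 2) := by
      rw [← pow_mul, ← pow_add]; congr 1; omega
    have e2 : (‖ζ‖ ^ d) ^ 2 = ‖ζ‖ ^ (d + 1) * ‖ζ‖ ^ (d - 1) := by
      rw [← pow_mul, ← pow_add]; congr 1; omega
    have p1 : ‖ζ‖ ≤ ‖ζ‖ ^ (2 * d - 2) := le_self_pow₀ (by linarith) (by omega)
    have p2 : ‖ζ‖ ≤ ‖ζ‖ ^ (d - 1) := le_self_pow₀ (by linarith) (by omega)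
    have q1 : ‖b‖ * ‖u‖ ≤ 1 / 2 * (‖u‖ / ‖ζ‖ ^ 2) * (‖ζ‖ ^ d) ^ 2 := by
      have : 1 / 2 * (‖u‖ / ‖ζ‖ ^ 2) * (‖ζ‖ ^ d) ^ 2 = 1 / 2 * ‖ζ‖ ^ (2 * d - 2) * ‖u‖ := by
        rw [e1]; field_simp
      rw [this]
      gcongr
      linarith
    have q2 : 4 * ‖ζ‖ ^ (d + 1) ≤ 1 / 64 * (‖ζ‖ ^ d) ^ 2 := by
      rw [e2]
      have : 0 < ‖ζ‖ ^ (d + 1) := by positivity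
      nlinarith
    linarith
  have ht2 : ∀ n, t n ≤ (1 / 2) ^ n * t 0 + 1 / 32 := by
    intro n
    induction n with
    | zero => simp
    | succ n ih =>
      have := ht n
      rw [pow_succ]
      linarith
  have htend : Tendsto (fun n : ℕ => ((1 : ℝ) / 2) ^ n * t 0) atTop (𝓝 (0 * t 0)) :=
    (tendsto_pow_atTop_nhds_zero_of_lt_one (by norm_num) (by norm_num)).mul_const _
  rw [zero_mul] at htend
  obtain ⟨n, hn⟩ := (htend.eventually (gt_mem_nhds (show (0 : ℝ) < 1 / 32 by norm_num))).exists
  refine ⟨n + N, ?_⟩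
  rw [Function.iterate_add_apply, ← hw0]
  have hb := hbig n
  refine ⟨by linarith, ?_⟩
  have h3 : t n < 1 / 16 := by linarith [ht2 n]
  simp only [t] at h3
  have hb0 : 0 < ‖(F^[n] w0).2‖ := by linarith
  rw [div_lt_iff₀ (by positivity)] at h3
  linarith

lemma exists_S (d : ℕ) (hd : 2 ≤ d) (a : ℂ) (ha : a ≠ 0) (e : ℂ → ℂ) (R4 K : ℝ) (hK : 0 ≤ K)
    (hR4 : 1 ≤ R4) (hR4a : 2 * ‖(d : ℂ) / a‖ ≤ R4)
    (hed : DifferentiableOn ℂ e {ζ | R4 < ‖ζ‖}) (he : ∀ ζ, R4 < ‖ζ‖ → ‖e ζ‖ * ‖ζ‖ ≤ K) :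
    ∃ S : ℂ → ℂ, DifferentiableOn ℂ S {ζ | R4 < ‖ζ‖} ∧ (∀ ζ, R4 < ‖ζ‖ → ‖S ζ‖ ≤ K) ∧
      ∀ ζ, R4 < ‖ζ‖ → a / d * S ζ = e ζ + S (ζ ^ d) := by
  have hd0 : (d : ℂ) ≠ 0 := by
    have : d ≠ 0 := by omega
    exact_mod_cast this
  let s : ℕ → ℂ → ℂ := fun n ζ => (d / a) ^ (n + 1) * e (ζ ^ d ^ n)
  have hbig : ∀ (n : ℕ) (ζ : ℂ), R4 < ‖ζ‖ → R4 < ‖ζ ^ d ^ n‖ := by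
    intro n ζ hζ
    rw [norm_pow]
    exact hζ.trans_le (le_self_pow₀ (by linarith) (by positivity))
  have hsb : ∀ n ζ, R4 < ‖ζ‖ → ‖s n ζ‖ ≤ K * (1 / 2) ^ (n + 1) := by
    intro n ζ hζ
    have h1 := he _ (hbig n ζ hζ)
    have h2 := hbig n ζ hζ
    simp only [s]
    rw [norm_mul, norm_pow]
    have h3 : ‖ζ‖ ^ (n + 1) ≤ ‖ζ ^ d ^ n‖ := by
      rw [norm_pow]
      exact pow_le_pow_right₀ (by linarith) (Nat.lt_pow_self (by omega))
    have h4 : ‖(d : ℂ) / a‖ ^ (n + 1) ≤ (1 / 2) ^ (n + 1) * ‖ζ ^ d ^ n‖ := by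
      calc ‖(d : ℂ) / a‖ ^ (n + 1) ≤ (1 / 2 * ‖ζ‖) ^ (n + 1) := by
            gcongr; linarith
        _ = (1 / 2) ^ (n + 1) * ‖ζ‖ ^ (n + 1) := mul_pow _ _ _
        _ ≤ _ := by gcongr
    calc _ ≤ (1 / 2) ^ (n + 1) * ‖ζ ^ d ^ n‖ * ‖e (ζ ^ d ^ n)‖ := by gcongr
      _ = (1 / 2) ^ (n + 1) * (‖e (ζ ^ d ^ n)‖ * ‖ζ ^ d ^ n‖) := by ring
      _ ≤ (1 / 2) ^ (n + 1) * K := by gcongr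
      _ = _ := by ring
  have hgeo : HasSum (fun n : ℕ => ((1 : ℝ) / 2) ^ (n + 1)) 1 := by
    have := (hasSum_geometric_two).mul_left (1 / 2)
    simp only [← pow_succ'] at this
    have e : (1 / 2 : ℝ) * 2 = 1 := by norm_num
    rw [e] at this
    exact this
  have hopen : IsOpen {ζ : ℂ | R4 < ‖ζ‖} := isOpen_lt (by fun_prop) (by fun_prop)
  refine ⟨fun ζ => ∑' n, s n ζ, ?_, ?_, ?_⟩
  · refine Complex.differentiableOn_tsum_of_summable_norm (hgeo.summable.mul_left K) ?_ hopen ?_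
    · intro n
      have : DifferentiableOn ℂ (fun ζ : ℂ => e (ζ ^ d ^ n)) {ζ | R4 < ‖ζ‖} :=
        hed.comp (f := fun ζ : ℂ => ζ ^ d ^ n) (by fun_prop) (fun ζ hζ => hbig n ζ hζ)
      exact this.const_mul _
    · intro n ζ hζ
      exact hsb n ζ hζ
  · intro ζ hζ
    have := tsum_of_norm_bounded (hgeo.mul_left K) (fun n => hsb n ζ hζ)
    rwa [mul_one] at this
  · intro ζ hζ
    have hs : Summable fun n => s n ζ :=
      Summable.of_norm_bounded (hgeo.summable.mul_left K) (fun n => hsb n ζ hζ)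
    have h1 : ∑' n, s n ζ = s 0 ζ + ∑' n, s (n + 1) ζ := hs.tsum_eq_zero_add
    have h2 : ∀ n, a / d * s (n + 1) ζ = s n (ζ ^ d) := by
      intro n
      simp only [s]
      rw [← pow_mul, ← pow_succ', pow_succ _ (n + 1)]
      generalize ((d : ℂ) / a) ^ (n + 1) = E
      field_simp
    have h3 : a / d * ∑' n, s (n + 1) ζ = ∑' n, s n (ζ ^ d) := by
      rw [← tsum_mul_left]
      exact tsum_congr h2
    simp only
    rw [h1, mul_add, h3]
    congr 1
    simp only [s]
    simp
    field_simp

lemma exists_model (d : ℕ) (hd : 2 ≤ d) (a : ℂ) (ha : a ≠ 0)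
    (H : ℂ × ℂ → ℂ × ℂ) (R3 : ℝ) (hR3 : 1 ≤ R3) (L : ℂ × ℂ → ℂ × ℂ) (U : ℂ × ℂ → ℂ) (q : ℂ → ℂ)
    (hLd : DifferentiableOn ℂ L (Tset R3)) (hLi : InjOn L (Tset R3))
    (hLn : ∀ w ∈ Tset R3, map L (𝓝 w) = 𝓝 (L w))
    (hUd : DifferentiableOn ℂ U (Tset R3))
    (hU2 : ∀ x x' ζ, (x, ζ) ∈ Tset R3 → (x', ζ) ∈ Tset R3 →
        ‖U (x, ζ) - U (x', ζ) - ζ * (x - x')‖ ≤ 1 / 2 * (‖ζ‖ * ‖x - x'‖))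
    (hU3 : ∀ ζ, R3 < ‖ζ‖ → U (0, ζ) = 0)
    (hqd : DifferentiableOn ℂ q {ζ | R3 < ‖ζ‖})
    (hqb : ∀ ζ, R3 < ‖ζ‖ → ‖q ζ‖ ≤ 3 * ‖ζ‖ ^ (d + 1))
    (hfun : ∀ x ζ, (x, ζ) ∈ Tset R3 → ((L (x, ζ)).2, ζ ^ d) ∈ Tset R3 ∧
        H (L (x, ζ)) = L ((L (x, ζ)).2, ζ ^ d) ∧
        U ((L (x, ζ)).2, ζ ^ d) = a / d * U (x, ζ) + q ζ) :
    ∃ (R4 : ℝ) (Q : ℂ → ℂ) (W : Set (ℂ × ℂ)) (Ψ F : ℂ × ℂ → ℂ × ℂ), Differentiable ℂ Q ∧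
      (∀ w, F w = (a / d * w.1 + Q w.2, w.2 ^ d)) ∧
      IsOpen W ∧ (∀ w ∈ W, F w ∈ W) ∧ DifferentiableOn ℂ Ψ W ∧ InjOn Ψ W ∧
      (∀ w ∈ W, map Ψ (𝓝 w) = 𝓝 (Ψ w)) ∧ (∀ w ∈ W, Ψ (F w) = H (Ψ w)) ∧
      (∀ w : ℂ × ℂ, 1 < ‖w.2‖ → ∃ n, F^[n] w ∈ W) ∧
      (∀ w ∈ W, ∃ x, (x, w.2) ∈ Tset R3 ∧ Ψ w = L (x, w.2)) ∧
      (∀ x ζ, R4 < ‖ζ‖ → (x, ζ) ∈ Tset R3 → ∃ w ∈ W, Ψ w = L (x, ζ)) := by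
  have hT0 : ∀ ζ, R3 < ‖ζ‖ → ((0 : ℂ), ζ) ∈ Tset R3 := fun ζ h => ⟨h, by
    simp only [norm_zero]; linarith⟩
  have hlow : ∀ x x' ζ, (x, ζ) ∈ Tset R3 → (x', ζ) ∈ Tset R3 →
      1 / 2 * ‖ζ‖ * ‖x - x'‖ ≤ ‖U (x, ζ) - U (x', ζ)‖ := by
    intro x x' ζ h h'
    have h1 := hU2 x x' ζ h h'
    have h2 := norm_sub_le (U (x, ζ) - U (x', ζ)) (U (x, ζ) - U (x', ζ) - ζ * (x - x'))
    rw [sub_sub_cancel, norm_mul] at h2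
    linarith
  have hder : ∀ x ζ, (x, ζ) ∈ Tset R3 →
      ∀ᶠ x' in 𝓝 x, 1 / 2 * ‖ζ‖ * ‖x' - x‖ ≤ ‖U (x', ζ) - U (x, ζ)‖ := by
    intro x ζ h
    have h1 : ∀ᶠ x' in 𝓝 x, (x', ζ) ∈ Tset R3 := by
      have : ContinuousAt (fun x' : ℂ => (x', ζ)) x := by fun_prop
      exact this.eventually ((isOpen_Tset R3).mem_nhds h)
    filter_upwards [h1] with x' hx'
    exact hlow x' x ζ hx' h
  have hζp : ∀ x ζ, (x, ζ) ∈ Tset R3 → 0 < 1 / 2 * ‖ζ‖ := fun x ζ h => by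
    have h1 : R3 < ‖ζ‖ := h.1
    linarith
  obtain ⟨g, hg1, hg2, hg3, hg4⟩ := skew_inv U (Tset R3) (isOpen_Tset R3) hUd
    (fun x x' ζ h h' he => by
      have h1 := hlow x x' ζ h h'
      rw [he, sub_self, norm_zero] at h1
      have h2 := hζp x ζ h
      have h3 : ‖x - x'‖ ≤ 0 := by
        by_contra! h4
        nlinarith
      exact sub_eq_zero.1 (norm_le_zero_iff.1 h3))
    (fun x ζ h => ⟨1 / 2 * ‖ζ‖, hζp x ζ h, hder x ζ h⟩)
  set W0 := (fun z : ℂ × ℂ => (U z, z.2)) '' Tset R3 with hW0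
  have hball : ∀ u ζ : ℂ, R3 < ‖ζ‖ → ‖u‖ < ‖ζ‖ ^ 2 / 8 → (u, ζ) ∈ W0 := by
    intro u ζ hζ hu
    have hmem : ∀ x ∈ Metric.closedBall (0 : ℂ) (‖ζ‖ / 2), (x, ζ) ∈ Tset R3 := by
      intro x hx
      rw [mem_closedBall_zero_iff] at hx
      exact ⟨hζ, by simp only; linarith⟩
    have hd1 : DifferentiableOn ℂ (fun x => U (x, ζ)) (Metric.closedBall 0 (‖ζ‖ / 2)) :=
      hUd.comp (g := U) (f := fun x : ℂ => (x, ζ)) (by fun_prop) hmem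
    have h5 := (hd1.diffContOnCl_ball le_rfl).ball_subset_image_closedBall (ε := ‖ζ‖ ^ 2 / 4)
      (by linarith) (fun x hx => ?_)
      (freq_of_lower _ _ (1 / 2 * ‖ζ‖) (hζp 0 ζ (hT0 ζ hζ)) (hder 0 ζ (hT0 ζ hζ)))
    · have h6 : u ∈ Metric.ball (U (0, ζ)) (‖ζ‖ ^ 2 / 4 / 2) := by
        rw [hU3 ζ hζ, mem_ball_zero_iff]
        linarith
      obtain ⟨x, hx, hx2⟩ := h5 h6
      exact ⟨(x, ζ), hmem x hx, by simp only at hx2 ⊢; rw [hx2]⟩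
    · have h7 := hlow x 0 ζ (hmem x (Metric.sphere_subset_closedBall hx)) (hT0 ζ hζ)
      rw [mem_sphere_zero_iff_norm] at hx
      rw [sub_zero, hx] at h7
      refine le_trans (le_of_eq (by ring)) h7
  obtain ⟨Q, K', R', hlau⟩ := laurent_split q R3 3 (d + 1) hqd hqb
  set K := max K' 0 with hK
  have hK0 : 0 ≤ K := le_max_right _ _
  set R4 : ℝ := R3 + |R'| + 2 * ‖(d : ℂ) / a‖ + K with hR4
  have hnn := norm_nonneg ((d : ℂ) / a)
  have hab := abs_nonneg R'
  have hab' := le_abs_self R'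
  have hR43 : R3 ≤ R4 := by linarith
  have he : ∀ ζ, R4 < ‖ζ‖ → ‖q ζ - Q.eval ζ‖ * ‖ζ‖ ≤ K := fun ζ hζ =>
    (hlau ζ (by linarith)).trans (le_max_left _ _)
  obtain ⟨S, hSd, hSb, hSf⟩ := exists_S d hd a ha (fun ζ => q ζ - Q.eval ζ) R4 K hK0 (by linarith)
    (by linarith) ((hqd.mono (fun ζ hζ => lt_of_le_of_lt hR43 hζ)).sub
      Q.differentiable.differentiableOn) he
  have hQb : ∀ ζ, R4 < ‖ζ‖ → ‖Q.eval ζ‖ ≤ 4 * ‖ζ‖ ^ (d + 1) := by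
    intro ζ hζ
    have h1 := hqb ζ (by linarith)
    have h2 := he ζ hζ
    have h3 : ‖q ζ - Q.eval ζ‖ ≤ 1 := by
      by_contra! h4
      nlinarith
    have h4 := norm_sub_le (q ζ) (q ζ - Q.eval ζ)
    rw [sub_sub_cancel] at h4
    have h5 : 1 ≤ ‖ζ‖ ^ (d + 1) := one_le_pow₀ (by linarith)
    linarith
  let F : ℂ × ℂ → ℂ × ℂ := fun w => (a / d * w.1 + Q.eval w.2, w.2 ^ d)
  let σ : ℂ × ℂ → ℂ × ℂ := fun w => (w.1 - S w.2, w.2)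
  let τ : ℂ × ℂ → ℂ × ℂ := fun w => (w.1 + S w.2, w.2)
  let Z : Set (ℂ × ℂ) := {w | R4 < ‖w.2‖}
  have hZ : IsOpen Z := isOpen_lt (by fun_prop) (by fun_prop)
  have hS2 : DifferentiableOn ℂ (fun w : ℂ × ℂ => S w.2) Z :=
    hSd.comp (f := fun w : ℂ × ℂ => w.2) (by fun_prop) (fun w hw => hw)
  have hσd : DifferentiableOn ℂ σ Z := by
    have h1 : DifferentiableOn ℂ (fun w : ℂ × ℂ => w.1 - S w.2) Z := DifferentiableOn.sub (by fun_prop) hS2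
    exact h1.prodMk (by fun_prop)
  have hτd : DifferentiableOn ℂ τ Z := by
    have h1 : DifferentiableOn ℂ (fun w : ℂ × ℂ => w.1 + S w.2) Z := DifferentiableOn.add (by fun_prop) hS2
    exact h1.prodMk (by fun_prop)
  have hστ : ∀ w, σ (τ w) = w := fun w => by simp [σ, τ]
  have hτσ : ∀ w, τ (σ w) = w := fun w => by simp [σ, τ]
  have hσn : ∀ w ∈ Z, map σ (𝓝 w) = 𝓝 (σ w) := by
    intro w hw
    have c1 : ContinuousAt σ w := hσd.continuousOn.continuousAt (hZ.mem_nhds hw)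
    have c2 : ContinuousAt τ (σ w) :=
      hτd.continuousOn.continuousAt (hZ.mem_nhds (show σ w ∈ Z from hw))
    refine le_antisymm c1 ?_
    have h1 : map τ (𝓝 (σ w)) ≤ 𝓝 w := by
      have := c2.tendsto
      rw [hτσ] at this
      exact this
    have h2 := Filter.map_mono (m := σ) h1
    rw [Filter.map_map] at h2
    have h3 : σ ∘ τ = id := funext hστ
    rwa [h3, Filter.map_id] at h2
  let W : Set (ℂ × ℂ) := Z ∩ σ ⁻¹' W0
  let Ψ : ℂ × ℂ → ℂ × ℂ := fun w => L (g (σ w))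
  have hW : ∀ w ∈ W, R4 < ‖w.2‖ ∧ ∃ x, (x, w.2) ∈ Tset R3 ∧ w.1 = U (x, w.2) + S w.2 ∧
      σ w = (U (x, w.2), w.2) ∧ g (σ w) = (x, w.2) := by
    rintro w ⟨h1, ⟨⟨x, ζ⟩, hx, hx2⟩⟩
    have e2 : ζ = w.2 := congrArg Prod.snd hx2
    have e1 : U (x, ζ) = w.1 - S w.2 := congrArg Prod.fst hx2
    subst e2
    refine ⟨h1, x, hx, by rw [e1]; ring, hx2.symm, ?_⟩
    rw [← hx2]
    exact hg2 _ hx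
  have hWmem : ∀ x ζ u, R4 < ‖ζ‖ → (x, ζ) ∈ Tset R3 → u = U (x, ζ) + S ζ →
      (u, ζ) ∈ W ∧ Ψ (u, ζ) = L (x, ζ) := by
    intro x ζ u hζ hx hu
    have e1 : σ (u, ζ) = (U (x, ζ), ζ) := by simp [σ, hu]
    refine ⟨⟨hζ, ⟨(x, ζ), hx, e1.symm⟩⟩, ?_⟩
    simp only [Ψ]
    rw [e1]
    exact congrArg L (hg2 _ hx)
  have hFW : ∀ w ∈ W, F w ∈ W ∧ Ψ (F w) = H (Ψ w) := by
    intro w hw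
    obtain ⟨h1, x, hx, hx1, hx2, hx3⟩ := hW w hw
    obtain ⟨k1, k2, k3⟩ := hfun x w.2 hx
    have h2 : R4 < ‖w.2 ^ d‖ := by
      rw [norm_pow]
      exact h1.trans_le (le_self_pow₀ (by linarith) (by omega))
    have h3 := hWmem _ _ (a / d * w.1 + Q.eval w.2) h2 k1 (by
      rw [k3, hx1]
      linear_combination hSf w.2 h1)
    refine ⟨h3.1, ?_⟩
    have h4 : Ψ w = L (x, w.2) := by simp only [Ψ]; rw [hx3]
    rw [h4, k2]
    exact h3.2
  refine ⟨R4, fun ζ => Q.eval ζ, W, Ψ, F, Q.differentiable, fun w => rfl, ?_, fun w hw => (hFW w hw).1,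
    ?_, ?_, ?_, fun w hw => (hFW w hw).2, ?_, ?_, ?_⟩
  · exact hσd.continuousOn.isOpen_inter_preimage hZ hg1
  · have h1 : DifferentiableOn ℂ (fun w => g (σ w)) W :=
      hg3.comp (hσd.mono inter_subset_left) (fun w hw => hw.2)
    refine hLd.comp (g := L) (f := fun w => g (σ w)) h1 (fun w hw => ?_)
    obtain ⟨h1, x, hx, hx1, hx2, hx3⟩ := hW w hw
    simp only [hx3]; exact hx
  · intro w hw w' hw' hww
    obtain ⟨h1, x, hx, hx1, hx2, hx3⟩ := hW w hw
    obtain ⟨h1', x', hx', hx1', hx2', hx3'⟩ := hW w' hw'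
    simp only [Ψ, hx3, hx3'] at hww
    have h2 := hLi hx hx' hww
    have e1 : x = x' := congrArg Prod.fst h2
    have e2 : w.2 = w'.2 := (Prod.mk.inj h2).2
    refine Prod.ext ?_ e2
    rw [hx1, hx1', e1, e2]
  · intro w hw
    obtain ⟨h1, x, hx, hx1, hx2, hx3⟩ := hW w hw
    have h2 : Ψ = L ∘ g ∘ σ := rfl
    rw [h2, ← Filter.map_map, ← Filter.map_map, hσn w h1, hx2, hg4 _ hx, hLn _ hx]
    simp only [Function.comp]
    rw [hx3]
  · intro w hw
    obtain ⟨n, hn1, hn2⟩ := escape_lemma d hd (a / d) (fun ζ => Q.eval ζ) R4 hQb F (fun w => rfl) w hw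
      (R4 + 16 * K)
    refine ⟨n, ?_⟩
    set w' := F^[n] w
    have h1 : R4 < ‖w'.2‖ := by linarith
    refine ⟨h1, ?_⟩
    have h2 := hSb _ h1
    refine hball _ _ (by linarith) ?_
    refine (norm_sub_le _ _).trans_lt ?_
    have h3 : ‖w'.2‖ ≤ ‖w'.2‖ ^ 2 := le_self_pow₀ (by linarith) (by norm_num)
    linarith
  · intro w hw
    obtain ⟨h1, x, hx, hx1, hx2, hx3⟩ := hW w hw
    exact ⟨x, hx, by simp only [Ψ]; rw [hx3]⟩
  · intro x ζ hζ hx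
    have := hWmem x ζ _ hζ hx rfl
    exact ⟨_, this.1, this.2⟩


lemma G_phi (d : ℕ) (hd : 2 ≤ d) (H : ℂ × ℂ → ℂ × ℂ) (G : ℂ × ℂ → ℝ)
    (hGlim : ∀ z : ℂ × ℂ,
      Tendsto (fun n : ℕ => Real.log (max ‖H^[n] z‖ 1) / (d : ℝ) ^ n) atTop (𝓝 (G z)))
    (R B : ℝ) (φ : ℂ × ℂ → ℂ) (hB : 1 ≤ B)
    (hφb : ∀ z ∈ Dset R, ‖φ z - z.2‖ ≤ B) (hDH : ∀ z ∈ Dset R, H z ∈ Dset R)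
    (hφH : ∀ z ∈ Dset R, φ (H z) = φ z ^ d) (z : ℂ × ℂ) (hz : z ∈ Dset R)
    (hφz : B + 2 ≤ ‖φ z‖) : G z = Real.log ‖φ z‖ := by
  have hDn : ∀ n, H^[n] z ∈ Dset R ∧ φ (H^[n] z) = φ z ^ d ^ n := by
    intro n
    induction n with
    | zero => simpa using hz
    | succ n ih =>
      obtain ⟨h1, h2⟩ := ih
      rw [Function.iterate_succ_apply']
      refine ⟨hDH _ h1, ?_⟩
      rw [hφH _ h1, h2, pow_succ, pow_mul]
  have hd1 : (1 : ℝ) < d := by exact_mod_cast hd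
  have hbound : ∀ n : ℕ, |Real.log (max ‖H^[n] z‖ 1) / (d : ℝ) ^ n - Real.log ‖φ z‖| ≤
      (Real.log (B + 2) + Real.log 4) / (d : ℝ) ^ n := by
    intro n
    obtain ⟨h1, h2⟩ := hDn n
    have h3 := hφb _ h1
    rw [h2] at h3
    have hζ : ‖φ z ^ d ^ n‖ = ‖φ z‖ ^ d ^ n := norm_pow _ _
    have hζ2 : B + 2 ≤ ‖φ z ^ d ^ n‖ := by
      rw [hζ]
      exact hφz.trans (le_self_pow₀ (by linarith) (by positivity))
    set y := (H^[n] z).2 with hy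
    have h4 := norm_sub_norm_le (φ z ^ d ^ n) y
    have h5 := norm_sub_norm_le y (φ z ^ d ^ n)
    rw [norm_sub_rev] at h5
    have h6 : ‖y‖ ≤ max ‖H^[n] z‖ 1 := (norm_snd_le _).trans (le_max_left _ _)
    have h7 : max ‖H^[n] z‖ 1 ≤ 4 * ‖φ z ^ d ^ n‖ := by
      refine max_le ?_ (by linarith)
      have h8 := h1.2
      rw [Prod.norm_def]
      exact max_le (by linarith) (by linarith)
    have h9 : ‖φ z ^ d ^ n‖ / (B + 2) ≤ max ‖H^[n] z‖ 1 := by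
      rw [div_le_iff₀ (by linarith)]
      have : (‖φ z ^ d ^ n‖ - B) * (B + 2) ≤ max ‖H^[n] z‖ 1 * (B + 2) := by
        gcongr
        linarith
      nlinarith
    have hpos : 0 < ‖φ z ^ d ^ n‖ := by linarith
    have l1 := Real.log_le_log (by positivity) h7
    have l2 := Real.log_le_log (by positivity) h9
    rw [Real.log_mul (by norm_num) hpos.ne', hζ, Real.log_pow] at l1
    rw [Real.log_div hpos.ne' (by linarith), hζ, Real.log_pow] at l2
    push_cast at l1 l2
    have hdn : (0 : ℝ) < (d : ℝ) ^ n := by positivity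
    have e : Real.log (max ‖H^[n] z‖ 1) / (d : ℝ) ^ n - Real.log ‖φ z‖ =
      (Real.log (max ‖H^[n] z‖ 1) - d ^ n * Real.log ‖φ z‖) / (d : ℝ) ^ n := by
      field_simp
    rw [e, abs_div, abs_of_pos hdn]
    have k1 : 0 ≤ Real.log (B + 2) := Real.log_nonneg (by linarith)
    have k2 : 0 ≤ Real.log 4 := Real.log_nonneg (by norm_num)
    gcongr
    rw [abs_le]
    constructor <;> linarith
  have hlim0 : Tendsto (fun n : ℕ => (Real.log (B + 2) + Real.log 4) / (d : ℝ) ^ n) atTop (𝓝 0) :=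
    (tendsto_pow_atTop_atTop_of_one_lt hd1).const_div_atTop _
  have h1 : Tendsto (fun n : ℕ => Real.log (max ‖H^[n] z‖ 1) / (d : ℝ) ^ n - Real.log ‖φ z‖) atTop
      (𝓝 0) := squeeze_zero_norm hbound hlim0
  have h2 := tendsto_nhds_unique ((hGlim z).sub_const (Real.log ‖φ z‖)) h1
  linarith

lemma G_enters (d : ℕ) (hd : 2 ≤ d) (H : ℂ × ℂ → ℂ × ℂ) (hH1 : ∀ z, (H z).1 = z.2)
    (G : ℂ × ℂ → ℝ)
    (hGlim : ∀ z : ℂ × ℂ,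
      Tendsto (fun n : ℕ => Real.log (max ‖H^[n] z‖ 1) / (d : ℝ) ^ n) atTop (𝓝 (G z)))
    (R : ℝ) (hR : 1 ≤ R) (z : ℂ × ℂ) (hz : 0 < G z) : ∃ n, H^[n] z ∈ Dset R := by
  by_contra! hc
  set M := max R ‖z.1‖ with hM
  have hM1 : 1 ≤ M := hR.trans (le_max_left _ _)
  have hy : ∀ w : ℂ × ℂ, w ∉ Dset R → ‖w.1‖ ≤ M → ‖w.2‖ ≤ M := by
    intro w hw h1
    by_contra! h2
    apply hw
    refine ⟨(le_max_left _ _).trans_lt h2, ?_⟩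
    linarith
  have hx : ∀ n, ‖(H^[n] z).1‖ ≤ M := by
    intro n
    induction n with
    | zero => exact le_max_right _ _
    | succ n ih =>
      rw [Function.iterate_succ_apply', hH1]
      exact hy _ (hc n) ih
  have hn : ∀ n, max ‖H^[n] z‖ 1 ≤ M := by
    intro n
    refine max_le ?_ hM1
    rw [Prod.norm_def]
    exact max_le (hx n) (hy _ (hc n) (hx n))
  have hd1 : (1 : ℝ) < d := by exact_mod_cast hd
  have hlim0 : Tendsto (fun n : ℕ => Real.log M / (d : ℝ) ^ n) atTop (𝓝 0) :=
    (tendsto_pow_atTop_atTop_of_one_lt hd1).const_div_atTop _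
  have h1 := le_of_tendsto_of_tendsto' (hGlim z) hlim0 (fun n => by
    gcongr
    exact hn n)
  linarith

lemma G_H (d : ℕ) (hd : 2 ≤ d) (H : ℂ × ℂ → ℂ × ℂ) (G : ℂ × ℂ → ℝ)
    (hGlim : ∀ z : ℂ × ℂ,
      Tendsto (fun n : ℕ => Real.log (max ‖H^[n] z‖ 1) / (d : ℝ) ^ n) atTop (𝓝 (G z)))
    (z : ℂ × ℂ) : G (H z) = d * G z := by
  have h1 := ((tendsto_add_atTop_iff_nat 1).2 (hGlim z)).const_mul (d : ℝ)
  refine tendsto_nhds_unique (hGlim (H z)) (h1.congr fun n => ?_)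
  have hd0 : (d : ℝ) ≠ 0 := by
    have : d ≠ 0 := by omega
    exact_mod_cast this
  rw [Function.iterate_succ_apply, pow_succ]
  field_simp


/-- There exists `c₀ > 0` such that for every `c ≥ c₀`, with
`A_c = {ζ ∈ ℂ : 1 < |ζ| < e^c}`, there exists a holomorphic map `P : ℂ × A_c → ℂ²`
whose image is `Ω'_c = {0 < G⁺_H < c}` and whose corestriction to `Ω'_c` is a
topological covering map. -/
theorem stmt_11 (d : ℕ) (hd : 2 ≤ d) (a : ℂ) (ha : a ≠ 0)
    (p : Polynomial ℂ) (hpm : p.Monic) (hpd : p.natDegree = d)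
    (hpc : p.coeff (d - 1) = 0)
    (H : ℂ × ℂ → ℂ × ℂ) (hH : ∀ z : ℂ × ℂ, H z = (z.2, p.eval z.2 - a * z.1))
    (G : ℂ × ℂ → ℝ) (hGcont : Continuous G) (hGnonneg : ∀ z, 0 ≤ G z)
    (hGlim : ∀ z : ℂ × ℂ,
      Tendsto (fun n : ℕ => Real.log (max ‖H^[n] z‖ 1) / (d : ℝ) ^ n) atTop (𝓝 (G z))) :
    ∃ c₀ : ℝ, 0 < c₀ ∧ ∀ c : ℝ, c₀ ≤ c →
      ∃ (P : ℂ × ℂ → ℂ × ℂ)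
        (hmaps : Set.MapsTo P
          ((Set.univ : Set ℂ) ×ˢ {ζ : ℂ | 1 < ‖ζ‖ ∧ ‖ζ‖ < Real.exp c})
          {z : ℂ × ℂ | 0 < G z ∧ G z < c}),
        DifferentiableOn ℂ P
          ((Set.univ : Set ℂ) ×ˢ {ζ : ℂ | 1 < ‖ζ‖ ∧ ‖ζ‖ < Real.exp c}) ∧
        P '' ((Set.univ : Set ℂ) ×ˢ {ζ : ℂ | 1 < ‖ζ‖ ∧ ‖ζ‖ < Real.exp c}) =
          {z : ℂ × ℂ | 0 < G z ∧ G z < c} ∧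
        IsCoveringMap
          (Set.MapsTo.restrict P
            ((Set.univ : Set ℂ) ×ˢ {ζ : ℂ | 1 < ‖ζ‖ ∧ ‖ζ‖ < Real.exp c})
            {z : ℂ × ℂ | 0 < G z ∧ G z < c} hmaps) := by
  refine ⟨1, one_pos, fun c _ => ?_⟩
  have hd0 : (d : ℂ) ≠ 0 := by
    have : d ≠ 0 := by omega
    exact_mod_cast this
  have hH1 : ∀ z, (H z).1 = z.2 := fun z => by rw [hH]
  have hHd : Differentiable ℂ H := by
    have : H = fun z => (z.2, p.eval z.2 - a * z.1) := funext hH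
    rw [this]
    have := p.differentiable
    fun_prop
  obtain ⟨R, B, φ, hR, hB, hφd, hφb, hDH, hφH, hgrow⟩ := exists_phi d hd a p hpm hpd H hH
  obtain ⟨R1, C, hR1, hC, hleaf⟩ := leaf_lemma d hd a p hpm hpd H hH R B φ hB hφb hDH hφH
  have huniq : ∀ z ∈ Dset R, ∀ z' ∈ Dset R, φ z = φ z' → R1 < ‖φ z‖ → z.1 = z'.1 → z = z' := by
    intro z hz z' hz' h1 h2 h3
    have h4 := (hleaf z hz z' hz' h1 h2).1
    rw [h3, sub_self, norm_zero, mul_zero] at h4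
    exact Prod.ext h3 (sub_eq_zero.1 (norm_le_zero_iff.1 h4))
  obtain ⟨R2, L, h12, hR2, hLd, hL⟩ := exists_L R B R1 φ hR hB hφd hφb huniq
  obtain ⟨R3, U, q, h23, hR3, hUd, hU2, hU3, hqd, hqb, hfun⟩ := exists_U d hd a ha H hHd hH1 R B R1 R2
    C φ L hB hC hφb hDH hφH (fun z hz z' hz' h1 h2 => (hleaf z hz z' hz' h1 h2).2) huniq h12 hR2 hLd
    (fun w hw => ⟨(hL w hw).1, (hL w hw).2.1, (hL w hw).2.2.1⟩)
  have hT : ∀ w ∈ Tset R3, w ∈ Tset R2 := fun w hw => ⟨by linarith [hw.1], hw.2⟩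
  obtain ⟨R4, Q, W, Ψ, F, hQ, hF, hWo, hWF, hΨd, hΨi, hΨn, hΨF, hesc, hWL, hLW⟩ :=
    exists_model d hd a ha H R3 (by linarith) L U q (hLd.mono hT)
      (fun w hw w' hw' h => by
        obtain ⟨-, h1, h2, -⟩ := hL w (hT w hw)
        obtain ⟨-, h1', h2', -⟩ := hL w' (hT w' hw')
        refine Prod.ext ?_ ?_
        · rw [← h1, ← h1', h]
        · rw [← h2, ← h2', h])
      (fun w hw => (hL w (hT w hw)).2.2.2) hUd hU2 hU3 hqd hqb hfun
  have hKd : Differentiable ℂ (fun z : ℂ × ℂ => ((p.eval z.1 - z.2) / a, z.1)) := by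
    have := p.differentiable
    fun_prop
  refine covering_of_model d hd (a / d) (div_ne_zero ha hd0) Q hQ H
    (fun z => ((p.eval z.1 - z.2) / a, z.1)) hKd hHd.continuous ?_ ?_ F hF W hWo hWF Ψ hΨd hΨi hΨn hΨF
    hesc ?_ G (G_H d hd H G hGlim) ?_ ?_ c
  · intro z
    rw [hH]
    refine Prod.ext rfl ?_
    simp only
    field_simp
    ring
  · intro z
    rw [hH]
    refine Prod.ext ?_ rfl
    simp only
    field_simp
    ring
  · intro w hw
    obtain ⟨x, hx, -⟩ := hWL w hw
    have := hx.1
    simp only at this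
    linarith
  · intro w hw
    obtain ⟨x, hx, hx2⟩ := hWL w hw
    obtain ⟨l1, l2, l3, -⟩ := hL _ (hT _ hx)
    have h1 : R3 < ‖w.2‖ := hx.1
    rw [hx2, G_phi d hd H G hGlim R B φ hB hφb hDH hφH _ l1 (by rw [l3]; simp only; linarith), l3]
  · intro z hz
    obtain ⟨N, hN⟩ := G_enters d hd H hH1 G hGlim R hR z hz
    set z0 := H^[N] z with hz0
    have hn : ∀ n : ℕ, H^[n] z0 ∈ Dset R ∧ 2 ^ n ≤ ‖(H^[n] z0).2‖ := by
      intro n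
      induction n with
      | zero => exact ⟨hN, by simpa using hR.trans hN.1.le⟩
      | succ n ih =>
        obtain ⟨h1, h2⟩ := ih
        rw [Function.iterate_succ_apply']
        refine ⟨hDH _ h1, ?_⟩
        have := hgrow _ h1
        rw [pow_succ]
        linarith
    obtain ⟨n, hn2⟩ := pow_unbounded_of_one_lt (2 * B + |R4| + R3 + R1) (one_lt_two (α := ℝ))
    obtain ⟨m1, m2⟩ := hn n
    have m3 := hDH _ m1
    have m4 := hgrow _ m1
    set z1 := H^[n] z0 with hz1
    have hx1 : (H z1).1 = z1.2 := hH1 z1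
    have hb := hφb _ m3
    have h4 := norm_sub_norm_le (H z1).2 (φ (H z1))
    rw [norm_sub_rev] at h4
    have hR4 := le_abs_self R4
    have hR4' := abs_nonneg R4
    have hT1 : ((H z1).1, φ (H z1)) ∈ Tset R3 := by
      refine ⟨by simp only; linarith, ?_⟩
      simp only [hx1]
      linarith
    obtain ⟨w, hw, hw2⟩ := hLW (H z1).1 (φ (H z1)) (by linarith) hT1
    refine ⟨n + 1 + N, w, hw, ?_⟩
    rw [Function.iterate_add_apply, ← hz0, Function.iterate_succ_apply', ← hz1, hw2]
    obtain ⟨l1, l2, l3, -⟩ := hL _ (hT _ hT1)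
    exact huniq _ l1 _ m3 l3 (by rw [l3]; simp only; linarith) l2
end
end

section
/- For every c > 0 there is an injective homomorphism from the additive group (ℂ, +) into the group of automorphisms of Ω'_c: there exists a family (f_γ)_{γ ∈ ℂ} such that each f_γ is an automorphism of Ω'_c, f_0 is the identity of Ω'_c, f_{γ+γ'}(z) = f_γ(f_{γ'}(z)) for all γ, γ' ∈ ℂ and z ∈ Ω'_c, and for γ ≠ γ' the maps f_γ and f_{γ'} do not agree on Ω'_c. -/
open Filter Topology Set

noncomputable section

/-- `f : U → V` and `g : V → U` are mutually inverse holomorphic maps, i.e.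
`f` is a biholomorphism from `U` onto `V` with inverse `g`. -/
def IsBiholoOn (f g : ℂ × ℂ → ℂ × ℂ) (U V : Set (ℂ × ℂ)) : Prop :=
  DifferentiableOn ℂ f U ∧ DifferentiableOn ℂ g V ∧
    Set.MapsTo f U V ∧ Set.MapsTo g V U ∧
    (∀ z ∈ U, g (f z) = z) ∧ (∀ w ∈ V, f (g w) = w)

namespace HenonFlow

/-- The Henon map. -/
def hen (a : ℂ) (p : Polynomial ℂ) (z : ℂ × ℂ) : ℂ × ℂ := (z.2, p.eval z.2 - a * z.1)

/-- Its inverse. -/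
def inv (a : ℂ) (p : Polynomial ℂ) (z : ℂ × ℂ) : ℂ × ℂ := ((p.eval z.1 - z.2) / a, z.1)

/-- The Hamiltonian flow of `log y`. -/
def shear (γ : ℂ) (z : ℂ × ℂ) : ℂ × ℂ := (z.1 + γ / z.2, z.2)

/-- The approximating flows. -/
def app (a l : ℂ) (p : Polynomial ℂ) : ℕ → ℂ → ℂ × ℂ → ℂ × ℂ
  | 0, γ, z => shear γ z
  | n + 1, γ, z => inv a p (app a l p n (γ * l) (hen a p z))

/-- The escape region. -/
def esc (R : ℝ) (γ : ℂ) : Set (ℂ × ℂ) := {z | ‖z.1‖ < ‖z.2‖ ∧ R < ‖z.2‖ ∧ ‖γ‖ < ‖z.2‖}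

/-- The limit flow. -/
def flow (a l : ℂ) (p : Polynomial ℂ) (γ : ℂ) (z : ℂ × ℂ) : ℂ × ℂ :=
  limUnder atTop (fun n => app a l p n γ z)

/-- The weighted distance used in the estimates. -/
def wt (γ : ℂ) (z : ℂ × ℂ) : ℝ := ‖γ‖ / ‖z.2‖ ^ 2

/-- The quantitative facts about the Henon map in the escape region. -/
structure Data (a l : ℂ) (p : Polynomial ℂ) (d : ℕ) (R B : ℝ) : Prop where
  a0 : a ≠ 0
  R1 : 1 ≤ R
  B0 : 0 ≤ B
  RB : 1 + 2 * B < R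
  stay : ∀ z : ℂ × ℂ, ‖z.1‖ < ‖z.2‖ → R < ‖z.2‖ →
    2 * (1 + ‖l‖) * ‖z.2‖ ≤ ‖(hen a p z).2‖ ∧ (‖z.2‖ / 2) ^ d ≤ ‖(hen a p z).2‖ / 2
  start : ∀ γ : ℂ, ∀ z ∈ esc R γ,
    ‖inv a p (shear (γ * l) (hen a p z)) - shear γ z‖ ≤ B * wt γ z
  contr : ∀ γ : ℂ, ∀ z ∈ esc R γ, ∀ E : ℝ, 0 ≤ E → ∀ w w' : ℂ × ℂ,
    ‖w.1‖ ≤ 2 * ‖z.2‖ → ‖w'.1‖ ≤ 2 * ‖z.2‖ →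
    ‖w - w'‖ ≤ E * wt (γ * l) (hen a p z) →
    ‖inv a p w - inv a p w'‖ ≤ E / 2 * wt γ z

theorem hen_inv {a : ℂ} (ha : a ≠ 0) (p : Polynomial ℂ) (z : ℂ × ℂ) :
    hen a p (inv a p z) = z := by
  ext <;> simp [hen, inv]
  field_simp
  ring

theorem inv_hen {a : ℂ} (ha : a ≠ 0) (p : Polynomial ℂ) (z : ℂ × ℂ) :
    inv a p (hen a p z) = z := by
  ext <;> simp [hen, inv]
  field_simp

theorem poly_bound (r : Polynomial ℂ) (m : ℕ) (hr : r.natDegree ≤ m) :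
    ∃ K : ℝ, 0 ≤ K ∧ ∀ (M : ℝ) (u : ℂ), 1 ≤ M → ‖u‖ ≤ M → ‖r.eval u‖ ≤ K * M ^ m := by
  refine ⟨∑ i ∈ Finset.range (r.natDegree + 1), ‖r.coeff i‖, by positivity, ?_⟩
  intro M u hM hu
  rw [Polynomial.eval_eq_sum_range, Finset.sum_mul]
  refine (norm_sum_le _ _).trans (Finset.sum_le_sum fun i hi => ?_)
  rw [norm_mul, norm_pow]
  gcongr
  calc ‖u‖ ^ i ≤ M ^ i := by gcongr
    _ ≤ M ^ m := pow_le_pow_right₀ hM (by have := Finset.mem_range.1 hi; omega)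

theorem poly_lip (r : Polynomial ℂ) (m : ℕ) (hr : r.natDegree ≤ m + 1) :
    ∃ K : ℝ, 0 ≤ K ∧ ∀ (M : ℝ) (u v : ℂ), 1 ≤ M → ‖u‖ ≤ M → ‖v‖ ≤ M →
      ‖r.eval u - r.eval v‖ ≤ K * M ^ m * ‖u - v‖ := by
  obtain ⟨K, hK, h⟩ := poly_bound r.derivative m
    ((Polynomial.natDegree_derivative_le r).trans (by omega))
  refine ⟨K, hK, fun M u v hM hu hv => ?_⟩
  refine (convex_closedBall (0 : ℂ) M).norm_image_sub_le_of_norm_hasDerivWithin_le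
    (f := fun z => r.eval z) (f' := fun z => r.derivative.eval z)
    (fun z _ => (r.hasDerivAt z).hasDerivWithinAt)
    (fun z hz => h M z hM (by simpa using hz)) (by simpa using hv) (by simpa using hu)

theorem poly_taylor (r : Polynomial ℂ) (m : ℕ) (hr : r.natDegree ≤ m + 1) :
    ∃ K : ℝ, 0 ≤ K ∧ ∀ (M : ℝ) (u v : ℂ), 1 ≤ M → ‖u‖ ≤ M → ‖u + v‖ ≤ M → ‖v‖ ≤ M →
      ‖r.eval (u + v) - r.eval u - r.derivative.eval u * v‖ ≤ K * (2 * M) ^ m * ‖v‖ ^ 2 := by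
  obtain ⟨K, hK, h⟩ := poly_lip r.derivative m
    ((Polynomial.natDegree_derivative_le r).trans (by omega))
  refine ⟨K, hK, fun M u v hM hu huv hv => ?_⟩
  have := (convex_closedBall (0 : ℂ) ‖v‖).norm_image_sub_le_of_norm_hasDerivWithin_le
    (f := fun z => r.eval (u + z) - r.derivative.eval u * z)
    (f' := fun z => r.derivative.eval (u + z) - r.derivative.eval u)
    (C := K * (2 * M) ^ m * ‖v‖) (x := 0) (y := v)
    (fun z _ => by
      have h1 : HasDerivAt (fun z => r.eval (u + z)) (r.derivative.eval (u + z)) z := by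
        simpa using (r.hasDerivAt (u + z)).comp_const_add u z
      have h2 : HasDerivAt (fun z => r.derivative.eval u * z) (r.derivative.eval u) z := by
        simpa using (hasDerivAt_id z).const_mul (r.derivative.eval u)
      exact (h1.sub h2).hasDerivWithinAt)
    (fun z hz => by
      have hz' : ‖z‖ ≤ ‖v‖ := by simpa using hz
      have h3 := h (2 * M) (u + z) u (by linarith)
        ((norm_add_le _ _).trans (by linarith)) (by linarith)
      rw [add_sub_cancel_left] at h3
      refine h3.trans ?_
      gcongr)
    (by simp) (by simp)
  simp only [add_zero, mul_zero, sub_zero] at this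
  calc _ = ‖r.eval (u + v) - r.derivative.eval u * v - r.eval u‖ := by congr 1; ring
    _ ≤ _ := this
    _ = _ := by ring

theorem poly_consts (p : Polynomial ℂ) (m : ℕ) (hpm : p.Monic) (hpd : p.natDegree = m + 1) :
    ∃ K : ℝ, 1 ≤ K ∧
      (∀ y : ℂ, 1 ≤ ‖y‖ → ‖p.eval y - y ^ (m + 1)‖ ≤ K * ‖y‖ ^ m) ∧
      (∀ y : ℂ, 1 ≤ ‖y‖ →
        ‖y * p.derivative.eval y - ((m + 1 : ℕ) : ℂ) * p.eval y‖ ≤ K * ‖y‖ ^ m) ∧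
      (∀ y u v : ℂ, 1 ≤ ‖y‖ → ‖u‖ ≤ 2 * ‖y‖ → ‖v‖ ≤ 2 * ‖y‖ →
        ‖p.eval u - p.eval v‖ ≤ K * ‖y‖ ^ m * ‖u - v‖) ∧
      (∀ y v : ℂ, 1 ≤ ‖y‖ → ‖v‖ ≤ ‖y‖ →
        ‖p.eval (y + v) - p.eval y - p.derivative.eval y * v‖ ≤ K * ‖y‖ ^ m * ‖v‖ ^ 2) := by
  have hlt : (p - Polynomial.X ^ (m + 1)).natDegree ≤ m := by
    rw [Polynomial.natDegree_le_iff_coeff_eq_zero]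
    intro N hN
    rw [Polynomial.coeff_sub, Polynomial.coeff_X_pow]
    by_cases h : N = m + 1
    · subst h
      have := hpm.coeff_natDegree
      rw [hpd] at this
      simp [this]
    · rw [if_neg h, Polynomial.coeff_eq_zero_of_natDegree_lt (by omega)]; simp
  have hlt2 : (Polynomial.X * p.derivative - Polynomial.C ((m + 1 : ℕ) : ℂ) * p).natDegree ≤ m := by
    rw [Polynomial.natDegree_le_iff_coeff_eq_zero]
    intro N hN
    obtain ⟨k, rfl⟩ : ∃ k, N = k + 1 := ⟨N - 1, by omega⟩
    rw [Polynomial.coeff_sub, Polynomial.coeff_X_mul, Polynomial.coeff_C_mul,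
      Polynomial.coeff_derivative]
    by_cases h : k = m
    · subst h
      push_cast; ring
    · rw [Polynomial.coeff_eq_zero_of_natDegree_lt (p := p) (by omega)]; simp
  obtain ⟨K1, h1, H1⟩ := poly_bound _ m hlt
  obtain ⟨K2, h2, H2⟩ := poly_bound _ m hlt2
  obtain ⟨K3, h3, H3⟩ := poly_lip p m hpd.le
  obtain ⟨K4, h4, H4⟩ := poly_taylor p m hpd.le
  have e3 : 0 ≤ K3 * 2 ^ m := by positivity
  have e4 : 0 ≤ K4 * 4 ^ m := by positivity
  refine ⟨1 + K1 + K2 + K3 * 2 ^ m + K4 * 4 ^ m, by linarith, ?_, ?_, ?_, ?_⟩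
  · intro y hy
    have := H1 ‖y‖ y hy le_rfl
    simp only [Polynomial.eval_sub, Polynomial.eval_pow, Polynomial.eval_X] at this
    refine this.trans ?_
    gcongr; linarith
  · intro y hy
    have := H2 ‖y‖ y hy le_rfl
    simp only [Polynomial.eval_sub, Polynomial.eval_mul, Polynomial.eval_X,
      Polynomial.eval_C] at this
    refine this.trans ?_
    gcongr; linarith
  · intro y u v hy hu hv
    refine (H3 (2 * ‖y‖) u v (by linarith) hu hv).trans ?_
    rw [mul_pow, ← mul_assoc]
    gcongr; linarith
  · intro y v hy hv
    refine (H4 (2 * ‖y‖) y v (by linarith) (by linarith)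
      ((norm_add_le _ _).trans (by linarith)) (by linarith)).trans ?_
    rw [← mul_assoc, mul_pow, ← mul_assoc]
    norm_num
    gcongr; linarith

set_option maxHeartbeats 2000000 in
theorem exists_data (d : ℕ) (hd : 2 ≤ d) (a : ℂ) (ha : a ≠ 0)
    (p : Polynomial ℂ) (hpm : p.Monic) (hpd : p.natDegree = d) :
    ∃ R B : ℝ, Data a (a / d) p d R B := by
  obtain ⟨m, rfl⟩ : ∃ m, d = m + 1 := ⟨d - 1, by omega⟩
  obtain ⟨K, hK, P1, P2, P3, P4⟩ := poly_consts p m hpm hpd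
  set l : ℂ := a / ((m + 1 : ℕ) : ℂ) with hl
  have hd0 : ((m + 1 : ℕ) : ℂ) ≠ 0 := by exact_mod_cast Nat.succ_ne_zero m
  have hla : a = l * ((m + 1 : ℕ) : ℂ) := by rw [hl]; field_simp
  set D : ℝ := ((m + 1 : ℕ) : ℝ) with hD
  have hDn : ‖((m + 1 : ℕ) : ℂ)‖ = D := by rw [hD]; exact Complex.norm_natCast _
  have hDpos : 0 < D := by rw [hD]; positivity
  set A : ℝ := ‖a‖ with hA
  have hApos : 0 < A := norm_pos_iff.2 ha
  set L : ℝ := ‖l‖ with hL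
  have hL0 : 0 ≤ L := norm_nonneg _
  set B : ℝ := (2 * L * (K + D * A) + 4 * K * L ^ 2) / A + 2 * L with hB
  have hB0 : 0 ≤ B := by positivity
  set R : ℝ := 2 + 2 * B + 2 * (K + A) + 4 * (1 + L) + 16 * K * L / A + 8 * L with hR
  have hq : 0 ≤ 16 * K * L / A := by positivity
  -- basic growth
  have grow : ∀ z : ℂ × ℂ, ‖z.1‖ < ‖z.2‖ → R < ‖z.2‖ →
      1 ≤ ‖z.2‖ ∧ ‖z.2‖ ≤ ‖z.2‖ ^ m ∧ ‖z.2‖ * ‖z.2‖ ^ m / 2 ≤ ‖(hen a p z).2‖ := by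
    intro z hz hz'
    have h1 : 1 ≤ ‖z.2‖ := by linarith
    have hs : ‖z.2‖ ≤ ‖z.2‖ ^ m := le_self_pow₀ h1 (by omega)
    refine ⟨h1, hs, ?_⟩
    have := P1 z.2 h1
    have e : (hen a p z).2 = z.2 ^ (m + 1) + (p.eval z.2 - z.2 ^ (m + 1)) - a * z.1 := by
      simp [hen]
    have e2 : ‖z.2 ^ (m + 1)‖ ≤ ‖(hen a p z).2‖ + ‖p.eval z.2 - z.2 ^ (m + 1)‖ + ‖a * z.1‖ := by
      have : z.2 ^ (m + 1) = (hen a p z).2 - (p.eval z.2 - z.2 ^ (m + 1)) + a * z.1 := by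
        rw [e]; ring
      calc ‖z.2 ^ (m + 1)‖ = ‖(hen a p z).2 - (p.eval z.2 - z.2 ^ (m + 1)) + a * z.1‖ := by
            rw [← this]
        _ ≤ _ := (norm_add_le _ _).trans (by gcongr; exact norm_sub_le _ _)
    rw [norm_pow, norm_mul] at e2
    have e3 : ‖a‖ * ‖z.1‖ ≤ A * ‖z.2‖ ^ m := by
      rw [← hA]; gcongr; linarith
    have e4 : (2 * (K + A)) * ‖z.2‖ ^ m ≤ ‖z.2‖ * ‖z.2‖ ^ m := by
      gcongr; linarith
    rw [pow_succ'] at e2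
    linarith
  refine ⟨R, B, ha, by linarith, hB0, by linarith, ?_, ?_, ?_⟩
  · intro z hz hz'
    obtain ⟨h1, hs, hg⟩ := grow z hz hz'
    constructor
    · refine le_trans ?_ hg
      have : 4 * (1 + L) * ‖z.2‖ ≤ ‖z.2‖ ^ m * ‖z.2‖ := by
        gcongr; linarith
      linarith
    · refine le_trans ?_ (div_le_div_of_nonneg_right hg (by norm_num))
      rw [div_pow, ← pow_succ', div_div]
      gcongr
      calc (2 * 2 : ℝ) = 2 ^ 2 := by norm_num
        _ ≤ 2 ^ (m + 1) := pow_le_pow_right₀ (by norm_num) hd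
  · intro γ z hz
    obtain ⟨hz1, hz2, hz3⟩ := hz
    obtain ⟨h1, hs, hg⟩ := grow z hz1 hz2
    have hYe : (hen a p z).2 = p.eval z.2 - a * z.1 := rfl
    have hH1 : (hen a p z).1 = z.2 := rfl
    set Y := (hen a p z).2 with hY
    set s := ‖z.2‖ ^ m with hsdef
    have hy0 : z.2 ≠ 0 := norm_pos_iff.1 (by linarith)
    have hYpos : 0 < ‖Y‖ := lt_of_lt_of_le (by positivity) hg
    have hY0 : Y ≠ 0 := norm_pos_iff.1 hYpos
    set δ := γ * l / Y with hδ
    have hδn : ‖δ‖ ≤ 2 * L * ‖γ‖ / (‖z.2‖ * s) := by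
      rw [hδ, norm_div, norm_mul]
      calc ‖γ‖ * L / ‖Y‖ ≤ ‖γ‖ * L / (‖z.2‖ * s / 2) := by gcongr
        _ = _ := by field_simp
    have hδ2 : ‖δ‖ ≤ 2 * L * wt γ z := by
      refine hδn.trans ?_
      rw [wt, mul_div_assoc, pow_two]
      gcongr
    have hw1 : wt γ z ≤ 1 := by
      rw [wt, div_le_one (by positivity), pow_two]
      nlinarith
    have hw0 : 0 ≤ wt γ z := by rw [wt]; positivity
    have hδ3 : ‖δ‖ ≤ ‖z.2‖ := by nlinarith
    have t1 := P4 z.2 δ h1 hδ3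
    have t2 : ‖p.derivative.eval z.2 * δ - ((m + 1 : ℕ) : ℂ) * (γ * l) / z.2‖ ≤
        2 * L * (K + D * A) * wt γ z := by
      have e : p.derivative.eval z.2 * δ - ((m + 1 : ℕ) : ℂ) * (γ * l) / z.2 =
          γ * l * ((z.2 * p.derivative.eval z.2 - ((m + 1 : ℕ) : ℂ) * p.eval z.2) +
            ((m + 1 : ℕ) : ℂ) * a * z.1) / (z.2 * Y) := by
        rw [hδ]
        field_simp
        rw [hYe]; ring
      rw [e, norm_div, norm_mul, norm_mul, norm_mul, wt]
      have e1 : ‖(z.2 * p.derivative.eval z.2 - ((m + 1 : ℕ) : ℂ) * p.eval z.2) +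
            ((m + 1 : ℕ) : ℂ) * a * z.1‖ ≤ (K + D * A) * s := by
        refine (norm_add_le _ _).trans ?_
        rw [norm_mul, norm_mul, hDn]
        have := P2 z.2 h1
        have e3 : D * ‖a‖ * ‖z.1‖ ≤ D * A * s := by
          rw [← hA]; gcongr; linarith
        linarith
      calc _ ≤ ‖γ‖ * ‖l‖ * ((K + D * A) * s) / (‖z.2‖ * (‖z.2‖ * s / 2)) := by gcongr
        _ = _ := by
          have : s ≠ 0 := by positivity
          rw [← hL]
          field_simp
    have t3 : K * s * ‖δ‖ ^ 2 ≤ 4 * K * L ^ 2 * wt γ z := by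
      calc K * s * ‖δ‖ ^ 2 ≤ K * s * (2 * L * ‖γ‖ / (‖z.2‖ * s)) ^ 2 := by gcongr
        _ = 4 * K * L ^ 2 * wt γ z * (‖γ‖ / s) := by
          rw [wt]
          have : s ≠ 0 := by positivity
          field_simp
          ring
        _ ≤ 4 * K * L ^ 2 * wt γ z * 1 := by
          gcongr
          rw [div_le_one (by positivity)]; linarith
        _ = _ := by ring
    have c1 : (inv a p (shear (γ * l) (hen a p z)) - shear γ z).1 =
        ((p.eval (z.2 + δ) - p.eval z.2 - p.derivative.eval z.2 * δ) +
         (p.derivative.eval z.2 * δ - ((m + 1 : ℕ) : ℂ) * (γ * l) / z.2)) / a := by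
      have : ((m + 1 : ℕ) : ℂ) * (γ * l) = γ * a := by rw [hla]; ring
      rw [this]
      simp only [inv, shear, Prod.fst_sub, hH1, ← hY, ← hδ]
      rw [hYe]
      field_simp
      ring
    have c2 : (inv a p (shear (γ * l) (hen a p z)) - shear γ z).2 = δ := by
      simp only [inv, shear, Prod.snd_sub, hH1, ← hY, ← hδ]
      ring
    rw [Prod.norm_def, c1, c2, hB]
    have q1 : 0 ≤ (2 * L * (K + D * A) + 4 * K * L ^ 2) / A * wt γ z := by positivity
    have q2 : 0 ≤ 2 * L * wt γ z := by positivity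
    refine max_le ?_ (by nlinarith)
    rw [norm_div, ← hA, add_mul]
    have : ‖(p.eval (z.2 + δ) - p.eval z.2 - p.derivative.eval z.2 * δ) +
         (p.derivative.eval z.2 * δ - ((m + 1 : ℕ) : ℂ) * (γ * l) / z.2)‖ / A ≤
         (2 * L * (K + D * A) + 4 * K * L ^ 2) / A * wt γ z := by
      rw [div_mul_eq_mul_div]
      gcongr
      refine (norm_add_le _ _).trans ?_
      linarith
    linarith
  · intro γ z hz E hE w w' hw hw' hww
    obtain ⟨hz1, hz2, hz3⟩ := hz
    obtain ⟨h1, hs, hg⟩ := grow z hz1 hz2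
    set s := ‖z.2‖ ^ m with hsdef
    have hs1 : 1 ≤ s := by linarith
    have hW : wt (γ * l) (hen a p z) ≤ 4 * L * wt γ z / s ^ 2 := by
      rw [wt, wt, norm_mul]
      calc ‖γ‖ * L / ‖(hen a p z).2‖ ^ 2 ≤ ‖γ‖ * L / (‖z.2‖ * s / 2) ^ 2 := by gcongr
        _ = _ := by field_simp; norm_num
    have hw0 : 0 ≤ wt γ z := by rw [wt]; positivity
    have hww2 : ‖w - w'‖ ≤ E * (4 * L * wt γ z / s ^ 2) := hww.trans (by gcongr)
    have hf : ‖w.1 - w'.1‖ ≤ ‖w - w'‖ := norm_fst_le (w - w')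
    have hsn : ‖w.2 - w'.2‖ ≤ ‖w - w'‖ := norm_snd_le (w - w')
    have c1 : (inv a p w - inv a p w').1 =
        ((p.eval w.1 - p.eval w'.1) - (w.2 - w'.2)) / a := by
      simp only [inv, Prod.fst_sub]; ring
    have c2 : (inv a p w - inv a p w').2 = w.1 - w'.1 := by
      simp only [inv, Prod.snd_sub]
    rw [Prod.norm_def, c1, c2]
    refine max_le ?_ ?_
    · rw [norm_div, ← hA, div_le_iff₀ hApos]
      have := P3 z.2 w.1 w'.1 h1 hw hw'
      have k1 : ‖p.eval w.1 - p.eval w'.1 - (w.2 - w'.2)‖ ≤ 2 * K * s * ‖w - w'‖ := by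
        refine (norm_sub_le _ _).trans ?_
        have k2 : K * s * ‖w.1 - w'.1‖ ≤ K * s * ‖w - w'‖ := by gcongr
        have k3 : 1 * ‖w - w'‖ ≤ K * s * ‖w - w'‖ := by
          gcongr; nlinarith
        linarith
      refine k1.trans ?_
      calc 2 * K * s * ‖w - w'‖ ≤ 2 * K * s * (E * (4 * L * wt γ z / s ^ 2)) := by gcongr
        _ = (E / 2 * wt γ z) * (16 * K * L / s) := by field_simp; ring
        _ ≤ (E / 2 * wt γ z) * A := by
          gcongr
          rw [div_le_iff₀ (by positivity)]
          have : 16 * K * L / A ≤ s := by linarith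
          rw [div_le_iff₀ hApos] at this
          linarith
    · refine hf.trans (hww2.trans ?_)
      calc E * (4 * L * wt γ z / s ^ 2) = (E / 2 * wt γ z) * (8 * L / s ^ 2) := by
            field_simp; ring
        _ ≤ (E / 2 * wt γ z) * 1 := by
          gcongr
          rw [div_le_one (by positivity)]
          nlinarith
        _ = _ := by ring

theorem diff_of_geom (g : ℕ → ℂ × ℂ → ℂ × ℂ) (f : ℂ × ℂ → ℂ × ℂ) (s : Set (ℂ × ℂ))
    (hs : IsOpen s) (B : ℝ) (hg : ∀ n, DifferentiableOn ℂ (g n) s)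
    (hb : ∀ n, ∀ z ∈ s, ‖g (n + 1) z - g n z‖ ≤ B * (1 / 2) ^ n)
    (hf : ∀ z ∈ s, Tendsto (fun n => g n z) atTop (𝓝 (f z))) (q : ℂ × ℂ) (hq : q ∈ s) :
    DifferentiableAt ℂ f q := by
  obtain ⟨r, hr, hrs⟩ := Metric.isOpen_iff.1 hs q hq
  set h : ℕ → ℂ × ℂ → ℂ × ℂ := fun n z => g (n + 1) z - g n z with hh
  have hdiff : ∀ n, DifferentiableOn ℂ (h n) s := fun n => (hg (n + 1)).sub (hg n)
  have hsub : ∀ z ∈ Metric.ball q (r / 2), Metric.ball z (r / 2) ⊆ s := by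
    intro z hz
    refine Subset.trans ?_ hrs
    apply Metric.ball_subset_ball'
    have := Metric.mem_ball.1 hz
    linarith
  have hbs : Metric.ball q (r / 2) ⊆ s := hsub q (Metric.mem_ball_self (by linarith))
  have hbound : ∀ n, ∀ z ∈ Metric.ball q (r / 2),
      ‖fderiv ℂ (h n) z‖ ≤ (B * (1 / 2) ^ n + B * (1 / 2) ^ n) / (r / 2) := by
    intro n z hz
    apply Complex.norm_fderiv_le_div_of_mapsTo_ball ((hdiff n).mono (hsub z hz)) _ (by linarith)
    intro w hw
    rw [mem_closedBall_iff_norm]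
    refine (norm_sub_le _ _).trans (add_le_add (hb n w (hsub z hz hw)) (hb n z (hbs hz)))
  have hgeo : Summable (fun n : ℕ => B * (1 / 2 : ℝ) ^ n) :=
    (summable_geometric_of_lt_one (by norm_num) (by norm_num)).mul_left B
  have hsum : ∀ z ∈ s, Summable (fun n => h n z) := fun z hz =>
    Summable.of_norm_bounded hgeo (fun n => hb n z hz)
  have key := hasFDerivAt_tsum_of_isPreconnected (𝕜 := ℂ) (f := h)
    (f' := fun n z => fderiv ℂ (h n) z)
    ((hgeo.add hgeo).div_const (r / 2)) (Metric.isOpen_ball (x := q) (ε := r / 2))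
    (convex_ball q (r / 2)).isPreconnected
    (fun n z hz => ((hdiff n).differentiableAt (hs.mem_nhds (hbs hz))).hasFDerivAt)
    hbound (Metric.mem_ball_self (by linarith)) (hsum q hq) (Metric.mem_ball_self (by linarith))
  have hfe : ∀ z ∈ s, f z = g 0 z + ∑' n, h n z := by
    intro z hz
    have t1 := (hsum z hz).hasSum.tendsto_sum_nat
    have t2 : (fun n => ∑ i ∈ Finset.range n, h i z) = fun n => g n z - g 0 z := by
      funext n
      exact Finset.sum_range_sub (fun i => g i z) n
    rw [t2] at t1
    have := tendsto_nhds_unique t1 ((hf z hz).sub_const (g 0 z))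
    rw [this]; abel
  have h0 : DifferentiableAt ℂ (g 0) q := (hg 0).differentiableAt (hs.mem_nhds hq)
  have := h0.add key.differentiableAt
  refine this.congr_of_eventuallyEq ?_
  filter_upwards [hs.mem_nhds hq] with z hz
  exact hfe z hz

variable {a l : ℂ} {p : Polynomial ℂ} {d : ℕ} {R B : ℝ}

theorem differentiable_hen : Differentiable ℂ (hen a p) := by
  unfold hen
  have : Differentiable ℂ (fun z : ℂ × ℂ => p.eval z.2) :=
    p.differentiable.comp differentiable_snd
  fun_prop

theorem differentiable_inv : Differentiable ℂ (inv a p) := by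
  unfold inv
  have : Differentiable ℂ (fun z : ℂ × ℂ => p.eval z.1) :=
    p.differentiable.comp differentiable_fst
  simp only [div_eq_mul_inv]
  fun_prop

theorem isOpen_esc (R : ℝ) (γ : ℂ) : IsOpen (esc R γ) := by
  unfold esc
  have h1 : Continuous (fun z : ℂ × ℂ => ‖z.1‖) := by fun_prop
  have h2 : Continuous (fun z : ℂ × ℂ => ‖z.2‖) := by fun_prop
  exact (isOpen_lt h1 h2).inter
    ((isOpen_lt continuous_const h2).inter (isOpen_lt continuous_const h2))

theorem wt_nonneg (γ : ℂ) (z : ℂ × ℂ) : 0 ≤ wt γ z := by unfold wt; positivity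

theorem wt_le_one (hD : Data a l p d R B) {γ : ℂ} {z : ℂ × ℂ} (hz : z ∈ esc R γ) :
    wt γ z ≤ 1 := by
  obtain ⟨_, h2, h3⟩ := hz
  have := hD.R1
  rw [wt, div_le_one (by nlinarith), pow_two]
  nlinarith [norm_nonneg z.2]

theorem hen_esc (hD : Data a l p d R B) {γ : ℂ} {z : ℂ × ℂ} (hz : z ∈ esc R γ) :
    hen a p z ∈ esc R (γ * l) := by
  obtain ⟨h1, h2, h3⟩ := hz
  have h4 := (hD.stay z h1 h2).1
  have := hD.R1
  have e : (hen a p z).1 = z.2 := rfl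
  refine ⟨?_, ?_, ?_⟩
  · rw [e]; nlinarith [norm_nonneg l]
  · nlinarith [norm_nonneg l]
  · rw [norm_mul]; nlinarith [norm_nonneg l, norm_nonneg γ]

theorem near (hD : Data a l p d R B) {γ : ℂ} {z w : ℂ × ℂ} (hz : z ∈ esc R γ)
    (hw : ‖w - shear γ z‖ ≤ 2 * B * wt γ z) : ‖w - z‖ ≤ 1 + 2 * B := by
  have h1 := wt_le_one hD hz
  have h2 : ‖shear γ z - z‖ ≤ 1 := by
    have : shear γ z - z = (γ / z.2, 0) := by ext <;> simp [shear]
    rw [this, Prod.norm_def]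
    simp only [norm_zero, norm_div]
    refine max_le ?_ zero_le_one
    obtain ⟨_, h2, h3⟩ := hz
    have := hD.R1
    rw [div_le_one (by linarith)]
    exact h3.le
  have : w - z = (w - shear γ z) + (shear γ z - z) := by abel
  rw [this]
  refine (norm_add_le _ _).trans ?_
  have : 2 * B * wt γ z ≤ 2 * B * 1 := by
    gcongr
    have := hD.B0
    linarith
  linarith

theorem app_est (hD : Data a l p d R B) (n : ℕ) : ∀ γ : ℂ, ∀ z ∈ esc R γ,
    ‖app a l p (n + 1) γ z - app a l p n γ z‖ ≤ B * (1 / 2) ^ n * wt γ z ∧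
    ‖app a l p n γ z - shear γ z‖ ≤ 2 * B * (1 - (1 / 2) ^ n) * wt γ z := by
  induction n with
  | zero =>
    intro γ z hz
    refine ⟨?_, by simp [app]⟩
    simpa [app] using hD.start γ z hz
  | succ n ih =>
    intro γ z hz
    obtain ⟨i1, i2⟩ := ih (γ * l) (hen a p z) (hen_esc hD hz)
    obtain ⟨j1, j2⟩ := ih γ z hz
    have hB := hD.B0
    have hRB := hD.RB
    have w0 := wt_nonneg γ z
    have w0' := wt_nonneg (γ * l) (hen a p z)
    have hpos : (0 : ℝ) < (1 / 2) ^ n := by positivity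
    have e1 : ‖app a l p n (γ * l) (hen a p z) - shear (γ * l) (hen a p z)‖
        ≤ 2 * B * wt (γ * l) (hen a p z) := by
      refine i2.trans (mul_le_mul_of_nonneg_right ?_ w0')
      nlinarith
    have e2 : ‖app a l p (n + 1) (γ * l) (hen a p z) - shear (γ * l) (hen a p z)‖
        ≤ 2 * B * wt (γ * l) (hen a p z) := by
      have : app a l p (n + 1) (γ * l) (hen a p z) - shear (γ * l) (hen a p z) =
        (app a l p (n + 1) (γ * l) (hen a p z) - app a l p n (γ * l) (hen a p z)) +
        (app a l p n (γ * l) (hen a p z) - shear (γ * l) (hen a p z)) := by abel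
      rw [this]
      refine (norm_add_le _ _).trans ((add_le_add i1 i2).trans ?_)
      rw [← add_mul]
      gcongr
      nlinarith
    have bd : ∀ w : ℂ × ℂ, ‖w - shear (γ * l) (hen a p z)‖
        ≤ 2 * B * wt (γ * l) (hen a p z) → ‖w.1‖ ≤ 2 * ‖z.2‖ := by
      intro w hw
      have h1 := near hD (hen_esc hD hz) hw
      have h2 : ‖w.1 - z.2‖ ≤ ‖w - hen a p z‖ := norm_fst_le (w - hen a p z)
      have h3 : ‖w.1‖ ≤ ‖w.1 - z.2‖ + ‖z.2‖ := by
        simpa using norm_add_le (w.1 - z.2) z.2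
      have := hz.2.1
      linarith
    constructor
    · have := hD.contr γ z hz (B * (1 / 2) ^ n) (by positivity) _ _ (bd _ e2) (bd _ e1) i1
      have e : B * (1 / 2) ^ (n + 1) * wt γ z = B * (1 / 2) ^ n / 2 * wt γ z := by
        rw [pow_succ]; ring
      rw [e]
      exact this
    · have : app a l p (n + 1) γ z - shear γ z =
        (app a l p (n + 1) γ z - app a l p n γ z) + (app a l p n γ z - shear γ z) := by abel
      rw [this]
      refine (norm_add_le _ _).trans ((add_le_add j1 j2).trans ?_)
      rw [← add_mul, pow_succ]
      gcongr
      nlinarith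

theorem app_est1 (hD : Data a l p d R B) (n : ℕ) {γ : ℂ} {z : ℂ × ℂ} (hz : z ∈ esc R γ) :
    ‖app a l p (n + 1) γ z - app a l p n γ z‖ ≤ B * (1 / 2) ^ n := by
  refine (app_est hD n γ z hz).1.trans ?_
  have := hD.B0
  exact mul_le_of_le_one_right (by positivity) (wt_le_one hD hz)

theorem app_tendsto (hD : Data a l p d R B) {γ : ℂ} {z : ℂ × ℂ} (hz : z ∈ esc R γ) :
    Tendsto (fun n => app a l p n γ z) atTop (𝓝 (flow a l p γ z)) := by
  have : CauchySeq (fun n => app a l p n γ z) := by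
    refine cauchySeq_of_le_geometric (1 / 2) B (by norm_num) fun n => ?_
    rw [dist_comm, dist_eq_norm]
    exact app_est1 hD n hz
  exact this.tendsto_limUnder

theorem app_dist (hD : Data a l p d R B) (n : ℕ) {γ : ℂ} {z : ℂ × ℂ} (hz : z ∈ esc R γ) :
    dist (app a l p n γ z) (flow a l p γ z) ≤ B * (1 / 2) ^ n / (1 - 1 / 2) := by
  refine dist_le_of_le_geometric_of_tendsto (1 / 2) B (by norm_num) (fun n => ?_)
    (app_tendsto hD hz) n
  rw [dist_comm, dist_eq_norm]
  exact app_est1 hD n hz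

theorem flow_shear (hD : Data a l p d R B) {γ : ℂ} {z : ℂ × ℂ} (hz : z ∈ esc R γ) :
    ‖flow a l p γ z - shear γ z‖ ≤ 2 * B * wt γ z := by
  refine le_of_tendsto ((app_tendsto hD hz).sub_const _).norm (Eventually.of_forall fun n => ?_)
  refine (app_est hD n γ z hz).2.trans (mul_le_mul_of_nonneg_right ?_ (wt_nonneg γ z))
  have := hD.B0
  have hpos : (0 : ℝ) < (1 / 2) ^ n := by positivity
  nlinarith

theorem app_diff (hD : Data a l p d R B) (n : ℕ) : ∀ γ : ℂ,
    DifferentiableOn ℂ (app a l p n γ) (esc R γ) := by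
  induction n with
  | zero =>
    intro γ z hz
    apply DifferentiableAt.differentiableWithinAt
    have h0 : z.2 ≠ 0 := by
      have := hD.R1
      have := hz.2.1
      exact norm_pos_iff.1 (by linarith)
    have : app a l p 0 γ = fun z : ℂ × ℂ => (z.1 + γ / z.2, z.2) := by
      funext z; rfl
    rw [this]
    have h2 : DifferentiableAt ℂ (fun z : ℂ × ℂ => γ / z.2) z := by
      have h3 : DifferentiableAt ℂ (fun z : ℂ × ℂ => (z.2)⁻¹) z :=
        (differentiableAt_inv h0).comp z differentiableAt_snd
      simp only [div_eq_mul_inv]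
      exact h3.const_mul γ
    fun_prop
  | succ n ih =>
    intro γ
    have : app a l p (n + 1) γ = inv a p ∘ (app a l p n (γ * l) ∘ hen a p) := by
      funext z; rfl
    rw [this]
    refine differentiable_inv.comp_differentiableOn ?_
    exact (ih (γ * l)).comp differentiable_hen.differentiableOn (fun z hz => hen_esc hD hz)

/-- Local regularity of the flow at a point. -/
def Good (a l : ℂ) (p : Polynomial ℂ) (γ : ℂ) (q : ℂ × ℂ) : Prop :=
  DifferentiableAt ℂ (flow a l p γ) q ∧
  (∀ᶠ z in 𝓝 q, Tendsto (fun n => app a l p n γ z) atTop (𝓝 (flow a l p γ z))) ∧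
  (∀ z : ℕ → ℂ × ℂ, Tendsto z atTop (𝓝 q) →
    Tendsto (fun n => app a l p n γ (z n)) atTop (𝓝 (flow a l p γ q)))

theorem good_base (hD : Data a l p d R B) {γ : ℂ} {q : ℂ × ℂ} (hq : q ∈ esc R γ) :
    Good a l p γ q := by
  have hdiff : DifferentiableAt ℂ (flow a l p γ) q :=
    diff_of_geom (fun n => app a l p n γ) _ (esc R γ) (isOpen_esc R γ) B
      (fun n => app_diff hD n γ) (fun n z hz => app_est1 hD n hz)
      (fun z hz => app_tendsto hD hz) q hq
  refine ⟨hdiff, ?_, ?_⟩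
  · filter_upwards [(isOpen_esc R γ).mem_nhds hq] with z hz
    exact app_tendsto hD hz
  · intro z hz
    have t1 : Tendsto (fun n => flow a l p γ (z n)) atTop (𝓝 (flow a l p γ q)) :=
      hdiff.continuousAt.tendsto.comp hz
    refine t1.congr_dist ?_
    have hge : Tendsto (fun n : ℕ => B * (1 / 2 : ℝ) ^ n / (1 - 1 / 2)) atTop (𝓝 0) := by
      have := ((tendsto_pow_atTop_nhds_zero_of_lt_one (r := (1 / 2 : ℝ)) (by norm_num)
        (by norm_num)).const_mul B).div_const (1 - 1 / 2)
      simpa using this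
    refine squeeze_zero' (Eventually.of_forall fun n => dist_nonneg) ?_ hge
    filter_upwards [hz.eventually ((isOpen_esc R γ).mem_nhds hq)] with n hn
    rw [dist_comm]
    exact app_dist hD n hn

theorem tendsto_step {γ : ℂ} {q w : ℂ × ℂ}
    (h : Tendsto (fun n => app a l p n (γ * l) (hen a p q)) atTop (𝓝 w)) :
    Tendsto (fun n => app a l p n γ q) atTop (𝓝 (inv a p w)) := by
  rw [← tendsto_add_atTop_iff_nat 1]
  exact (differentiable_inv.continuous.tendsto w).comp h

theorem flow_step {γ : ℂ} {q : ℂ × ℂ}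
    (h : Tendsto (fun n => app a l p n (γ * l) (hen a p q)) atTop
      (𝓝 (flow a l p (γ * l) (hen a p q)))) :
    flow a l p γ q = inv a p (flow a l p (γ * l) (hen a p q)) :=
  (tendsto_step h).limUnder_eq

theorem good_step {γ : ℂ} {q : ℂ × ℂ} (h : Good a l p (γ * l) (hen a p q)) :
    Good a l p γ q := by
  obtain ⟨h1, h2, h3⟩ := h
  have h2' : ∀ᶠ z in 𝓝 q, Tendsto (fun n => app a l p n (γ * l) (hen a p z)) atTop
      (𝓝 (flow a l p (γ * l) (hen a p z))) :=
    (differentiable_hen.continuous.tendsto q).eventually h2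
  refine ⟨?_, ?_, ?_⟩
  · have : DifferentiableAt ℂ (fun z => inv a p (flow a l p (γ * l) (hen a p z))) q :=
      (differentiable_inv _).comp q (h1.comp q (differentiable_hen q))
    refine this.congr_of_eventuallyEq ?_
    filter_upwards [h2'] with z hz
    exact flow_step hz
  · filter_upwards [h2'] with z hz
    rw [flow_step hz]
    exact tendsto_step hz
  · intro z hz
    rw [flow_step h2'.self_of_nhds, ← tendsto_add_atTop_iff_nat 1]
    have := h3 (fun n => hen a p (z (n + 1)))
      ((differentiable_hen.continuous.tendsto q).comp ((tendsto_add_atTop_iff_nat 1).2 hz))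
    exact (differentiable_inv.continuous.tendsto _).comp this

theorem good_of_iter (hD : Data a l p d R B) (N : ℕ) : ∀ (γ : ℂ) (q : ℂ × ℂ),
    (hen a p)^[N] q ∈ esc R (γ * l ^ N) → Good a l p γ q := by
  induction N with
  | zero => intro γ q h; exact good_base hD (by simpa using h)
  | succ N ih =>
    intro γ q h
    refine good_step (ih _ _ ?_)
    rw [Function.iterate_succ_apply] at h
    rwa [mul_assoc, ← pow_succ']

theorem shear_add (γ γ' : ℂ) (z : ℂ × ℂ) : shear (γ + γ') z = shear γ (shear γ' z) := by
  ext <;> simp [shear]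
  ring

theorem app_add (ha : a ≠ 0) (n : ℕ) : ∀ (γ γ' : ℂ) (z : ℂ × ℂ),
    app a l p n (γ + γ') z = app a l p n γ (app a l p n γ' z) := by
  induction n with
  | zero => intro γ γ' z; exact shear_add γ γ' z
  | succ n ih => intro γ γ' z; simp only [app]; rw [add_mul, ih, hen_inv ha]

theorem app_zero (ha : a ≠ 0) (n : ℕ) : ∀ (z : ℂ × ℂ), app a l p n 0 z = z := by
  induction n with
  | zero => intro z; simp [app, shear]
  | succ n ih => intro z; simp only [app]; rw [zero_mul, ih, inv_hen ha]

theorem flow_zero (ha : a ≠ 0) (z : ℂ × ℂ) : flow a l p 0 z = z := by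
  unfold flow
  simp only [app_zero ha]
  exact tendsto_const_nhds.limUnder_eq

theorem flow_add (ha : a ≠ 0) {γ γ' : ℂ} {z : ℂ × ℂ} (h' : Good a l p γ' z)
    (h : Good a l p γ (flow a l p γ' z)) :
    flow a l p (γ + γ') z = flow a l p γ (flow a l p γ' z) := by
  have := h.2.2 _ h'.2.1.self_of_nhds
  simp only [← app_add ha] at this
  exact this.limUnder_eq

theorem iter_esc (hD : Data a l p d R B) {γ : ℂ} {q : ℂ × ℂ} {N : ℕ}
    (h : (hen a p)^[N] q ∈ esc R (γ * l ^ N)) (n : ℕ) (hn : N ≤ n) :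
    (hen a p)^[n] q ∈ esc R (γ * l ^ n) := by
  induction n, hn using Nat.le_induction with
  | base => exact h
  | succ n hn ih =>
    rw [Function.iterate_succ_apply', pow_succ, ← mul_assoc]
    exact hen_esc hD ih

/-- Once the orbit enters the escape region, it eventually beats the parameter. -/
theorem esc_of_region (hD : Data a l p d R B) (γ : ℂ) {q : ℂ × ℂ}
    (hq : ‖q.1‖ < ‖q.2‖ ∧ R < ‖q.2‖) :
    ∃ m : ℕ, (hen a p)^[m] q ∈ esc R (γ * l ^ m) := by
  have hR := hD.R1
  have key : ∀ m : ℕ, (‖((hen a p)^[m] q).1‖ < ‖((hen a p)^[m] q).2‖ ∧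
      R < ‖((hen a p)^[m] q).2‖) ∧
      ‖γ * l ^ m‖ * 2 ^ m * ‖q.2‖ ≤ ‖γ‖ * ‖((hen a p)^[m] q).2‖ := by
    intro m
    induction m with
    | zero => exact ⟨hq, by simp⟩
    | succ m ih =>
      rw [Function.iterate_succ_apply']
      obtain ⟨⟨i1, i2⟩, i3⟩ := ih
      set z := (hen a p)^[m] q
      have e : (hen a p z).1 = z.2 := rfl
      have h4 := (hD.stay z i1 i2).1
      have hl := norm_nonneg l
      refine ⟨⟨?_, ?_⟩, ?_⟩
      · rw [e]; nlinarith
      · nlinarith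
      · have h5 : 2 * ‖l‖ * ‖z.2‖ ≤ ‖(hen a p z).2‖ := by nlinarith
        calc ‖γ * l ^ (m + 1)‖ * 2 ^ (m + 1) * ‖q.2‖
            = (‖γ * l ^ m‖ * 2 ^ m * ‖q.2‖) * (2 * ‖l‖) := by
              rw [norm_mul, norm_mul, norm_pow, norm_pow]; ring
          _ ≤ (‖γ‖ * ‖z.2‖) * (2 * ‖l‖) := by gcongr
          _ = ‖γ‖ * (2 * ‖l‖ * ‖z.2‖) := by ring
          _ ≤ _ := by gcongr
  obtain ⟨m, hm⟩ := pow_unbounded_of_one_lt ‖γ‖ (one_lt_two : (1 : ℝ) < 2)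
  refine ⟨m, (key m).1.1, (key m).1.2, ?_⟩
  have k := (key m).2
  have k2 := (key m).1.2
  have hq2 : 1 ≤ ‖q.2‖ := by linarith [hq.2]
  by_contra! hcon
  have p2 : (0 : ℝ) < 2 ^ m := by positivity
  have c1 : ‖γ‖ * ‖((hen a p)^[m] q).2‖ < 2 ^ m * ‖((hen a p)^[m] q).2‖ := by
    apply mul_lt_mul_of_pos_right hm; linarith
  have c2 : 2 ^ m * ‖((hen a p)^[m] q).2‖ ≤ ‖γ * l ^ m‖ * 2 ^ m * ‖q.2‖ := by
    calc 2 ^ m * ‖((hen a p)^[m] q).2‖ ≤ 2 ^ m * ‖γ * l ^ m‖ := by gcongr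
      _ = ‖γ * l ^ m‖ * 2 ^ m * 1 := by ring
      _ ≤ _ := by gcongr
  linarith

/-- If the orbit never enters the region, it is bounded. -/
theorem bounded_of_not (q : ℂ × ℂ)
    (h : ∀ n : ℕ, ¬ (‖((hen a p)^[n] q).1‖ < ‖((hen a p)^[n] q).2‖ ∧
      R < ‖((hen a p)^[n] q).2‖)) (n : ℕ) :
    ‖(hen a p)^[n] q‖ ≤ max R ‖q‖ := by
  induction n with
  | zero => simp
  | succ n ih =>
    have h2 := h (n + 1)
    rw [Function.iterate_succ_apply'] at h2 ⊢
    set z := (hen a p)^[n] q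
    have e : (hen a p z).1 = z.2 := rfl
    have hz : ‖(hen a p z).1‖ ≤ max R ‖q‖ := by rw [e]; exact (norm_snd_le z).trans ih
    rw [Prod.norm_def]
    refine max_le hz ?_
    by_contra! hc
    exact h2 ⟨hz.trans_lt hc, (le_max_left _ _).trans_lt hc⟩

variable {G : ℂ × ℂ → ℝ}

/-- `G` is the escape rate of the Henon map. -/
def IsGreen (a : ℂ) (p : Polynomial ℂ) (d : ℕ) (G : ℂ × ℂ → ℝ) : Prop :=
  ∀ z : ℂ × ℂ, Tendsto (fun n : ℕ => Real.log (max ‖(hen a p)^[n] z‖ 1) / (d : ℝ) ^ n)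
    atTop (𝓝 (G z))

theorem tendsto_const_div (hd : 2 ≤ d) (C : ℝ) :
    Tendsto (fun n : ℕ => C / (d : ℝ) ^ n) atTop (𝓝 0) := by
  refine tendsto_const_nhds.div_atTop (tendsto_pow_atTop_atTop_of_one_lt ?_)
  exact_mod_cast (by omega : 1 < d)

theorem green_hen (hd : 2 ≤ d) (hG : IsGreen a p d G) (z : ℂ × ℂ) :
    G (hen a p z) = d * G z := by
  have hd0 : (d : ℝ) ≠ 0 := by exact_mod_cast (by omega : d ≠ 0)
  have h1 := ((tendsto_add_atTop_iff_nat 1).2 (hG z)).const_mul (d : ℝ)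
  refine tendsto_nhds_unique (hG (hen a p z)) (h1.congr fun n => ?_)
  rw [Function.iterate_succ_apply, pow_succ]
  field_simp

theorem escape (hd : 2 ≤ d) (hD : Data a l p d R B) (hG : IsGreen a p d G) (γ : ℂ)
    {z : ℂ × ℂ} (hz : 0 < G z) : ∃ N : ℕ, (hen a p)^[N] z ∈ esc R (γ * l ^ N) := by
  by_cases h : ∀ n : ℕ, ¬ (‖((hen a p)^[n] z).1‖ < ‖((hen a p)^[n] z).2‖ ∧
      R < ‖((hen a p)^[n] z).2‖)
  · exfalso
    have hb := bounded_of_not z h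
    have : G z ≤ 0 := by
      refine le_of_tendsto_of_tendsto' (hG z)
        (tendsto_const_div hd (Real.log (max (max R ‖z‖) 1))) fun n => ?_
      gcongr
      exact hb n
    linarith
  · push Not at h
    obtain ⟨n, h1, h2⟩ := h
    obtain ⟨m, hm⟩ := esc_of_region hD (γ * l ^ n) ⟨h1, h2⟩
    refine ⟨m + n, ?_⟩
    rw [Function.iterate_add_apply, pow_add, mul_comm (l ^ m), ← mul_assoc]
    exact hm

theorem good_of_pos (hd : 2 ≤ d) (hD : Data a l p d R B) (hG : IsGreen a p d G) (γ : ℂ)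
    {z : ℂ × ℂ} (hz : 0 < G z) : Good a l p γ z := by
  obtain ⟨N, hN⟩ := escape hd hD hG γ hz
  exact good_of_iter hD N γ z hN

theorem hen_flow (hd : 2 ≤ d) (hD : Data a l p d R B) (hG : IsGreen a p d G) (n : ℕ) :
    ∀ (γ : ℂ) (z : ℂ × ℂ), 0 < G z →
    (hen a p)^[n] (flow a l p γ z) = flow a l p (γ * l ^ n) ((hen a p)^[n] z) := by
  induction n with
  | zero => intro γ z _; simp
  | succ n ih =>
    intro γ z hz
    have hz' : 0 < G (hen a p z) := by
      rw [green_hen hd hG]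
      have : (0 : ℝ) < d := by exact_mod_cast (by omega : 0 < d)
      positivity
    have hg := good_of_pos hd hD hG (γ * l) hz'
    rw [Function.iterate_succ_apply, Function.iterate_succ_apply,
      flow_step hg.2.1.self_of_nhds, hen_inv hD.a0, ih _ _ hz', mul_assoc, ← pow_succ']

theorem log_le_aux {u v : ℂ × ℂ} {C : ℝ} (hC : 0 ≤ C) (h : ‖u - v‖ ≤ C) :
    Real.log (max ‖u‖ 1) ≤ Real.log (max ‖v‖ 1) + Real.log (1 + C) := by
  have h1 : 1 ≤ max ‖v‖ 1 := le_max_right _ _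
  rw [← Real.log_mul (by positivity) (by positivity)]
  apply Real.log_le_log (by positivity)
  have h2 : ‖u‖ ≤ ‖u - v‖ + ‖v‖ := by simpa using norm_add_le (u - v) v
  have h3 : ‖v‖ ≤ max ‖v‖ 1 := le_max_left _ _
  refine max_le ?_ ?_ <;> nlinarith

theorem green_flow (hd : 2 ≤ d) (hD : Data a l p d R B) (hG : IsGreen a p d G) (γ : ℂ)
    {z : ℂ × ℂ} (hz : 0 < G z) : G (flow a l p γ z) = G z := by
  obtain ⟨N, hN⟩ := escape hd hD hG γ hz
  have hC : 0 ≤ 1 + 2 * B := by have := hD.B0; linarith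
  have key : ∀ n, N ≤ n →
      ‖(hen a p)^[n] (flow a l p γ z) - (hen a p)^[n] z‖ ≤ 1 + 2 * B := by
    intro n hn
    have h1 := iter_esc hD hN n hn
    rw [hen_flow hd hD hG n γ z hz]
    exact near hD h1 (flow_shear hD h1)
  have t0 := tendsto_const_div hd (Real.log (1 + (1 + 2 * B)))
  apply le_antisymm
  · have := (hG z).add t0
    rw [add_zero] at this
    refine le_of_tendsto_of_tendsto (hG _) this ?_
    filter_upwards [eventually_ge_atTop N] with n hn
    rw [← add_div]
    gcongr
    exact log_le_aux hC (key n hn)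
  · have := (hG (flow a l p γ z)).add t0
    rw [add_zero] at this
    refine le_of_tendsto_of_tendsto (hG _) this ?_
    filter_upwards [eventually_ge_atTop N] with n hn
    rw [← add_div]
    gcongr
    refine log_le_aux hC ?_
    rw [norm_sub_rev]
    exact key n hn

theorem flow_free (hd : 2 ≤ d) (hl : l ≠ 0) (hD : Data a l p d R B) (hG : IsGreen a p d G)
    {γ : ℂ} (hγ : γ ≠ 0) {z : ℂ × ℂ} (hz : 0 < G z) : flow a l p γ z ≠ z := by
  intro heq
  obtain ⟨N, hN⟩ := escape hd hD hG γ hz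
  have h1 := hen_flow hd hD hG N γ z hz
  rw [heq] at h1
  have h2 := flow_shear hD hN
  rw [← h1] at h2
  set w := (hen a p)^[N] z
  set g := γ * l ^ N
  have hg : 0 < ‖g‖ := norm_pos_iff.2 (mul_ne_zero hγ (pow_ne_zero _ hl))
  have hR := hD.R1
  have hRB := hD.RB
  have hw := hN.2.1
  have hw0 : 0 < ‖w.2‖ := by linarith
  have h3 : ‖g / w.2‖ ≤ ‖w - shear g w‖ := by
    have : (w - shear g w).1 = -(g / w.2) := by simp [shear]
    rw [← norm_neg, ← this]
    exact norm_fst_le _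
  have h4 := h3.trans h2
  rw [norm_div, wt, ← mul_div_assoc, div_le_div_iff₀ hw0 (by positivity)] at h4
  have h5 : 2 * B * (‖g‖ * ‖w.2‖) < ‖w.2‖ * (‖g‖ * ‖w.2‖) := by
    apply mul_lt_mul_of_pos_right _ (by positivity)
    linarith
  nlinarith

theorem exists_pos (hd : 2 ≤ d) (hD : Data a l p d R B) (hG : IsGreen a p d G) :
    ∃ z, 0 < G z := by
  have hR := hD.R1
  set r : ℝ := R + 2 with hr
  have hrn : ‖((r : ℝ) : ℂ)‖ = r := by
    rw [Complex.norm_real, Real.norm_of_nonneg (by linarith)]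
  refine ⟨(0, (r : ℂ)), ?_⟩
  set z : ℂ × ℂ := (0, (r : ℂ)) with hz
  have key : ∀ m : ℕ, ‖((hen a p)^[m] z).1‖ < ‖((hen a p)^[m] z).2‖ ∧
      R < ‖((hen a p)^[m] z).2‖ ∧ (r / 2) ^ (d ^ m) ≤ ‖((hen a p)^[m] z).2‖ / 2 := by
    intro m
    induction m with
    | zero =>
      simp only [Function.iterate_zero, id, hz, hrn, norm_zero, pow_zero, pow_one]
      refine ⟨by linarith, by linarith, le_rfl⟩
    | succ m ih =>
      rw [Function.iterate_succ_apply']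
      obtain ⟨i1, i2, i3⟩ := ih
      set w := (hen a p)^[m] z
      have e : (hen a p w).1 = w.2 := rfl
      obtain ⟨h4, h5⟩ := hD.stay w i1 i2
      have hl := norm_nonneg l
      refine ⟨?_, ?_, ?_⟩
      · rw [e]; nlinarith
      · nlinarith
      · refine le_trans ?_ h5
        rw [pow_succ, pow_mul]
        gcongr
  have hpos : 0 < Real.log (r / 2) := Real.log_pos (by linarith)
  refine hpos.trans_le (ge_of_tendsto (hG z) (Eventually.of_forall fun n => ?_))
  have hd0 : (0 : ℝ) < d := by exact_mod_cast (by omega : 0 < d)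
  rw [le_div_iff₀ (by positivity)]
  have : Real.log (r / 2) * (d : ℝ) ^ n = Real.log ((r / 2) ^ (d ^ n)) := by
    rw [Real.log_pow]; push_cast; ring
  rw [this]
  apply Real.log_le_log (by positivity)
  refine (key n).2.2.trans (le_max_of_le_left ?_)
  have := norm_snd_le ((hen a p)^[n] z)
  have := norm_nonneg ((hen a p)^[n] z).2
  linarith

theorem exists_mem (hd : 2 ≤ d) (hD : Data a l p d R B) (hG : IsGreen a p d G)
    {c : ℝ} (hc : 0 < c) : ∃ z, 0 < G z ∧ G z < c := by
  obtain ⟨z, hz⟩ := exists_pos hd hD hG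
  have hd0 : (0 : ℝ) < d := by exact_mod_cast (by omega : 0 < d)
  have key : ∀ k : ℕ, G ((inv a p)^[k] z) = G z / (d : ℝ) ^ k := by
    intro k
    induction k with
    | zero => simp
    | succ k ih =>
      rw [Function.iterate_succ_apply']
      have := green_hen hd hG (inv a p ((inv a p)^[k] z))
      rw [hen_inv hD.a0, ih] at this
      rw [pow_succ]
      field_simp at this ⊢
      linarith
  obtain ⟨k, hk⟩ := ((tendsto_const_div hd (G z)).eventually (gt_mem_nhds hc)).exists
  refine ⟨(inv a p)^[k] z, ?_, ?_⟩
  · rw [key]; positivity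
  · rw [key]; exact hk

end HenonFlow

/-- For every `c > 0` there is an injective homomorphism of the additive
group `(ℂ, +)` into the automorphism group of `Ω'_c = {0 < G⁺_H < c}`: a family
`(f_γ)_{γ∈ℂ}` of automorphisms of `Ω'_c` with `f_0 = id`, the cocycle property
`f_{γ+γ'} = f_γ ∘ f_{γ'}` on `Ω'_c`, and `f_γ ≠ f_{γ'}` on `Ω'_c` whenever `γ ≠ γ'`. -/
theorem stmt_12 (d : ℕ) (hd : 2 ≤ d) (a : ℂ) (ha : a ≠ 0)
    (p : Polynomial ℂ) (hpm : p.Monic) (hpd : p.natDegree = d)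
    (hpc : p.coeff (d - 1) = 0)
    (H : ℂ × ℂ → ℂ × ℂ) (hH : ∀ z : ℂ × ℂ, H z = (z.2, p.eval z.2 - a * z.1))
    (G : ℂ × ℂ → ℝ) (hGcont : Continuous G) (hGnonneg : ∀ z, 0 ≤ G z)
    (hGlim : ∀ z : ℂ × ℂ,
      Tendsto (fun n : ℕ => Real.log (max ‖H^[n] z‖ 1) / (d : ℝ) ^ n) atTop (𝓝 (G z)))
    (c : ℝ) (hc : 0 < c) :
    ∃ f : ℂ → (ℂ × ℂ → ℂ × ℂ),
      (∀ γ : ℂ, ∃ g : ℂ × ℂ → ℂ × ℂ,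
        IsBiholoOn (f γ) g {z : ℂ × ℂ | 0 < G z ∧ G z < c}
          {z : ℂ × ℂ | 0 < G z ∧ G z < c}) ∧
      (∀ z ∈ {z : ℂ × ℂ | 0 < G z ∧ G z < c}, f 0 z = z) ∧
      (∀ γ γ' : ℂ, ∀ z ∈ {z : ℂ × ℂ | 0 < G z ∧ G z < c},
        f (γ + γ') z = f γ (f γ' z)) ∧
      (∀ γ γ' : ℂ, γ ≠ γ' →
        ∃ z ∈ {z : ℂ × ℂ | 0 < G z ∧ G z < c}, f γ z ≠ f γ' z) := by
  obtain ⟨R, B, hD⟩ := HenonFlow.exists_data d hd a ha p hpm hpd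
  obtain rfl : H = HenonFlow.hen a p := funext hH
  have hG : HenonFlow.IsGreen a p d G := hGlim
  have hl : a / (d : ℂ) ≠ 0 :=
    div_ne_zero ha (by exact_mod_cast (by omega : d ≠ 0))
  set l := a / (d : ℂ)
  have hadd : ∀ γ γ' : ℂ, ∀ z ∈ {z : ℂ × ℂ | 0 < G z ∧ G z < c},
      HenonFlow.flow a l p (γ + γ') z =
        HenonFlow.flow a l p γ (HenonFlow.flow a l p γ' z) := by
    intro γ γ' z hz
    refine HenonFlow.flow_add ha (HenonFlow.good_of_pos hd hD hG γ' hz.1)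
      (HenonFlow.good_of_pos hd hD hG γ ?_)
    rw [HenonFlow.green_flow hd hD hG γ' hz.1]
    exact hz.1
  have hmaps : ∀ γ : ℂ, Set.MapsTo (HenonFlow.flow a l p γ) {z : ℂ × ℂ | 0 < G z ∧ G z < c}
      {z : ℂ × ℂ | 0 < G z ∧ G z < c} := by
    intro γ z hz
    simp only [Set.mem_setOf_eq]
    rw [HenonFlow.green_flow hd hD hG γ hz.1]
    exact hz
  have hdiff : ∀ γ : ℂ, DifferentiableOn ℂ (HenonFlow.flow a l p γ)
      {z : ℂ × ℂ | 0 < G z ∧ G z < c} := fun γ z hz =>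
    (HenonFlow.good_of_pos hd hD hG γ hz.1).1.differentiableWithinAt
  refine ⟨fun γ => HenonFlow.flow a l p γ, fun γ => ⟨HenonFlow.flow a l p (-γ), hdiff γ,
    hdiff (-γ), hmaps γ, hmaps (-γ), ?_, ?_⟩, ?_, hadd, ?_⟩
  · intro z hz
    rw [← hadd _ _ z hz, neg_add_cancel, HenonFlow.flow_zero ha]
  · intro z hz
    simp only []
    rw [← hadd _ _ z hz, add_neg_cancel, HenonFlow.flow_zero ha]
  · intro z _
    exact HenonFlow.flow_zero ha z
  · intro γ γ' hne
    obtain ⟨z, hz⟩ := HenonFlow.exists_mem hd hD hG hc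
    refine ⟨z, hz, fun heq => ?_⟩
    refine HenonFlow.flow_free hd hl hD hG (sub_ne_zero.2 hne) hz.1 ?_
    have h1 : HenonFlow.flow a l p (-γ') (HenonFlow.flow a l p γ z) = z := by
      have heq' : HenonFlow.flow a l p γ z = HenonFlow.flow a l p γ' z := heq
      rw [heq', ← hadd _ _ z hz, neg_add_cancel, HenonFlow.flow_zero ha]
    rw [sub_eq_neg_add, hadd _ _ z hz, h1]
end
end
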